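/- Let E be an m-dimensional primitive extremal subset of an Alexandrov space M. Then the set of regular points of E (points whose extrinsic tangent cone T_pE is isometric to ℝ^m) is dense in E, and the complement of the regular set has Hausdorff dimension at most m − 1. -/

import Mathlib

open Real Metric Set
open scoped ENNReal NNReal

noncomputable section

/-- The comparison angle in the `κ`-plane at the vertex between sides of
lengths `s` and `t`, opposite side of length `d`. -/
def cangleK (κ s t d : ℝ) : ℝ :=
  if 0 < κ then
    Real.arccos ((Real.cos (Real.sqrt κ * d) - Real.cos (Real.sqrt κ * s) * Real.cos (Real.sqrt κ * t)) /
      (Real.sin (Real.sqrt κ * s) * Real.sin (Real.sqrt κ * t)))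
  else if κ < 0 then
    Real.arccos ((Real.cosh (Real.sqrt (-κ) * s) * Real.cosh (Real.sqrt (-κ) * t) -
      Real.cosh (Real.sqrt (-κ) * d)) /
      (Real.sinh (Real.sqrt (-κ) * s) * Real.sinh (Real.sqrt (-κ) * t)))
  else Real.arccos ((s ^ 2 + t ^ 2 - d ^ 2) / (2 * s * t))

/-- The comparison angle `∠̃ q p r` at `p` in the `κ`-plane. -/
def cangle {X : Type*} [MetricSpace X] (κ : ℝ) (q p r : X) : ℝ :=
  cangleK κ (dist p q) (dist p r) (dist q r)

/-- A `(k,δ)`-strainer at `p` (comparison angles taken in the `κ`-plane). -/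
def IsStrainer {X : Type*} [MetricSpace X] (κ : ℝ) {k : ℕ} (a b : Fin k → X) (p : X)
    (δ : ℝ) : Prop :=
  (∀ i, π - δ < cangle κ (a i) p (b i)) ∧
  ∀ i j, i ≠ j →
    π / 2 - δ < cangle κ (a i) p (a j) ∧
    π / 2 - δ < cangle κ (a i) p (b j) ∧
    π / 2 - δ < cangle κ (b i) p (b j)

/-- A `(k,δ)`-strained point. -/
def IsStrainedPt {X : Type*} [MetricSpace X] (κ : ℝ) (k : ℕ) (δ : ℝ) (p : X) : Prop :=
  ∃ a b : Fin k → X, IsStrainer κ a b p δ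

/-- An Alexandrov space of curvature `≥ κ`: complete, geodesic (via midpoints), and the
sum of the three `κ`-comparison angles of any quadruple is at most `2π`. -/
def IsAlexandrov (X : Type*) [MetricSpace X] (κ : ℝ) : Prop :=
  CompleteSpace X ∧
  (∀ x y : X, ∃ z : X, dist x z = dist x y / 2 ∧ dist z y = dist x y / 2) ∧
  ∀ p q r s : X, q ≠ p → r ≠ p → s ≠ p →
    cangle κ q p r + cangle κ r p s + cangle κ s p q ≤ 2 * π

/-- `p` is a critical point of `dist q`. -/
def IsCriticalPt {X : Type*} [MetricSpace X] (κ : ℝ) (q p : X) : Prop :=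
  ∀ x : X, x ≠ p → cangle κ q p x ≤ π / 2

/-- An extremal subset: closed, and every local minimum point `p ∈ E` of `dist q|_E`
with `q ∉ E` is a critical point of `dist q`. -/
def IsExtremal {X : Type*} [MetricSpace X] (κ : ℝ) (E : Set X) : Prop :=
  IsClosed E ∧
  ∀ q ∉ E, ∀ p ∈ E, IsLocalMinOn (fun x => dist q x) E p → IsCriticalPt κ q p

/-- A primitive extremal subset: an extremal subset containing no proper extremal
subset with nonempty relative interior. -/
def IsPrimitiveExtremal {X : Type*} [MetricSpace X] (κ : ℝ) (E : Set X) : Prop :=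
  IsExtremal κ E ∧
  ∀ F : Set X, IsExtremal κ F → F ⊆ E → F ≠ E →
    ∀ x ∈ F, ¬ ∃ r > (0:ℝ), Metric.ball x r ∩ E ⊆ F

/-- `p` is a regular point of `E` of dimension `m`: the tangent cone of `E` at `p`
(with the extrinsic metric) is isometric to `ℝ^m`, expressed through blow-ups:
balls of `E` around `p` at scale `r` are `εr`-approximated by `r`-balls of `ℝ^m`. -/
def IsRegularPt {X : Type*} [MetricSpace X] (E : Set X) (m : ℕ) (p : X) : Prop :=
  ∀ ε > (0:ℝ), ∃ r₀ > (0:ℝ), ∀ r, 0 < r → r < r₀ →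
    ∃ f : X → EuclideanSpace ℝ (Fin m),
      f p = 0 ∧
      (∀ x ∈ E ∩ Metric.closedBall p r, ∀ y ∈ E ∩ Metric.closedBall p r,
        |dist (f x) (f y) - dist x y| ≤ ε * r) ∧
      (∀ v ∈ Metric.closedBall (0 : EuclideanSpace ℝ (Fin m)) r,
        ∃ x ∈ E ∩ Metric.closedBall p r, dist (f x) v ≤ ε * r)

/-- The intrinsic (induced length) extended distance on a subset `E`. -/
def intrinsicEDist {X : Type*} [MetricSpace X] (E : Set X) (x y : X) : ℝ≥0∞ :=
  ⨅ (γ : ℝ → X) (_ : ContinuousOn γ (Set.Icc 0 1)) (_ : γ 0 = x) (_ : γ 1 = y)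
    (_ : ∀ t ∈ Set.Icc (0:ℝ) 1, γ t ∈ E), eVariationOn γ (Set.Icc 0 1)

/-- Diameter of a set with respect to an abstract extended distance. -/
def ediamOn {X : Type*} (ρ : X → X → ℝ≥0∞) (s : Set X) : ℝ≥0∞ :=
  ⨆ x ∈ s, ⨆ y ∈ s, ρ x y

/-- The `m`-dimensional Hausdorff measure of `S` with respect to an abstract
extended distance `ρ`. -/
def hMeas {X : Type*} (ρ : X → X → ℝ≥0∞) (m : ℝ) (S : Set X) : ℝ≥0∞ :=
  ⨆ (ε : ℝ≥0∞) (_ : 0 < ε),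
    ⨅ (t : ℕ → Set X) (_ : S ⊆ ⋃ n, t n) (_ : ∀ n, ediamOn ρ (t n) ≤ ε),
      ∑' n, ediamOn ρ (t n) ^ m

end

namespace Alexandrov

variable {X : Type*} [MetricSpace X] {κ : ℝ}

/-- The generalized sine of curvature `κ` (unnormalized). -/
noncomputable def snK (κ x : ℝ) : ℝ :=
  if 0 < κ then Real.sin (Real.sqrt κ * x)
  else if κ < 0 then Real.sinh (Real.sqrt (-κ) * x) else x

lemma cangleK_eq {κ s t : ℝ} (d : ℝ) (h : snK κ s * snK κ t ≠ 0) :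
    cangleK κ s t d = Real.arccos (1 - 2 * snK κ ((d + s - t) / 2) * snK κ ((d - s + t) / 2) /
      (snK κ s * snK κ t)) := by
  unfold cangleK
  unfold snK at *
  split_ifs at * with h1 h2
  · congr 1
    have e : Real.cos (√κ * d) = Real.cos (√κ * ((d + s - t) / 2) + √κ * ((d - s + t) / 2)) := by
      congr 1; ring
    have e2 : Real.cos (√κ * s - √κ * t) =
        Real.cos (√κ * ((d + s - t) / 2) - √κ * ((d - s + t) / 2)) := by congr 1; ring
    rw [Real.cos_sub, Real.cos_sub] at e2
    rw [Real.cos_add] at e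
    rw [eq_sub_iff_add_eq, ← add_div, div_eq_one_iff_eq h]
    linarith
  · congr 1
    have e : Real.cosh (√(-κ) * d) =
        Real.cosh (√(-κ) * ((d + s - t) / 2) + √(-κ) * ((d - s + t) / 2)) := by
      congr 1; ring
    have e2 : Real.cosh (√(-κ) * s - √(-κ) * t) =
        Real.cosh (√(-κ) * ((d + s - t) / 2) - √(-κ) * ((d - s + t) / 2)) := by congr 1; ring
    rw [Real.cosh_sub, Real.cosh_sub] at e2
    rw [Real.cosh_add] at e
    rw [eq_sub_iff_add_eq, ← add_div, div_eq_one_iff_eq h]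
    linarith
  · congr 1
    have hs : s ≠ 0 := left_ne_zero_of_mul h
    have ht : t ≠ 0 := right_ne_zero_of_mul h
    field_simp
    ring

lemma cangleK_of_eq_zero {κ s t : ℝ} (d : ℝ) (h : snK κ s * snK κ t = 0) :
    cangleK κ s t d = π / 2 := by
  unfold cangleK
  unfold snK at h
  split_ifs at * with h1 h2
  · rw [h, div_zero, Real.arccos_zero]
  · rw [h, div_zero, Real.arccos_zero]
  · rw [mul_assoc, h, mul_zero, div_zero, Real.arccos_zero]

lemma continuous_snK (κ : ℝ) : Continuous (snK κ) := by
  unfold snK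
  split_ifs <;> fun_prop

lemma snK_zero (κ : ℝ) : snK κ 0 = 0 := by
  unfold snK
  split_ifs <;> simp

/-- The derivative of `snK` at the origin. -/
noncomputable def dsnK (κ : ℝ) : ℝ :=
  if 0 < κ then Real.sqrt κ else if κ < 0 then Real.sqrt (-κ) else 1

lemma dsnK_pos (κ : ℝ) : 0 < dsnK κ := by
  unfold dsnK
  split_ifs with h1 h2
  · exact Real.sqrt_pos.2 h1
  · exact Real.sqrt_pos.2 (by linarith)
  · exact one_pos

lemma hasDerivAt_snK (κ : ℝ) : HasDerivAt (snK κ) (dsnK κ) 0 := by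
  unfold snK dsnK
  split_ifs with h1 h2
  · have := ((hasDerivAt_id (0:ℝ)).const_mul (√κ)).sin
    simpa using this
  · have := ((hasDerivAt_id (0:ℝ)).const_mul (√(-κ))).sinh
    simpa using this
  · exact hasDerivAt_id 0

lemma sin_ratio {u s : ℝ} (hu : 0 ≤ u) (hus : u ≤ s) (hs : 0 < s) (hsπ : s ≤ π) :
    u / s * Real.sin s ≤ Real.sin u := by
  have h := strictConcaveOn_sin_Icc.concaveOn.2 (show (0:ℝ) ∈ Icc 0 π from ⟨le_rfl, pi_pos.le⟩)
    (show s ∈ Icc 0 π from ⟨hs.le, hsπ⟩)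
    (show 0 ≤ 1 - u / s by rw [sub_nonneg, div_le_one hs]; exact hus)
    (show 0 ≤ u / s by positivity)
    (by ring)
  simp only [smul_eq_mul, mul_zero, zero_add, Real.sin_zero] at h
  rwa [div_mul_cancel₀ _ hs.ne'] at h

lemma sinh_ratio {u s : ℝ} (hu : 0 ≤ u) (hus : u ≤ s) (hs : 0 < s) :
    Real.sinh u ≤ u / s * Real.sinh s := by
  have hc : ConvexOn ℝ (Ici 0) Real.sinh := by
    apply MonotoneOn.convexOn_of_deriv (convex_Ici 0) Real.continuous_sinh.continuousOn
      Real.differentiable_sinh.differentiableOn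
    rw [Real.deriv_sinh]
    intro x hx y hy hxy
    simp only [interior_Ici, mem_Ioi] at hx hy
    exact Real.cosh_le_cosh.2 (by rw [abs_of_pos hx, abs_of_pos hy]; exact hxy)
  have h := hc.2 (mem_Ici.2 (le_refl (0:ℝ))) (mem_Ici.2 hs.le)
    (show 0 ≤ 1 - u / s by rw [sub_nonneg, div_le_one hs]; exact hus)
    (show 0 ≤ u / s by positivity)
    (by ring)
  simp only [smul_eq_mul, mul_zero, zero_add, Real.sinh_zero] at h
  rwa [div_mul_cancel₀ _ hs.ne'] at h

/-- The cosine of the hyperbolic comparison angle, for curvature `-k²`. -/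
noncomputable def hcos (k s t d : ℝ) : ℝ :=
  1 - 2 * Real.sinh (k * ((d + s - t) / 2)) * Real.sinh (k * ((d - s + t) / 2)) /
      (Real.sinh (k * s) * Real.sinh (k * t))

lemma hcos_eq {k s t d : ℝ} (hk : 0 < k) (hs : 0 < s) (ht : 0 < t) :
    hcos k s t d = (Real.cosh (k * s) * Real.cosh (k * t) - Real.cosh (k * d)) /
      (Real.sinh (k * s) * Real.sinh (k * t)) := by
  have h : Real.sinh (k * s) * Real.sinh (k * t) ≠ 0 := by
    have h1 : 0 < Real.sinh (k * s) := Real.sinh_pos_iff.2 (by positivity)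
    have h2 : 0 < Real.sinh (k * t) := Real.sinh_pos_iff.2 (by positivity)
    positivity
  unfold hcos
  have e : Real.cosh (k * d) =
      Real.cosh (k * ((d + s - t) / 2) + k * ((d - s + t) / 2)) := by
    congr 1; ring
  have e2 : Real.cosh (k * s - k * t) =
      Real.cosh (k * ((d + s - t) / 2) - k * ((d - s + t) / 2)) := by congr 1; ring
  rw [Real.cosh_sub, Real.cosh_sub] at e2
  rw [Real.cosh_add] at e
  symm
  rw [eq_sub_iff_add_eq, ← add_div, div_eq_one_iff_eq h]
  linarith

lemma hcos_mem {k s t d : ℝ} (hk : 0 < k) (hs : 0 < s) (ht : 0 < t) (h1 : d ≤ s + t)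
    (h2 : s ≤ d + t) (h3 : t ≤ d + s) : -1 ≤ hcos k s t d ∧ hcos k s t d ≤ 1 := by
  have p1 : 0 < Real.sinh (k * s) := Real.sinh_pos_iff.2 (by positivity)
  have p2 : 0 < Real.sinh (k * t) := Real.sinh_pos_iff.2 (by positivity)
  have q1 : 0 ≤ Real.sinh (k * ((d + s - t) / 2)) :=
    Real.sinh_nonneg_iff.2 (mul_nonneg hk.le (by linarith))
  have q2 : 0 ≤ Real.sinh (k * ((d - s + t) / 2)) :=
    Real.sinh_nonneg_iff.2 (mul_nonneg hk.le (by linarith))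
  have r1 : Real.sinh (k * ((d + s - t) / 2)) ≤ Real.sinh (k * s) :=
    Real.sinh_le_sinh.2 (by gcongr; linarith)
  have r2 : Real.sinh (k * ((d - s + t) / 2)) ≤ Real.sinh (k * t) :=
    Real.sinh_le_sinh.2 (by gcongr; linarith)
  unfold hcos
  constructor
  · have : 2 * Real.sinh (k * ((d + s - t) / 2)) * Real.sinh (k * ((d - s + t) / 2)) /
      (Real.sinh (k * s) * Real.sinh (k * t)) ≤ 2 := by
      rw [div_le_iff₀ (by positivity), mul_assoc]
      gcongr
    linarith
  · have : 0 ≤ 2 * Real.sinh (k * ((d + s - t) / 2)) * Real.sinh (k * ((d - s + t) / 2)) /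
      (Real.sinh (k * s) * Real.sinh (k * t)) := by positivity
    linarith

/-- The cosine of the Euclidean comparison angle. -/
noncomputable def ecos (s t d : ℝ) : ℝ := (s ^ 2 + t ^ 2 - d ^ 2) / (2 * s * t)

lemma ecos_eq {s t d : ℝ} (hs : 0 < s) (ht : 0 < t) :
    ecos s t d = 1 - 2 * ((d + s - t) / 2 / s) * ((d - s + t) / 2 / t) := by
  unfold ecos
  field_simp
  ring

lemma ecos_le_hcos {k s t d : ℝ} (hk : 0 < k) (hs : 0 < s) (ht : 0 < t) (h1 : d ≤ s + t)
    (h2 : s ≤ d + t) (h3 : t ≤ d + s) : ecos s t d ≤ hcos k s t d := by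
  have p1 : 0 < Real.sinh (k * s) := Real.sinh_pos_iff.2 (by positivity)
  have p2 : 0 < Real.sinh (k * t) := Real.sinh_pos_iff.2 (by positivity)
  have q1 : 0 ≤ Real.sinh (k * ((d + s - t) / 2)) :=
    Real.sinh_nonneg_iff.2 (mul_nonneg hk.le (by linarith))
  have q2 : 0 ≤ Real.sinh (k * ((d - s + t) / 2)) :=
    Real.sinh_nonneg_iff.2 (mul_nonneg hk.le (by linarith))
  have r1 := sinh_ratio (u := k * ((d + s - t) / 2)) (s := k * s)
    (mul_nonneg hk.le (by linarith)) (by gcongr; linarith) (by positivity)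
  have r2 := sinh_ratio (u := k * ((d - s + t) / 2)) (s := k * t)
    (mul_nonneg hk.le (by linarith)) (by gcongr; linarith) (by positivity)
  rw [mul_div_mul_left _ _ hk.ne'] at r1 r2
  rw [ecos_eq hs ht, hcos, mul_assoc, mul_assoc, mul_div_assoc, mul_div_mul_comm]
  have s1 : Real.sinh (k * ((d + s - t) / 2)) / Real.sinh (k * s) ≤ (d + s - t) / 2 / s := by
    rwa [div_le_iff₀ p1]
  have s2 : Real.sinh (k * ((d - s + t) / 2)) / Real.sinh (k * t) ≤ (d - s + t) / 2 / t := by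
    rwa [div_le_iff₀ p2]
  have := mul_le_mul s1 s2 (by positivity) (by
    apply div_nonneg _ hs.le; linarith)
  linarith

lemma sinh_le_mul {x M : ℝ} (hx : 0 ≤ x) (hM : Real.cosh x ≤ M) : Real.sinh x ≤ M * x := by
  have : Real.sinh x ≤ x * Real.cosh x := by
    rcases hx.eq_or_lt with rfl | hx
    · simp
    obtain ⟨c, hc, hc'⟩ := exists_deriv_eq_slope Real.sinh hx Real.continuous_sinh.continuousOn
      Real.differentiable_sinh.differentiableOn
    rw [Real.deriv_sinh, Real.sinh_zero, sub_zero, sub_zero, eq_div_iff hx.ne'] at hc'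
    rw [← hc', mul_comm]
    gcongr
    exact Real.cosh_le_cosh.2 (by rw [abs_of_pos hc.1, abs_of_pos hx]; exact hc.2.le)
  nlinarith

lemma hcos_le_ecos_add {k s t d M : ℝ} (hk : 0 < k) (hs : 0 < s) (ht : 0 < t) (h1 : d ≤ s + t)
    (h2 : s ≤ d + t) (h3 : t ≤ d + s) (hM : Real.cosh (k * s) ≤ M) (hM' : Real.cosh (k * t) ≤ M) :
    hcos k s t d ≤ ecos s t d + 2 * (M ^ 2 - 1) := by
  have hM1 : 1 ≤ M := (Real.one_le_cosh _).trans hM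
  have p1 : 0 < Real.sinh (k * s) := Real.sinh_pos_iff.2 (by positivity)
  have p2 : 0 < Real.sinh (k * t) := Real.sinh_pos_iff.2 (by positivity)
  have u0 : 0 ≤ (d + s - t) / 2 := by linarith
  have v0 : 0 ≤ (d - s + t) / 2 := by linarith
  have q1 : k * ((d + s - t) / 2) ≤ Real.sinh (k * ((d + s - t) / 2)) :=
    Real.self_le_sinh_iff.2 (mul_nonneg hk.le u0)
  have q2 : k * ((d - s + t) / 2) ≤ Real.sinh (k * ((d - s + t) / 2)) :=
    Real.self_le_sinh_iff.2 (mul_nonneg hk.le v0)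
  have r1 := sinh_le_mul (by positivity) hM
  have r2 := sinh_le_mul (by positivity) hM'
  rw [ecos_eq hs ht, hcos, mul_assoc, mul_assoc, mul_div_assoc, mul_div_mul_comm]
  have s1 : (d + s - t) / 2 / s ≤ M * (Real.sinh (k * ((d + s - t) / 2)) / Real.sinh (k * s)) := by
    rw [← mul_div_assoc, div_le_div_iff₀ hs p1]
    calc (d + s - t) / 2 * Real.sinh (k * s) ≤ (d + s - t) / 2 * (M * (k * s)) := by gcongr
      _ = M * (k * ((d + s - t) / 2)) * s := by ring
      _ ≤ _ := by gcongr
  have s2 : (d - s + t) / 2 / t ≤ M * (Real.sinh (k * ((d - s + t) / 2)) / Real.sinh (k * t)) := by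
    rw [← mul_div_assoc, div_le_div_iff₀ ht p2]
    calc (d - s + t) / 2 * Real.sinh (k * t) ≤ (d - s + t) / 2 * (M * (k * t)) := by gcongr
      _ = M * (k * ((d - s + t) / 2)) * t := by ring
      _ ≤ _ := by gcongr
  set A := Real.sinh (k * ((d + s - t) / 2)) / Real.sinh (k * s)
  set B := Real.sinh (k * ((d - s + t) / 2)) / Real.sinh (k * t)
  have hA : A ≤ 1 := by
    rw [div_le_one p1]; exact Real.sinh_le_sinh.2 (by gcongr; linarith)
  have hB : B ≤ 1 := by
    rw [div_le_one p2]; exact Real.sinh_le_sinh.2 (by gcongr; linarith)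
  have hA0 : 0 ≤ A := div_nonneg ((mul_nonneg hk.le u0).trans q1) p1.le
  have hB0 : 0 ≤ B := div_nonneg ((mul_nonneg hk.le v0).trans q2) p2.le
  have := mul_le_mul s1 s2 (div_nonneg v0 ht.le) (by positivity)
  have hAB : A * B ≤ 1 := mul_le_one₀ hA hB0 hB
  nlinarith [sq_nonneg (M-1)]

lemma snK_pos {κ s : ℝ} (hs : 0 < s) (h : Real.sqrt κ * s < π) : 0 < snK κ s := by
  unfold snK
  split_ifs with h1 h2
  · have : 0 < √κ := Real.sqrt_pos.2 h1
    exact Real.sin_pos_of_pos_of_lt_pi (by positivity) h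
  · have : 0 < √(-κ) := Real.sqrt_pos.2 (by linarith)
    exact Real.sinh_pos_iff.2 (by positivity)
  · exact hs

/-- An admissible comparison constant: the curvature is at least `-k²`. -/
noncomputable def cmpK (κ : ℝ) : ℝ := if κ < 0 then Real.sqrt (-κ) else 1

lemma cmpK_pos (κ : ℝ) : 0 < cmpK κ := by
  unfold cmpK
  split_ifs with h
  · exact Real.sqrt_pos.2 (by linarith)
  · exact one_pos

lemma arccos_hcos_le_cangleK {κ s t d : ℝ} (hs : 0 < s) (ht : 0 < t) (h1 : d ≤ s + t)
    (h2 : s ≤ d + t) (h3 : t ≤ d + s) (hs' : Real.sqrt κ * s < π) (ht' : Real.sqrt κ * t < π) :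
    Real.arccos (hcos (cmpK κ) s t d) ≤ cangleK κ s t d := by
  have n : snK κ s * snK κ t ≠ 0 := (mul_pos (snK_pos hs hs') (snK_pos ht ht')).ne'
  rw [cangleK_eq d n]
  apply Real.antitone_arccos
  by_cases hκ : κ < 0
  · simp [hcos, cmpK, snK, hκ, not_lt.2 hκ.le]
  refine le_trans ?_ (ecos_le_hcos (cmpK_pos κ) hs ht h1 h2 h3)
  rw [ecos_eq hs ht]
  unfold snK
  rw [if_neg hκ, if_neg hκ, if_neg hκ, if_neg hκ]
  split_ifs with h0
  · have k0 : 0 < √κ := Real.sqrt_pos.2 h0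
    have p1 : 0 < Real.sin (√κ * s) := Real.sin_pos_of_pos_of_lt_pi (by positivity) hs'
    have p2 : 0 < Real.sin (√κ * t) := Real.sin_pos_of_pos_of_lt_pi (by positivity) ht'
    have r1 := sin_ratio (u := √κ * ((d + s - t) / 2)) (s := √κ * s)
      (mul_nonneg k0.le (by linarith)) (by gcongr; linarith) (by positivity) hs'.le
    have r2 := sin_ratio (u := √κ * ((d - s + t) / 2)) (s := √κ * t)
      (mul_nonneg k0.le (by linarith)) (by gcongr; linarith) (by positivity) ht'.le
    rw [mul_div_mul_left _ _ k0.ne', ← le_div_iff₀ p1] at r1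
    rw [mul_div_mul_left _ _ k0.ne', ← le_div_iff₀ p2] at r2
    have a0 : 0 ≤ (d + s - t) / 2 / s := div_nonneg (by linarith) hs.le
    have b0 : 0 ≤ (d - s + t) / 2 / t := div_nonneg (by linarith) ht.le
    rw [mul_assoc, mul_assoc, mul_div_assoc, mul_div_mul_comm]
    have := mul_le_mul r1 r2 b0 (a0.trans r1)
    linarith
  · apply le_of_eq
    field_simp

lemma cangle_comm (κ : ℝ) (q p r : X) : cangle κ q p r = cangle κ r p q := by
  unfold cangle cangleK
  rw [dist_comm q r, mul_comm (Real.cos _) (Real.cos _), mul_comm (Real.sin _) (Real.sin _),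
    mul_comm (Real.cosh _) (Real.cosh _), mul_comm (Real.sinh _) (Real.sinh _),
    add_comm (dist p q ^ 2), mul_right_comm]

/-- A scale below which comparison with curvature `-(cmpK κ)²` is available. -/
noncomputable def scale (κ : ℝ) : ℝ := π / (Real.sqrt κ + 1)

lemma scale_pos (κ : ℝ) : 0 < scale κ := by unfold scale; positivity

lemma sqrt_mul_lt_pi {κ s : ℝ} (h0 : 0 ≤ s) (h : s < scale κ) : Real.sqrt κ * s < π := by
  unfold scale at h
  rw [lt_div_iff₀ (by positivity)] at h
  nlinarith

/-- Cosine of the hyperbolic comparison angle at `p`. -/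
noncomputable def hang (κ : ℝ) (q p r : X) : ℝ := hcos (cmpK κ) (dist p q) (dist p r) (dist q r)

/-- Cosine of the Euclidean comparison angle at `p`. -/
noncomputable def eang (q p r : X) : ℝ := ecos (dist p q) (dist p r) (dist q r)

lemma dist_tri3 (p q r : X) : dist q r ≤ dist p q + dist p r ∧ dist p q ≤ dist q r + dist p r ∧
    dist p r ≤ dist q r + dist p q := by
  refine ⟨dist_triangle_left _ _ _, ?_, ?_⟩
  · rw [add_comm, dist_comm q r]; exact dist_triangle _ _ _
  · rw [add_comm]; exact dist_triangle _ _ _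

lemma arccos_hang_le {q p r : X} (hq : q ≠ p) (hr : r ≠ p) (hq' : dist p q < scale κ)
    (hr' : dist p r < scale κ) : Real.arccos (hang κ q p r) ≤ cangle κ q p r := by
  obtain ⟨h1, h2, h3⟩ := dist_tri3 p q r
  exact arccos_hcos_le_cangleK (dist_pos.2 hq.symm) (dist_pos.2 hr.symm) h1 h2 h3
    (sqrt_mul_lt_pi dist_nonneg hq') (sqrt_mul_lt_pi dist_nonneg hr')

lemma hang_mem {q p r : X} (hq : q ≠ p) (hr : r ≠ p) :
    -1 ≤ hang κ q p r ∧ hang κ q p r ≤ 1 := by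
  obtain ⟨h1, h2, h3⟩ := dist_tri3 p q r
  exact hcos_mem (cmpK_pos κ) (dist_pos.2 hq.symm) (dist_pos.2 hr.symm) h1 h2 h3

lemma four_point (hX : IsAlexandrov X κ) {p q r s : X} (hq : q ≠ p) (hr : r ≠ p) (hs : s ≠ p)
    (hq' : dist p q < scale κ) (hr' : dist p r < scale κ) (hs' : dist p s < scale κ) :
    Real.arccos (hang κ q p r) + Real.arccos (hang κ r p s) + Real.arccos (hang κ q p s)
      ≤ 2 * π := by
  have h := hX.2.2 p q r s hq hr hs
  have h1 := arccos_hang_le hq hr hq' hr'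
  have h2 := arccos_hang_le hr hs hr' hs'
  have h3 := arccos_hang_le hq hs hq' hs'
  rw [cangle_comm κ s p q] at h
  linarith

/-- Rescaled hyperbolic cosine. -/
noncomputable def ch (κ x : ℝ) : ℝ := Real.cosh (cmpK κ * x)
/-- Rescaled hyperbolic sine. -/
noncomputable def sh (κ x : ℝ) : ℝ := Real.sinh (cmpK κ * x)

lemma sh_pos {x : ℝ} (hx : 0 < x) : 0 < sh κ x :=
  Real.sinh_pos_iff.2 (mul_pos (cmpK_pos κ) hx)
lemma sh_nonneg {x : ℝ} (hx : 0 ≤ x) : 0 ≤ sh κ x :=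
  Real.sinh_nonneg_iff.2 (mul_nonneg (cmpK_pos κ).le hx)
lemma ch_pos (x : ℝ) : 0 < ch κ x := Real.cosh_pos _
lemma one_le_ch (x : ℝ) : 1 ≤ ch κ x := Real.one_le_cosh _
lemma ch_le_ch {x y : ℝ} (hx : 0 ≤ x) (h : x ≤ y) : ch κ x ≤ ch κ y := by
  have := cmpK_pos κ
  apply Real.cosh_le_cosh.2
  rw [abs_of_nonneg (by positivity), abs_of_nonneg (by have := hx.trans h; positivity)]
  gcongr
lemma ch_lt_ch {x y : ℝ} (hx : 0 ≤ x) (h : x < y) : ch κ x < ch κ y := by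
  have := cmpK_pos κ
  apply Real.cosh_lt_cosh.2
  rw [abs_of_nonneg (by positivity), abs_of_nonneg (by have := hx.trans h.le; positivity)]
  gcongr
lemma sh_le_sh {x y : ℝ} (h : x ≤ y) : sh κ x ≤ sh κ y := by
  have := cmpK_pos κ
  exact Real.sinh_le_sinh.2 (by gcongr)
lemma ch_zero : ch κ 0 = 1 := by simp [ch]
lemma sh_zero : sh κ 0 = 0 := by simp [sh]
lemma ch_add (x y : ℝ) : ch κ (x + y) = ch κ x * ch κ y + sh κ x * sh κ y := by
  simp [ch, sh, mul_add, Real.cosh_add]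
lemma ch_sub (x y : ℝ) : ch κ (x - y) = ch κ x * ch κ y - sh κ x * sh κ y := by
  simp [ch, sh, mul_sub, Real.cosh_sub]
lemma sh_add (x y : ℝ) : sh κ (x + y) = sh κ x * ch κ y + ch κ x * sh κ y := by
  simp [ch, sh, mul_add, Real.sinh_add]
lemma sh_sub (x y : ℝ) : sh κ (x - y) = sh κ x * ch κ y - ch κ x * sh κ y := by
  simp [ch, sh, mul_sub, Real.sinh_sub]
lemma ch_sq (x : ℝ) : ch κ x ^ 2 = sh κ x ^ 2 + 1 := Real.cosh_sq _
lemma continuous_ch : Continuous (ch κ) := by unfold ch; fun_prop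

lemma hang_eq {q p r : X} (hq : q ≠ p) (hr : r ≠ p) :
    hang κ q p r = (ch κ (dist p q) * ch κ (dist p r) - ch κ (dist q r)) /
      (sh κ (dist p q) * sh κ (dist p r)) :=
  hcos_eq (cmpK_pos κ) (dist_pos.2 hq.symm) (dist_pos.2 hr.symm)

lemma neg_le_of_arccos_add_le {a b ω : ℝ} (hω : 0 ≤ ω) (ha : -1 ≤ a) (ha' : a ≤ 1) (hb : -1 ≤ b)
    (hb' : b ≤ 1) (h : Real.arccos a + Real.arccos b ≤ π + ω) : -ω ≤ a + b := by
  have e1 := Real.cos_arccos ha ha'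
  have e2 := Real.cos_arccos hb hb'
  set A := Real.arccos a with hA
  set B := Real.arccos b with hB
  have A0 : 0 ≤ A := Real.arccos_nonneg _
  have B0 : 0 ≤ B := Real.arccos_nonneg _
  have Aπ : A ≤ π := Real.arccos_le_pi _
  have Bπ : B ≤ π := Real.arccos_le_pi _
  by_cases hc : A + B ≤ π
  · have := Real.cos_le_cos_of_nonneg_of_le_pi A0 (y := π - B) (by linarith) (by linarith)
    rw [Real.cos_pi_sub] at this
    linarith
  · push Not at hc
    have h4 := Real.abs_sin_le_abs (x := ((A + B - π)/2))
    have : Real.cos A + Real.cos B = 2 * Real.cos ((A + B)/2) * Real.cos ((A-B)/2) :=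
      Real.cos_add_cos _ _
    have h2 : Real.cos ((A+B)/2) = - Real.sin ((A+B-π)/2) := by
      rw [show (A+B)/2 = (A+B-π)/2 + π/2 by ring, Real.cos_add_pi_div_two]
    have h3 : |Real.cos ((A+B)/2) * Real.cos ((A-B)/2)| ≤ |(A+B-π)/2| * 1 := by
      rw [abs_mul, h2, abs_neg]
      exact mul_le_mul h4 (Real.abs_cos_le_one _) (abs_nonneg _) (abs_nonneg _)
    rw [abs_of_pos (show 0 < (A+B-π)/2 by linarith)] at h3
    have := neg_abs_le (Real.cos ((A+B)/2) * Real.cos ((A-B)/2))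
    linarith

/-- Hinge comparison: `z` lies between `x` and `y`. -/
lemma hinge (hX : IsAlexandrov X κ) {x y z a : X} (hz : dist x z + dist z y = dist x y)
    (h1 : dist z x < scale κ) (h2 : dist z y < scale κ) (h3 : dist z a < scale κ) :
    sh κ (dist z y) * ch κ (dist x a) + sh κ (dist x z) * ch κ (dist y a) ≤
      ch κ (dist z a) * sh κ (dist x y) := by
  by_cases hx : x = z
  · subst hx; simp [sh_zero]; linarith
  by_cases hy : y = z
  · subst hy; simp [sh_zero]; linarith
  by_cases ha : a = z
  · subst ha
    simp only [dist_self, ch_zero, one_mul]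
    rw [← hz, sh_add, dist_comm y a]
    linarith
  have hp := four_point hX hx hy ha h1 h2 h3
  have sx : 0 < sh κ (dist z x) := sh_pos (dist_pos.2 (Ne.symm hx))
  have sy : 0 < sh κ (dist z y) := sh_pos (dist_pos.2 (Ne.symm hy))
  have sa : 0 < sh κ (dist z a) := sh_pos (dist_pos.2 (Ne.symm ha))
  have e : hang κ x z y = -1 := by
    rw [hang_eq hx hy, ← hz, ch_add, dist_comm x z]
    field_simp
    ring
  rw [e, Real.arccos_neg_one] at hp
  have h := neg_le_of_arccos_add_le (le_refl 0) (hang_mem (κ := κ) hx ha).1 (hang_mem hx ha).2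
    (hang_mem hy ha).1 (hang_mem hy ha).2 (by linarith)
  rw [hang_eq hx ha, hang_eq hy ha] at h
  rw [dist_comm x z] at *
  rw [← hz, sh_add]
  have h' := mul_le_mul_of_nonneg_right h
    (mul_nonneg (mul_nonneg sx.le sy.le) sa.le)
  have e3 : ((ch κ (dist z x) * ch κ (dist z a) - ch κ (dist x a)) /
      (sh κ (dist z x) * sh κ (dist z a)) +
    (ch κ (dist z y) * ch κ (dist z a) - ch κ (dist y a)) / (sh κ (dist z y) * sh κ (dist z a))) *
    (sh κ (dist z x) * sh κ (dist z y) * sh κ (dist z a)) =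
    (ch κ (dist z x) * ch κ (dist z a) - ch κ (dist x a)) * sh κ (dist z y) +
    (ch κ (dist z y) * ch κ (dist z a) - ch κ (dist y a)) * sh κ (dist z x) := by
    field_simp
  rw [e3] at h'
  linarith

lemma exists_cosh_bound (κ : ℝ) {ε : ℝ} (hε : 0 < ε) :
    ∃ L > 0, ∀ x, 0 ≤ x → x ≤ L → ch κ x ^ 2 - 1 ≤ ε := by
  have : Filter.Tendsto (fun x => ch κ x ^ 2 - 1) (nhds 0) (nhds (ch κ 0 ^ 2 - 1)) :=
    ((continuous_ch.pow 2).sub continuous_const).tendsto 0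
  rw [ch_zero] at this
  norm_num at this
  obtain ⟨L, hL, h⟩ := Metric.eventually_nhds_iff.1 (this.eventually (Iic_mem_nhds hε))
  refine ⟨L / 2, by positivity, fun x hx hxL => h ?_⟩
  rw [Real.dist_eq, sub_zero, abs_of_nonneg hx]
  linarith

lemma eang_le_hang {q p r : X} (hq : q ≠ p) (hr : r ≠ p) : eang q p r ≤ hang κ q p r := by
  obtain ⟨h1, h2, h3⟩ := dist_tri3 p q r
  exact ecos_le_hcos (cmpK_pos κ) (dist_pos.2 hq.symm) (dist_pos.2 hr.symm) h1 h2 h3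

/-- At small scales hyperbolic and Euclidean comparison angles are close. -/
lemma hang_le_eang (κ : ℝ) {ε : ℝ} (hε : 0 < ε) : ∃ L > 0, L < scale κ ∧
    ∀ {X : Type*} [MetricSpace X] (q p r : X), q ≠ p → r ≠ p → dist p q ≤ L → dist p r ≤ L →
      hang κ q p r ≤ eang q p r + ε := by
  obtain ⟨L, hL, h⟩ := exists_cosh_bound κ (half_pos hε)
  have hs := scale_pos κ
  refine ⟨min L (scale κ / 2), by positivity, (min_le_right _ _).trans_lt (by linarith), ?_⟩
  intro X _ y x z hy hz hy' hz'
  obtain ⟨h1, h2, h3⟩ := dist_tri3 x y z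
  have hM : max (dist x y) (dist x z) ≤ L :=
    max_le (hy'.trans (min_le_left _ _)) (hz'.trans (min_le_left _ _))
  have := hcos_le_ecos_add (cmpK_pos κ) (dist_pos.2 hy.symm) (dist_pos.2 hz.symm) h1 h2 h3
    (M := ch κ (max (dist x y) (dist x z))) (ch_le_ch dist_nonneg (le_max_left _ _))
    (ch_le_ch dist_nonneg (le_max_right _ _))
  have h4 := h (max (dist x y) (dist x z)) (le_max_of_le_left dist_nonneg) hM
  unfold hang eang
  linarith

/-- Core estimate: almost opposite directions have almost opposite cosines. -/
lemma core (hX : IsAlexandrov X κ) {ε : ℝ} (hε : 0 < ε) :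
    ∃ δ > 0, ∃ L > 0, ∀ x a b v : X, a ≠ x → b ≠ x → v ≠ x → dist x a ≤ L → dist x b ≤ L →
      dist x v ≤ L → eang a x b ≤ -1 + δ → -ε ≤ eang a x v + eang b x v := by
  obtain ⟨ω, hω0, hω1, hωε⟩ : ∃ ω : ℝ, 0 < ω ∧ ω < π ∧ ω ≤ ε / 2 :=
    ⟨min (ε / 2) 1, by positivity, (min_le_right _ _).trans_lt (by linarith [Real.pi_gt_three]),
      min_le_left _ _⟩
  have hc : 0 < 1 - Real.cos ω := by
    have := Real.cos_lt_cos_of_nonneg_of_le_pi le_rfl hω1.le hω0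
    rw [Real.cos_zero] at this; linarith
  obtain ⟨L, hL, hLs, key⟩ :=
    hang_le_eang κ (ε := min (ε / 8) ((1 - Real.cos ω) / 4)) (by positivity)
  refine ⟨(1 - Real.cos ω) / 2, by positivity, L, hL, fun x a b v ha hb hv ha' hb' hv' hab => ?_⟩
  have hsc : ∀ y : X, dist x y ≤ L → dist x y < scale κ := fun y hy => hy.trans_lt hLs
  have hp := four_point hX ha hb hv (hsc _ ha') (hsc _ hb') (hsc _ hv')
  have k1 := key a x b ha hb ha' hb'
  have k2 := key a x v ha hv ha' hv'
  have k3 := key b x v hb hv hb' hv'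
  have m1 := min_le_left (ε / 8) ((1 - Real.cos ω) / 4)
  have m2 := min_le_right (ε / 8) ((1 - Real.cos ω) / 4)
  have h5 : π - ω ≤ Real.arccos (hang κ a x b) := by
    rw [← Real.arccos_cos (x := π - ω) (by linarith) (by linarith)]
    apply Real.antitone_arccos
    rw [Real.cos_pi_sub]
    linarith
  have h6 := neg_le_of_arccos_add_le hω0.le (hang_mem (κ := κ) ha hv).1 (hang_mem ha hv).2
    (hang_mem hb hv).1 (hang_mem hb hv).2 (by linarith)
  linarith

lemma ch_le_of_critical {z x v : X} (h : IsCriticalPt κ z x) (h1 : dist x z < scale κ)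
    (h2 : dist x v < scale κ) : ch κ (dist z v) ≤ ch κ (dist z x) * ch κ (dist x v) := by
  by_cases hz : z = x
  · subst hz; simp [ch_zero]
  by_cases hv : v = x
  · subst hv; simp [ch_zero]
  have hc := (arccos_hang_le (κ := κ) hz hv h1 h2).trans (h v hv)
  rw [Real.arccos_le_pi_div_two, hang_eq hz hv] at hc
  have sz : 0 < sh κ (dist x z) := sh_pos (dist_pos.2 (Ne.symm hz))
  have sv : 0 < sh κ (dist x v) := sh_pos (dist_pos.2 (Ne.symm hv))
  rw [le_div_iff₀ (by positivity), zero_mul] at hc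
  rw [dist_comm z x]
  linarith

/-- Extremality at a nearest point. -/
lemma ch_le_of_nearest {E : Set X} (hE : IsExtremal κ E) {z x v : X} (hx : x ∈ E)
    (hmin : ∀ y ∈ E, dist z x ≤ dist z y) (h1 : dist x z < scale κ)
    (h2 : dist x v < scale κ) : ch κ (dist z v) ≤ ch κ (dist z x) * ch κ (dist x v) := by
  by_cases hz : z ∈ E
  · have : z = x := by
      have := hmin z hz
      rw [dist_self] at this
      exact dist_le_zero.1 this
    subst this
    simp [ch_zero]
  · apply ch_le_of_critical _ h1 h2
    apply hE.2 z hz x hx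
    filter_upwards [self_mem_nhdsWithin] with y hy using hmin y hy

open Filter Topology

/-- In a complete midpoint space there are points between `x` and `y` at any distance. -/
lemma exists_between (hX : IsAlexandrov X κ) (x y : X) {t : ℝ} (ht0 : 0 ≤ t)
    (ht : t ≤ dist x y) : ∃ z, dist x z = t ∧ dist z y = dist x y - t := by
  have := hX.1
  let S := {P : X × X // dist x P.1 ≤ t ∧ t ≤ dist x P.1 + dist P.1 P.2 ∧
    dist x P.1 + dist P.1 P.2 + dist P.2 y = dist x y}
  have step : ∀ P : S, ∃ P' : S, dist P'.1.1 P'.1.2 = dist P.1.1 P.1.2 / 2 ∧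
      dist P.1.1 P'.1.1 ≤ dist P.1.1 P.1.2 / 2 := by
    rintro ⟨⟨a, b⟩, h1, h2, h3⟩
    simp only at h1 h2 h3
    obtain ⟨m, m1, m2⟩ := hX.2.1 a b
    have t1 := dist_triangle x m y
    have t2 := dist_triangle x a m
    have t3 := dist_triangle m b y
    by_cases hc : t ≤ dist x a + dist a b / 2
    · exact ⟨⟨⟨a, m⟩, h1, by simp only; linarith, by simp only; linarith⟩, m1, by simp; positivity⟩
    · exact ⟨⟨⟨m, b⟩, by simp only; linarith, by simp only; linarith, by simp only; linarith⟩, m2,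
        by simp only; linarith⟩
  choose F hF1 hF2 using step
  let P0 : S := ⟨(x, y), by simp [ht0], by simpa using ht, by simp⟩
  let u : ℕ → S := fun n => F^[n] P0
  have hu : ∀ n, u (n + 1) = F (u n) := fun n => Function.iterate_succ_apply' F n P0
  have hd : ∀ n, dist (u n).1.1 (u n).1.2 = dist x y / 2 ^ n := by
    intro n
    induction n with
    | zero => simp [u, P0]
    | succ n ih => rw [hu, hF1, ih, pow_succ]; field_simp
  have hc : ∀ n, dist (u n).1.1 (u (n + 1)).1.1 ≤ dist x y / 2 / 2 ^ n := by
    intro n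
    rw [hu]
    refine (hF2 _).trans (le_of_eq ?_)
    rw [hd]; field_simp
  obtain ⟨z, hz⟩ := cauchySeq_tendsto_of_complete (cauchySeq_of_le_geometric_two hc)
  have hd0 : Tendsto (fun n : ℕ => dist x y / 2 ^ n) atTop (𝓝 0) := by
    have := (tendsto_pow_atTop_nhds_zero_of_lt_one (r := (1/2 : ℝ)) (by norm_num)
      (by norm_num)).const_mul (dist x y)
    rw [mul_zero] at this
    refine this.congr fun n => ?_
    rw [one_div, inv_pow]; rfl
  have hxz : Tendsto (fun n => dist x (u n).1.1) atTop (𝓝 (dist x z)) := tendsto_const_nhds.dist hz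
  have hzy : Tendsto (fun n => dist (u n).1.1 y) atTop (𝓝 (dist z y)) := hz.dist tendsto_const_nhds
  have e1 : dist x z ≤ t := le_of_tendsto' hxz fun n => (u n).2.1
  have e2 : t ≤ dist x z + 0 := ge_of_tendsto' (hxz.add hd0) fun n => by
    rw [← hd]; exact (u n).2.2.1
  have e3 : dist x z + dist z y ≤ dist x y := le_of_tendsto' (hxz.add hzy) fun n => by
    have := (u n).2.2.2
    have := dist_triangle (u n).1.1 (u n).1.2 y
    linarith
  have := dist_triangle x z y
  exact ⟨z, by linarith, by linarith⟩

lemma snK_monotoneOn (κ : ℝ) : ∃ η > 0, MonotoneOn (snK κ) (Icc 0 η) := by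
  by_cases h : 0 < κ
  · have h' : 0 < √κ := Real.sqrt_pos.2 h
    refine ⟨π / 2 / √κ, by positivity, fun x hx y hy hxy => ?_⟩
    simp only [snK, h, if_true]
    have hy2 := hy.2
    rw [le_div_iff₀ h'] at hy2
    have hx0 := mul_nonneg h'.le hx.1
    apply Real.sin_le_sin_of_le_of_le_pi_div_two
    · linarith [Real.pi_pos]
    · linarith
    · gcongr
  · refine ⟨1, one_pos, fun x hx y hy hxy => ?_⟩
    simp only [snK, h, if_false]
    split_ifs
    · apply Real.sinh_le_sinh.2; gcongr
    · exact hxy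

lemma tendsto_snK_div (κ a : ℝ) :
    Tendsto (fun τ => snK κ (a * τ) / τ) (𝓝[>] 0) (𝓝 (a * dsnK κ)) := by
  have h : HasDerivAt (fun τ => snK κ (a * τ)) (dsnK κ * a) 0 := by
    have h1 : HasDerivAt (fun τ : ℝ => a * τ) a 0 := by
      simpa using (hasDerivAt_id (0:ℝ)).const_mul a
    have h2 : HasDerivAt (snK κ) (dsnK κ) (a * 0) := by rw [mul_zero]; exact hasDerivAt_snK κ
    exact h2.comp 0 h1
  have h3 := hasDerivAt_iff_tendsto_slope_zero.1 h
  rw [mul_comm]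
  refine (h3.mono_left (nhdsWithin_mono _ fun x (hx : 0 < x) => hx.ne')).congr fun τ => ?_
  rw [zero_add, mul_zero, snK_zero, sub_zero, smul_eq_mul, div_eq_inv_mul]

/-- A point from which the distance to `q` cannot be increased to first order is critical. -/
lemma isCriticalPt_of_forall (hX : IsAlexandrov X κ) {q p : X} (hqp : q ≠ p)
    (h : ∀ c > 0, ∃ η > 0, ∀ y, 0 < dist p y → dist p y < η →
      dist q y < dist q p + c * dist p y) : IsCriticalPt κ q p := by
  intro w hw
  set s := dist p q with hs
  set D := dist p w with hD
  have hs0 : 0 < s := dist_pos.2 hqp.symm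
  have hD0 : 0 < D := dist_pos.2 hw.symm
  by_cases hn : snK κ s * snK κ D = 0
  · exact (cangleK_of_eq_zero _ hn).le
  have hnS : snK κ s ≠ 0 := left_ne_zero_of_mul hn
  have hnD : snK κ D ≠ 0 := right_ne_zero_of_mul hn
  have hex : ∀ τ : ℝ, ∃ y, 0 ≤ τ → τ ≤ D → dist p y = τ ∧ dist y w = D - τ := by
    intro τ
    by_cases hτ : 0 ≤ τ ∧ τ ≤ D
    · obtain ⟨z, hz⟩ := exists_between hX p w hτ.1 hτ.2
      exact ⟨z, fun _ _ => hz⟩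
    · exact ⟨p, fun h1 h2 => (hτ ⟨h1, h2⟩).elim⟩
  choose y hy using hex
  have id0 : Tendsto (fun τ : ℝ => τ) (𝓝[>] 0) (𝓝 0) := tendsto_id.mono_left nhdsWithin_le_nhds
  have evpos : ∀ᶠ τ : ℝ in 𝓝[>] 0, 0 < τ := self_mem_nhdsWithin
  have evD : ∀ᶠ τ : ℝ in 𝓝[>] 0, τ < D := id0.eventually (Iio_mem_nhds hD0)
  have hpy : ∀ᶠ τ : ℝ in 𝓝[>] 0, dist p (y τ) = τ ∧ dist (y τ) w = D - τ := by
    filter_upwards [evpos, evD] with τ h1 h2 using hy τ h1.le h2.le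
  have hyp : Tendsto y (𝓝[>] 0) (𝓝 p) := by
    rw [tendsto_iff_dist_tendsto_zero]
    refine id0.congr' ?_
    filter_upwards [hpy] with τ hτ
    rw [dist_comm, hτ.1]
  set e : ℝ → ℝ := fun τ => dist (y τ) q with he
  have hes : Tendsto e (𝓝[>] 0) (𝓝 s) := hyp.dist tendsto_const_nhds
  have cS := continuous_snK κ
  have hSe : Tendsto (fun τ => snK κ (e τ)) (𝓝[>] 0) (𝓝 (snK κ s)) := (cS.tendsto _).comp hes
  have hDτ : Tendsto (fun τ : ℝ => D - τ) (𝓝[>] 0) (𝓝 D) := by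
    simpa using tendsto_const_nhds.sub id0
  have hSD : Tendsto (fun τ => snK κ (D - τ)) (𝓝[>] 0) (𝓝 (snK κ D)) := (cS.tendsto _).comp hDτ
  have hlim : Tendsto (fun τ => cangle κ w (y τ) q) (𝓝[>] 0) (𝓝 (cangle κ w p q)) := by
    have e0 : cangle κ w p q = Real.arccos (1 - 2 * snK κ ((dist w q + D - s) / 2) *
        snK κ ((dist w q - D + s) / 2) / (snK κ D * snK κ s)) :=
      cangleK_eq _ (mul_ne_zero hnD hnS)
    rw [e0]
    have t1 : Tendsto (fun τ => snK κ ((dist w q + (D - τ) - e τ) / 2)) (𝓝[>] 0)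
        (𝓝 (snK κ ((dist w q + D - s) / 2))) :=
      (cS.tendsto _).comp (((tendsto_const_nhds.add hDτ).sub hes).div_const 2)
    have t2 : Tendsto (fun τ => snK κ ((dist w q - (D - τ) + e τ) / 2)) (𝓝[>] 0)
        (𝓝 (snK κ ((dist w q - D + s) / 2))) :=
      (cS.tendsto _).comp (((tendsto_const_nhds.sub hDτ).add hes).div_const 2)
    have := (Real.continuous_arccos.tendsto _).comp (tendsto_const_nhds (x := (1:ℝ)).sub
      (((tendsto_const_nhds (x := (2:ℝ)).mul t1).mul t2).div (hSD.mul hSe) (mul_ne_zero hnD hnS)))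
    refine this.congr' ?_
    filter_upwards [hpy, hSD.eventually_ne hnD, hSe.eventually_ne hnS] with τ h1 h2 h3
    unfold cangle
    rw [h1.2, cangleK_eq _ (mul_ne_zero h2 h3)]
    rfl
  rw [cangle_comm]
  obtain ⟨η₀, hη₀, hmono⟩ := snK_monotoneOn κ
  have key : ∀ c : ℝ, 0 < c → c < 1 → cangle κ w p q ≤ π - Real.arccos c := by
    intro c hc hc1
    obtain ⟨η, hη, hcη⟩ := h c hc
    set g : ℝ → ℝ := fun τ => snK κ ((1 - c) / 2 * τ) / snK κ τ *
      (snK κ ((s - τ + e τ) / 2) / snK κ (e τ)) with hg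
    have sv : Tendsto (fun τ => snK κ ((s - τ + e τ) / 2) / snK κ (e τ)) (𝓝[>] 0) (𝓝 1) := by
      have t2 : Tendsto (fun τ => snK κ ((s - τ + e τ) / 2)) (𝓝[>] 0)
          (𝓝 (snK κ ((s - 0 + s) / 2))) :=
        (cS.tendsto _).comp (((tendsto_const_nhds.sub id0).add hes).div_const 2)
      rw [show (s - 0 + s) / 2 = s by ring] at t2
      have := t2.div hSe hnS
      rwa [div_self hnS] at this
    have hpos : ∀ᶠ τ in 𝓝[>] (0:ℝ), 0 < snK κ τ := by
      have := tendsto_snK_div κ 1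
      rw [one_mul] at this
      filter_upwards [this.eventually (lt_mem_nhds (dsnK_pos κ)), evpos] with τ h1 h2
      rw [one_mul] at h1
      rwa [lt_div_iff₀ h2, zero_mul] at h1
    have gl : Tendsto g (𝓝[>] 0) (𝓝 ((1 - c) / 2)) := by
      have t1 := (tendsto_snK_div κ ((1 - c) / 2)).div (tendsto_snK_div κ 1)
        (by simpa using (dsnK_pos κ).ne')
      have : (1 - c) / 2 = ((1 - c) / 2 * dsnK κ) / (1 * dsnK κ) * 1 := by
        have := (dsnK_pos κ).ne'
        field_simp
      rw [this]
      refine Tendsto.mul (t1.congr' ?_) sv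
      filter_upwards [evpos] with τ h1
      simp only [Pi.div_apply, one_mul]
      rw [div_div_div_cancel_right₀ h1.ne']
    have hfin : Tendsto (fun τ => π - Real.arccos (1 - 2 * g τ)) (𝓝[>] 0)
        (𝓝 (π - Real.arccos (1 - 2 * ((1 - c) / 2)))) :=
      tendsto_const_nhds.sub ((Real.continuous_arccos.tendsto _).comp
        (tendsto_const_nhds.sub (tendsto_const_nhds.mul gl)))
    rw [show 1 - 2 * ((1 - c) / 2) = c by ring] at hfin
    refine le_of_tendsto_of_tendsto hlim hfin ?_
    filter_upwards [hpy, hSD.eventually_ne hnD, hSe.eventually_ne hnS, hpos, evpos, evD,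
      sv.eventually (lt_mem_nhds one_pos), id0.eventually (Iio_mem_nhds hη),
      id0.eventually (Iio_mem_nhds hη₀), hes.eventually (lt_mem_nhds hs0)]
      with τ h1 h2 h3 h4 h5 h6 h7 h8 h9 h10
    have hyp' : p ≠ y τ := fun hh => by rw [← hh, dist_self] at h1; linarith [h1.1]
    have hyw : w ≠ y τ := fun hh => by rw [← hh, dist_self] at h1; linarith [h1.2]
    have hyq : q ≠ y τ := fun hh => by
      simp only [he] at h10; rw [← hh, dist_self] at h10; linarith
    have h4p := hX.2.2 (y τ) p w q hyp' hyw hyq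
    have a1 : cangle κ p (y τ) w = π := by
      unfold cangle
      rw [dist_comm (y τ) p, h1.1, h1.2, cangleK_eq _ (mul_ne_zero h4.ne' h2)]
      rw [show dist p w = D from rfl, show (D + τ - (D - τ)) / 2 = τ by ring,
        show (D - τ + (D - τ)) / 2 = D - τ by ring, mul_assoc,
        mul_div_cancel_right₀ _ (mul_ne_zero h4.ne' h2)]
      norm_num
    have hey := hcη (y τ) (by rw [h1.1]; exact h5) (by rw [h1.1]; exact h8)
    rw [h1.1, dist_comm q (y τ), dist_comm q p] at hey
    have htri : s ≤ τ + e τ := by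
      have := dist_triangle p (y τ) q
      rw [h1.1] at this; exact this
    have htri2 : e τ ≤ τ + s := by
      have := dist_triangle (y τ) p q
      rw [dist_comm (y τ) p, h1.1] at this; exact this
    have a2 : Real.arccos (1 - 2 * g τ) ≤ cangle κ q (y τ) p := by
      rw [cangle_comm]
      unfold cangle
      rw [dist_comm (y τ) p, h1.1, cangleK_eq _ (mul_ne_zero h4.ne' h3)]
      apply Real.antitone_arccos
      change 1 - 2 * snK κ ((s + τ - e τ) / 2) * snK κ ((s - τ + e τ) / 2) /
        (snK κ τ * snK κ (e τ)) ≤ _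
      rw [hg, mul_assoc, mul_div_assoc, mul_div_mul_comm]
      have := hmono (a := (1 - c) / 2 * τ) (b := (s + τ - e τ) / 2)
        ⟨by have : 0 ≤ 1 - c := by linarith
            positivity, by nlinarith⟩ ⟨by linarith, by linarith⟩
        (by linarith)
      beta_reduce
      gcongr
    linarith
  have l2 : Tendsto (fun c => π - Real.arccos c) (𝓝[>] 0) (𝓝 (π - Real.arccos 0)) :=
    (tendsto_const_nhds.sub (Real.continuous_arccos.tendsto 0)).mono_left nhdsWithin_le_nhds
  rw [Real.arccos_zero, show π - π / 2 = π / 2 by ring] at l2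
  refine ge_of_tendsto l2 ?_
  filter_upwards [evpos, id0.eventually (Iio_mem_nhds one_pos)] with c h1 h2 using key c h1 h2

/-- A quantitative Cantor scheme forces a lower bound on the Hausdorff dimension. -/
lemma le_dimH_of_cantor {Y : Type*} [MetricSpace Y] [CompleteSpace Y] {N d : ℕ} (hN : 1 < N)
    (hd : 0 < d) {μ A B : ℝ} (hμ : 0 < μ) (hμ' : μ ≤ 1 / 2) (hNμ : (1 / μ) ^ d ≤ N)
    (hB : 0 < B) (hAB : 8 * A * μ ≤ B) (z : (ℕ → Fin N) → ℕ → Y)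
    (hz : ∀ w k, dist (z w k) (z w (k + 1)) ≤ A * μ ^ k)
    (hsep : ∀ w w' k, (∀ i < k, w i = w' i) → w k ≠ w' k →
      B * μ ^ k ≤ dist (z w (k + 1)) (z w' (k + 1))) :
    (d : ℝ≥0∞) ≤ dimH (univ : Set Y) := by
  have hμ1 : μ < 1 := by linarith
  have hlim : ∀ w, ∃ x, Tendsto (z w) atTop (𝓝 x) := fun w =>
    cauchySeq_tendsto_of_complete (cauchySeq_of_le_geometric μ A hμ1 (hz w))
  choose φ hφ using hlim
  have hA : 0 ≤ A := by
    have := dist_nonneg.trans (hz (fun _ => ⟨0, by omega⟩) 0)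
    simpa using this
  have htail : ∀ w k, dist (z w k) (φ w) ≤ 2 * A * μ ^ k := fun w k => by
    refine (dist_le_of_le_geometric_of_tendsto μ A hμ1 (hz w) (hφ w) k).trans ?_
    rw [div_le_iff₀ (by linarith)]
    have : 0 ≤ A * μ ^ k := by positivity
    nlinarith
  have hdist : ∀ w w' k, (∀ i < k, w i = w' i) → w k ≠ w' k →
      B / 2 * μ ^ k ≤ dist (φ w) (φ w') := by
    intro w w' k h1 h2
    have h3 := hsep w w' k h1 h2
    have h4 := htail w (k + 1)
    have h5 := htail w' (k + 1)
    have h6 := dist_triangle4 (z w (k + 1)) (φ w) (φ w') (z w' (k + 1))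
    rw [dist_comm (φ w')] at h6
    rw [pow_succ] at h4 h5
    have : 0 ≤ μ ^ k := by positivity
    nlinarith
  have hfirst : ∀ w w' : ℕ → Fin N, w ≠ w' → ∃ k, (∀ i < k, w i = w' i) ∧ w k ≠ w' k := by
    classical
    intro w w' h
    have h' : ∃ k, w k ≠ w' k := Function.ne_iff.1 h
    exact ⟨Nat.find h', fun i hi => not_not.1 (Nat.find_min h' hi), Nat.find_spec h'⟩
  have hinj : Function.Injective φ := by
    intro w w' h
    by_contra hne
    obtain ⟨k, h1, h2⟩ := hfirst w w' hne
    have := hdist w w' k h1 h2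
    rw [h, dist_self] at this
    have : 0 < B / 2 * μ ^ k := by positivity
    linarith
  have : Nonempty (ℕ → Fin N) := ⟨fun _ => ⟨0, by omega⟩⟩
  set g : Y → ℝ := fun x => Real.ofDigits (Function.invFun φ x) with hg
  have hgφ : ∀ w, g (φ w) = Real.ofDigits w := fun w => by
    simp only [hg]; rw [Function.leftInverse_invFun hinj w]
  have hC : (0:ℝ) ≤ (2 / B) ^ d := by positivity
  have hH : HolderOnWith ⟨(2 / B) ^ d, hC⟩ (d : ℝ≥0) g (range φ) := by
    rintro _ ⟨w, rfl⟩ _ ⟨w', rfl⟩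
    rw [hgφ, hgφ]
    by_cases hne : w = w'
    · subst hne; simp
    obtain ⟨k, h1, h2⟩ := hfirst w w' hne
    have h3 := hdist w w' k h1 h2
    have h4 := Real.abs_ofDigits_sub_ofDigits_le h1
    have h5 : |Real.ofDigits w - Real.ofDigits w'| ≤ (2 / B) ^ d * dist (φ w) (φ w') ^ d := by
      refine h4.trans ?_
      rw [← mul_pow]
      have h6 : μ ^ k ≤ 2 / B * dist (φ w) (φ w') := by
        rw [div_mul_eq_mul_div, le_div_iff₀ hB]; linarith
      calc ((N:ℝ) ^ k)⁻¹ ≤ (((1 / μ) ^ d) ^ k)⁻¹ := by gcongr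
        _ = (μ ^ k) ^ d := by
          rw [one_div, inv_pow, inv_pow, inv_inv, ← pow_mul, ← pow_mul, mul_comm]
        _ ≤ _ := by gcongr
    rw [edist_dist, Real.dist_eq, edist_dist]
    refine (ENNReal.ofReal_le_ofReal h5).trans ?_
    rw [ENNReal.ofReal_mul hC, ENNReal.ofReal_pow dist_nonneg, NNReal.coe_natCast,
      ENNReal.rpow_natCast, ENNReal.ofReal_eq_coe_nnreal hC]
    rfl
  have h1 := hH.dimH_image_le (by exact_mod_cast hd)
  have h2 : Icc (0:ℝ) 1 ⊆ g '' range φ := by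
    intro t ht
    obtain ⟨w, -, hw⟩ := Real.ofDigits_SurjOn hN ht
    exact ⟨φ w, ⟨w, rfl⟩, by rw [hgφ, hw]⟩
  have h3 : dimH (Icc (0:ℝ) 1) = 1 := by
    have := Real.dimH_of_nonempty_interior (E := ℝ) (s := Icc (0:ℝ) 1)
      (by rw [interior_Icc]; exact ⟨1/2, by norm_num, by norm_num⟩)
    simpa using this
  have h4 : 1 ≤ dimH (range φ) / (d : ℝ≥0) := by
    rw [← h3]; exact (dimH_mono h2).trans h1
  rw [ENNReal.le_div_iff_mul_le (by left; exact_mod_cast hd.ne') (by left; simp), one_mul] at h4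
  refine le_trans ?_ (h4.trans (dimH_mono (subset_univ _)))
  simp

/-- Monotonicity of comparison angles. -/
lemma hang_mono (hX : IsAlexandrov X κ) {p x y a : X} (hy : dist p y + dist y x = dist p x)
    (hyp : y ≠ p) (hap : a ≠ p) (hx : dist p x < scale κ) (ha : dist y a < scale κ) :
    hang κ a p y ≤ hang κ a p x := by
  have hpy : 0 < dist p y := dist_pos.2 hyp.symm
  have hyx : 0 ≤ dist y x := dist_nonneg
  have hpx : 0 < dist p x := by linarith
  have hxp : x ≠ p := (dist_pos.1 hpx).symm
  have h := hinge hX (z := y) (a := a) hy (by rw [dist_comm]; linarith) (by linarith) ha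
  have e1 : sh κ (dist y x) =
      sh κ (dist p x) * ch κ (dist p y) - ch κ (dist p x) * sh κ (dist p y) := by
    rw [← sh_sub]; congr 1; linarith
  rw [hang_eq hap hyp, hang_eq hap hxp]
  have sa : 0 < sh κ (dist p a) := sh_pos (dist_pos.2 hap.symm)
  have sy : 0 < sh κ (dist p y) := sh_pos hpy
  have sx : 0 < sh κ (dist p x) := sh_pos hpx
  rw [div_le_div_iff₀ (by positivity) (by positivity)]
  rw [e1] at h
  rw [dist_comm a y, dist_comm a x]
  have := mul_le_mul_of_nonneg_left h sa.le
  linarith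

lemma dist_sq_eq {q p r : X} (hq : q ≠ p) (hr : r ≠ p) :
    dist q r ^ 2 = dist p q ^ 2 + dist p r ^ 2 - 2 * dist p q * dist p r * eang q p r := by
  have h1 : 0 < dist p q := dist_pos.2 hq.symm
  have h2 : 0 < dist p r := dist_pos.2 hr.symm
  unfold eang ecos
  field_simp
  ring

lemma dist_sq_shrink {ε L : ℝ} (hX : IsAlexandrov X κ)
    (hL : ∀ (q p r : X), q ≠ p → r ≠ p → dist p q ≤ L → dist p r ≤ L →
      hang κ q p r ≤ eang q p r + ε) (hLs : L ≤ scale κ / 4) {p x x' y y' : X}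
    (hL0 : 0 < L) {l : ℝ} (hl : 0 < l) (hl1 : l ≤ 1) (hx : dist p x ≤ L) (hx' : dist p x' ≤ L)
    (h1 : dist p y = l * dist p x) (h2 : dist y x = dist p x - l * dist p x)
    (h1' : dist p y' = l * dist p x') (h2' : dist y' x' = dist p x' - l * dist p x') :
    l ^ 2 * (dist x x' ^ 2 - 2 * ε * (dist p x * dist p x')) ≤ dist y y' ^ 2 := by
  have hsc := scale_pos κ
  by_cases hxp : x = p
  · subst hxp
    rw [dist_self, mul_zero] at h1
    rw [dist_eq_zero.1 h1] at h1' ⊢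
    rw [h1', dist_self]
    linarith
  by_cases hxp' : x' = p
  · subst hxp'
    rw [dist_self, mul_zero] at h1'
    rw [dist_eq_zero.1 h1'] at h1 ⊢
    rw [dist_comm y, h1, dist_self, dist_comm x]
    linarith
  have px : 0 < dist p x := dist_pos.2 (Ne.symm hxp)
  have px' : 0 < dist p x' := dist_pos.2 (Ne.symm hxp')
  have hyp : y ≠ p := fun h => by
    rw [h, dist_self] at h1
    have : 0 < l * dist p x := by positivity
    linarith
  have hyp' : y' ≠ p := fun h => by
    rw [h, dist_self] at h1'
    have : 0 < l * dist p x' := by positivity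
    linarith
  have py : dist p y ≤ dist p x := by rw [h1]; nlinarith
  have py' : dist p y' ≤ dist p x' := by rw [h1']; nlinarith
  have m1 := hang_mono hX (a := y') (y := y) (x := x) (p := p)
    (by rw [h1, h2]; ring) hyp hyp' (by linarith)
    (by have := dist_triangle_left y y' p; linarith)
  have m2 := hang_mono hX (a := x) (y := y') (x := x') (p := p) (by rw [h1', h2']; ring) hyp' hxp
    (by linarith) (by have := dist_triangle_left y' x p; linarith)
  have m3 := eang_le_hang (κ := κ) hyp' hyp
  have m4 := hL x p x' hxp hxp' hx hx'
  have m5 : hang κ y' p x = hang κ x p y' := by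
    rw [hang_eq hyp' hxp, hang_eq hxp hyp', dist_comm x y', mul_comm (ch κ _), mul_comm (sh κ _)]
  have e1 := dist_sq_eq hyp' hyp
  have e2 := dist_sq_eq hxp hxp'
  rw [dist_comm y y', e1, e2, h1, h1']
  have : eang y' p y ≤ eang x p x' + ε := by linarith
  have := mul_le_mul_of_nonneg_left this (show 0 ≤ 2 * l ^ 2 * (dist p x * dist p x') by positivity)
  linarith

/-- Uniform packing bound at small scales. -/
lemma packing (hX : IsAlexandrov X κ) {n : ℕ} (hdim : dimH (univ : Set X) = n) {c : ℝ}
    (hc : 0 < c) (hc1 : c ≤ 1) : ∃ N : ℕ, ∃ L > 0, ∀ (p : X) (s : ℝ), 0 < s → s ≤ L →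
      ∀ x : Fin N → X, (∀ i, dist p (x i) ≤ s) → ∃ i j, i ≠ j ∧ dist (x i) (x j) < c * s := by
  obtain ⟨L, hL, -, hLe⟩ := hang_le_eang κ (ε := c ^ 2 / 72) (by positivity)
  have hsc := scale_pos κ
  set μ : ℝ := c / 48 with hμ
  have hμ0 : 0 < μ := by positivity
  have hμ1 : μ ≤ 1 / 48 := by rw [hμ]; linarith
  set N : ℕ := ⌈(1 / μ) ^ (n + 1)⌉₊ + 2 with hN
  refine ⟨N, min L (scale κ / 4) / 3, by positivity, fun p s hs hsL x hx => ?_⟩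
  by_contra! hcon
  have hmin1 := min_le_left L (scale κ / 4)
  have hmin2 := min_le_right L (scale κ / 4)
  have hs3 : 3 * s ≤ min L (scale κ / 4) := by linarith
  have hH : ∀ (q : X) (i : Fin N) (k : ℕ), ∃ y, dist q y = μ ^ (k + 1) * dist q (x i) ∧
      dist y (x i) = dist q (x i) - μ ^ (k + 1) * dist q (x i) := fun q i k =>
    exists_between hX q (x i) (by positivity)
      (mul_le_of_le_one_left dist_nonneg (pow_le_one₀ hμ0.le (by linarith)))
  choose H hH1 hH2 using hH
  let z : (ℕ → Fin N) → ℕ → X := fun w k => Nat.rec p (fun k q => H q (w k) k) k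
  have z0 : ∀ w, z w 0 = p := fun w => rfl
  have zs : ∀ w k, z w (k + 1) = H (z w k) (w k) k := fun w k => rfl
  have hnear : ∀ w k, dist p (z w k) ≤ 1 * s - μ ^ k * s := by
    intro w k
    induction k with
    | zero => simp [z0]
    | succ k ih =>
      have h1 := dist_triangle p (z w k) (z w (k + 1))
      have h2 : dist (z w k) (z w (k + 1)) ≤ μ ^ (k + 1) * (2 * s) := by
        rw [zs, hH1]
        have := dist_triangle_left (z w k) (x (w k)) p
        have := hx (w k)
        have : 0 ≤ μ ^ k * s := by positivity
        gcongr
        linarith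
      rw [pow_succ] at h2 ⊢
      have : 0 ≤ μ ^ k * s := by positivity
      nlinarith
  have hnear2 : ∀ w k i, dist (z w k) (x i) ≤ 3 * s := by
    intro w k i
    have := dist_triangle_left (z w k) (x i) p
    have := hx i
    have := hnear w k
    have : 0 ≤ μ ^ k * s := by positivity
    linarith
  have hzloc : ∀ w w' k, (∀ i < k, w i = w' i) → z w k = z w' k := by
    intro w w' k
    induction k with
    | zero => intro _; rfl
    | succ k ih =>
      intro h
      rw [zs, zs, ih fun i hi => h i (by omega), h k (by omega)]
  have hcomp := hX.1
  have := le_dimH_of_cantor (Y := X) (N := N) (d := n + 1) (μ := μ) (A := 3 * μ * s)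
    (B := μ * c * s / 2) (by omega) (by omega) hμ0 (by linarith)
    (by rw [hN]; push_cast; have := Nat.le_ceil ((1 / μ) ^ (n + 1)); linarith)
    (by positivity) (by
      have : 0 ≤ μ * s := by positivity
      have e : c = 48 * μ := by rw [hμ]; ring
      rw [e]; apply le_of_eq; ring) z
    (fun w k => by
      rw [zs, hH1]
      have h3 := hnear2 w k (w k)
      calc μ ^ (k + 1) * dist (z w k) (x (w k)) ≤ μ ^ (k + 1) * (3 * s) := by gcongr
        _ = _ := by ring)
    (fun w w' k h1 h2 => by
      rw [zs, zs, hzloc w w' k h1]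
      have hl0 : 0 < μ ^ (k + 1) := by positivity
      have hLe' : ∀ (q p r : X), q ≠ p → r ≠ p → dist p q ≤ min L (scale κ / 4) →
          dist p r ≤ min L (scale κ / 4) → hang κ q p r ≤ eang q p r + c ^ 2 / 72 :=
        fun q p r h1 h2 h3 h4 => hLe q p r h1 h2 (h3.trans hmin1) (h4.trans hmin1)
      have h3 := dist_sq_shrink hX hLe' hmin2 (by positivity) hl0
        (pow_le_one₀ hμ0.le (by linarith)) ((hnear2 w' k (w k)).trans hs3)
        ((hnear2 w' k (w' k)).trans hs3) (hH1 _ _ _) (hH2 _ _ _) (hH1 _ _ _) (hH2 _ _ _)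
      have h4 := hcon _ _ h2
      have h5 : dist (z w' k) (x (w k)) * dist (z w' k) (x (w' k)) ≤ (3 * s) * (3 * s) := by
        gcongr
        · exact hnear2 _ _ _
        · exact hnear2 _ _ _
      have h6 : (c * s) ^ 2 ≤ dist (x (w k)) (x (w' k)) ^ 2 := by gcongr
      refine abs_le_of_sq_le_sq' ?_ dist_nonneg |>.2
      refine le_trans ?_ h3
      have h7 : (c * s) ^ 2 / 4 ≤ dist (x (w k)) (x (w' k)) ^ 2 -
          2 * (c ^ 2 / 72) * (dist (z w' k) (x (w k)) * dist (z w' k) (x (w' k))) := by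
        have : 0 ≤ c ^ 2 := by positivity
        nlinarith
      calc (μ * c * s / 2 * μ ^ k) ^ 2 = (μ ^ (k + 1)) ^ 2 * ((c * s) ^ 2 / 4) := by ring
        _ ≤ _ := by gcongr)
  rw [hdim] at this
  have : n + 1 ≤ n := by exact_mod_cast this
  omega

lemma exists_finite_cover (hX : IsAlexandrov X κ) {n : ℕ} (hdim : dimH (univ : Set X) = n) :
    ∃ L > 0, ∀ (p : X) (s : ℝ), 0 < s → s ≤ L →
      ∃ F : Set X, F.Finite ∧ closedBall p s ⊆ ⋃ x ∈ F, closedBall x (s / 2) := by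
  obtain ⟨N, L, hL, h⟩ := packing hX hdim (c := 1 / 2) (by norm_num) (by norm_num)
  refine ⟨L, hL, fun p s hs hsL => ?_⟩
  by_contra! hcon
  have key : ∀ k : ℕ, ∃ x : Fin k → X, (∀ i, dist p (x i) ≤ s) ∧
      ∀ i j, i ≠ j → s / 2 ≤ dist (x i) (x j) := by
    intro k
    induction k with
    | zero => exact ⟨fun i => i.elim0, fun i => i.elim0, fun i => i.elim0⟩
    | succ k ih =>
      obtain ⟨x, hx1, hx2⟩ := ih
      obtain ⟨y, hy, hy'⟩ := not_subset.1 (hcon (range x) (finite_range x))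
      simp only [mem_range, iUnion_exists, iUnion_iUnion_eq', mem_iUnion, mem_closedBall,
          not_exists,
        not_le] at hy'
      refine ⟨Fin.cons y x, fun i => ?_, fun i j => ?_⟩
      · refine Fin.cases ?_ (fun i => ?_) i
        · rw [Fin.cons_zero, dist_comm]; exact hy
        · rw [Fin.cons_succ]; exact hx1 i
      · refine Fin.cases ?_ (fun i => ?_) i <;> refine Fin.cases ?_ (fun j => ?_) j
        · intro h; exact (h rfl).elim
        · intro _; rw [Fin.cons_zero, Fin.cons_succ]; exact (hy' j).le
        · intro _; rw [Fin.cons_zero, Fin.cons_succ, dist_comm]; exact (hy' i).le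
        · intro h; rw [Fin.cons_succ, Fin.cons_succ]; exact hx2 i j fun e => h (by rw [e])
  obtain ⟨x, hx1, hx2⟩ := key N
  obtain ⟨i, j, hij, hd⟩ := h p s hs hsL x hx1
  have := hx2 i j hij
  linarith

lemma properSpace (hX : IsAlexandrov X κ) {n : ℕ} (hdim : dimH (univ : Set X) = n) :
    ProperSpace X := by
  obtain ⟨L, hL, h⟩ := exists_finite_cover hX hdim
  have hcomp := hX.1
  have hsmall : ∀ (p : X) (s : ℝ), 0 < s → s ≤ L → IsCompact (closedBall p s) := by
    intro p s hs hsL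
    refine TotallyBounded.isCompact_of_isClosed ?_ isClosed_closedBall
    have key : ∀ j : ℕ, ∃ F : Set X, F.Finite ∧
        closedBall p s ⊆ ⋃ x ∈ F, closedBall x (s / 2 ^ j) := by
      intro j
      induction j with
      | zero => exact ⟨{p}, finite_singleton p, by simp⟩
      | succ j ih =>
        obtain ⟨F, hF, hFc⟩ := ih
        choose G hG hGc using fun x : X => h x (s / 2 ^ j) (by positivity)
          ((div_le_self hs.le (one_le_pow₀ (by norm_num))).trans hsL)
        refine ⟨⋃ x ∈ F, G x, hF.biUnion fun x _ => hG x, fun y hy => ?_⟩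
        obtain ⟨x, hx, hyx⟩ := mem_iUnion₂.1 (hFc hy)
        obtain ⟨w, hw, hyw⟩ := mem_iUnion₂.1 (hGc x hyx)
        refine mem_iUnion₂.2 ⟨w, mem_iUnion₂.2 ⟨x, hx, hw⟩, ?_⟩
        rwa [pow_succ, ← div_div]
    rw [Metric.totallyBounded_iff]
    intro ε hε
    obtain ⟨j, hj⟩ := pow_unbounded_of_one_lt (s / ε) (one_lt_two)
    obtain ⟨F, hF, hFc⟩ := key j
    refine ⟨F, hF, hFc.trans (iUnion₂_mono fun x _ => closedBall_subset_ball ?_)⟩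
    rwa [div_lt_comm₀ (by positivity) hε]
  have hbig : ∀ (p : X) (k : ℕ), IsCompact (closedBall p (k * (L / 4))) := by
    intro p k
    induction k with
    | zero => simp
    | succ k ih =>
      obtain ⟨t, ht⟩ := ih.elim_nhds_subcover (fun x => ball x (L / 4))
        (fun x _ => ball_mem_nhds x (by positivity))
      refine IsCompact.of_isClosed_subset (t.isCompact_biUnion
        (f := fun x => closedBall x (L / 2)) fun x _ => hsmall x _ (by positivity) (by linarith))
        isClosed_closedBall ?_
      intro y hy
      rw [mem_closedBall, dist_comm] at hy
      have hk : (0:ℝ) ≤ k * (L / 4) := by positivity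
      obtain ⟨z, hz1, hz2⟩ := exists_between hX p y (t := min (dist p y) (k * (L / 4)))
        (le_min dist_nonneg hk) (min_le_left _ _)
      have hz : z ∈ closedBall p (k * (L / 4)) := by
        rw [mem_closedBall, dist_comm, hz1]; exact min_le_right _ _
      obtain ⟨x, hx, hxz⟩ := mem_iUnion₂.1 (ht.2 hz)
      refine mem_iUnion₂.2 ⟨x, hx, ?_⟩
      rw [mem_ball] at hxz
      rw [mem_closedBall]
      push_cast at hy
      have := dist_triangle y z x
      rw [dist_comm y z, hz2] at this
      have : dist p y - min (dist p y) (k * (L / 4)) ≤ L / 4 := by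
        rcases min_cases (dist p y) (k * (L / 4)) with h | h <;> linarith
      linarith
  refine ⟨fun p r => ?_⟩
  obtain ⟨k, hk⟩ := exists_nat_ge (r / (L / 4))
  exact (hbig p k).of_isClosed_subset isClosed_closedBall
    (closedBall_subset_closedBall (by rwa [div_le_iff₀ (by positivity)] at hk))

lemma hang_comm (κ : ℝ) {q p r : X} (hq : q ≠ p) (hr : r ≠ p) : hang κ q p r = hang κ r p q := by
  rw [hang_eq hq hr, hang_eq hr hq, dist_comm q r, mul_comm (ch κ _), mul_comm (sh κ _)]

/-- Near `p`, every point is almost the midpoint of a segment issuing from `p`. -/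
lemma exists_tip (hX : IsAlexandrov X κ) {n : ℕ} (hdim : dimH (univ : Set X) = n) (p : X) {ε : ℝ}
    (hε : 0 < ε) : ∃ r₀ > 0, ∀ x, x ≠ p → dist p x < r₀ → ∃ y₁ y, dist p y₁ = dist p x ∧
      dist y₁ y = dist p x ∧ dist p y = 2 * dist p x ∧ dist x y₁ ≤ ε * dist p x := by
  wlog hε1 : ε ≤ 1 generalizing ε
  · obtain ⟨r₀, h0, h⟩ := this one_pos le_rfl
    refine ⟨r₀, h0, fun x hx hxr => ?_⟩
    obtain ⟨y₁, y, h1, h2, h3, h4⟩ := h x hx hxr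
    exact ⟨y₁, y, h1, h2, h3, h4.trans (by gcongr; linarith)⟩
  obtain ⟨N, L', hL', hpack⟩ := packing hX hdim (c := ε / 2) (by positivity) (by linarith)
  obtain ⟨L, hL, hLs, hLe⟩ := hang_le_eang κ (ε := ε ^ 2 / 8) (by positivity)
  have hsc := scale_pos κ
  by_contra! hcon
  have key : ∀ k : ℕ, ∃ r > 0, r ≤ min L' (min L (scale κ / 4)) ∧ ∃ z : Fin k → X,
      (∀ i, dist p (z i) = r) ∧ ∀ i j, i ≠ j → hang κ (z i) p (z j) ≤ 1 - 3 * ε ^ 2 / 8 := by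
    intro k
    induction k with
    | zero => exact ⟨_, lt_min hL' (lt_min hL (by positivity)), le_rfl, fun i => i.elim0,
        fun i => i.elim0, fun i => i.elim0⟩
    | succ k ih =>
      obtain ⟨r, hr, hr2, z, hz1, hz2⟩ := ih
      obtain ⟨x, hxp, hxr, hx⟩ := hcon (r / 2) (by positivity)
      have hm1 := hr2.trans (min_le_right _ _)
      have hm2 := hm1.trans (min_le_left _ _)
      have hm3 := hm1.trans (min_le_right _ _)
      set ρ := dist p x with hρ
      have hρ0 : 0 < ρ := dist_pos.2 hxp.symm
      have hex : ∀ i, ∃ y₁ y, dist p y₁ = ρ ∧ dist y₁ y = ρ ∧ dist p y = 2 * ρ ∧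
          dist y (z i) = r - 2 * ρ := by
        intro i
        obtain ⟨y, h1, h2⟩ := exists_between hX p (z i) (t := 2 * ρ) (by positivity)
          (by rw [hz1]; linarith)
        obtain ⟨y₁, h3, h4⟩ := exists_between hX p y (t := ρ) (by positivity) (by rw [h1]; linarith)
        exact ⟨y₁, y, h3, by rw [h4, h1]; ring, h1, by rw [h2, hz1]⟩
      choose z' y h1 h2 h3 h4 using hex
      have hz'p : ∀ i, z' i ≠ p := fun i hh => by
        have := h1 i; rw [hh, dist_self] at this; linarith
      have hyp : ∀ i, y i ≠ p := fun i hh => by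
        have := h3 i; rw [hh, dist_self] at this; linarith
      have hzp : ∀ i, z i ≠ p := fun i hh => by
        have := hz1 i; rw [hh, dist_self] at this; linarith
      have hmono : ∀ i a, a ≠ p → dist p a ≤ r → hang κ a p (z' i) ≤ hang κ a p (z i) := by
        intro i a ha har
        have t1 := dist_triangle_left (z' i) a p
        have t2 := dist_triangle_left (y i) a p
        rw [h1] at t1
        rw [h3] at t2
        refine (hang_mono hX (x := y i) (by rw [h1, h2, h3]; ring) (hz'p i) ha
          (by rw [h3]; linarith) (by linarith)).trans
          (hang_mono hX (by rw [h3, h4, hz1]; ring) (hyp i) ha (by rw [hz1]; linarith)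
            (by linarith))
      have hxz : ∀ i, hang κ x p (z' i) ≤ 1 - 3 * ε ^ 2 / 8 := by
        intro i
        have e1 := hx (z' i) (y i) (h1 i) (h2 i) (h3 i)
        have e2 := dist_sq_eq hxp (hz'p i)
        have e3 := hLe x p (z' i) hxp (hz'p i) (by linarith) (by rw [h1]; linarith)
        rw [h1, ← hρ] at e2
        have e4 : (ε * ρ) ^ 2 ≤ dist x (z' i) ^ 2 := by gcongr
        rw [e2] at e4
        have e5 : ε ^ 2 ≤ 2 - 2 * eang x p (z' i) := by
          have : 0 < ρ ^ 2 := by positivity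
          nlinarith
        linarith
      refine ⟨ρ, hρ0, by linarith, Fin.cons x z', fun i => ?_, fun i j => ?_⟩
      · refine Fin.cases ?_ (fun i => ?_) i
        · rfl
        · rw [Fin.cons_succ]; exact h1 i
      · refine Fin.cases ?_ (fun i => ?_) i <;> refine Fin.cases ?_ (fun j => ?_) j
        · intro h; exact (h rfl).elim
        · intro _; rw [Fin.cons_zero, Fin.cons_succ]; exact hxz j
        · intro _; rw [Fin.cons_zero, Fin.cons_succ, hang_comm κ (hz'p i) hxp]; exact hxz i
        · intro h; rw [Fin.cons_succ, Fin.cons_succ]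
          refine (hmono j _ (hz'p i) (by rw [h1]; linarith)).trans ?_
          rw [hang_comm κ (hz'p i) (hzp j)]
          refine (hmono i _ (hzp j) (by rw [hz1])).trans ?_
          exact hz2 j i fun e => h (by rw [e])
  obtain ⟨r, hr, hr2, z, hz1, hz2⟩ := key N
  obtain ⟨i, j, hij, hd⟩ := hpack p r hr (hr2.trans (min_le_left _ _)) z fun i => (hz1 i).le
  have hzp : ∀ i, z i ≠ p := fun i hh => by
    have := hz1 i; rw [hh, dist_self] at this; linarith
  have e1 := (eang_le_hang (κ := κ) (hzp i) (hzp j)).trans (hz2 i j hij)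
  have e2 := dist_sq_eq (hzp i) (hzp j)
  have e3 : dist (z i) (z j) ^ 2 < (ε / 2 * r) ^ 2 := by gcongr
  rw [e2, hz1, hz1] at e3
  have : 0 < r ^ 2 := by positivity
  nlinarith

lemma eang_comm (q p r : X) : eang q p r = eang r p q := by
  unfold eang ecos
  rw [dist_comm q r]
  ring

/-- First variation estimate. -/
lemma abs_eang_sub_le {a x v : X} (ha : a ≠ x) (hv : v ≠ x) :
    |eang a x v - (dist x a - dist v a) / dist x v| ≤ dist x v / dist x a := by
  have h1 : 0 < dist x a := dist_pos.2 ha.symm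
  have h2 : 0 < dist x v := dist_pos.2 hv.symm
  have h3 : |dist x a - dist v a| ≤ dist x v := abs_dist_sub_le x v a
  have e : eang a x v - (dist x a - dist v a) / dist x v =
      (dist x v ^ 2 - (dist x a - dist v a) ^ 2) / (2 * dist x a * dist x v) := by
    unfold eang ecos
    rw [dist_comm a v]
    field_simp
    ring
  have h4 : (dist x a - dist v a) ^ 2 ≤ dist x v ^ 2 := sq_le_sq' (by linarith [abs_le.1 h3])
    (abs_le.1 h3).2
  rw [e, abs_of_nonneg (by apply div_nonneg; linarith; positivity),
    div_le_div_iff₀ (by positivity) h1]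
  have := sq_nonneg (dist x a - dist v a)
  nlinarith [mul_pos h1 h2]

lemma eang_le_first {ε : ℝ} {a x v : X} (ha : a ≠ x) (hv : v ≠ x)
    (h : dist x v ≤ ε * dist x a) :
    dist x v * eang a x v ≤ dist x a - dist v a + ε * dist x v := by
  have h1 : 0 < dist x a := dist_pos.2 ha.symm
  have h2 : 0 < dist x v := dist_pos.2 hv.symm
  have h3 := (abs_le.1 (abs_eang_sub_le ha hv)).2
  have h4 : dist x v / dist x a ≤ ε := by rwa [div_le_iff₀ h1]
  have h5 : eang a x v ≤ (dist x a - dist v a) / dist x v + ε := by linarith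
  calc dist x v * eang a x v ≤ dist x v * ((dist x a - dist v a) / dist x v + ε) := by gcongr
    _ = _ := by field_simp

lemma first_le_eang {ε : ℝ} {a x v : X} (ha : a ≠ x) (hv : v ≠ x)
    (h : dist x v ≤ ε * dist x a) :
    dist x a - dist v a - ε * dist x v ≤ dist x v * eang a x v := by
  have h1 : 0 < dist x a := dist_pos.2 ha.symm
  have h2 : 0 < dist x v := dist_pos.2 hv.symm
  have h3 := (abs_le.1 (abs_eang_sub_le ha hv)).1
  have h4 : dist x v / dist x a ≤ ε := by rwa [div_le_iff₀ h1]
  have h5 : (dist x a - dist v a) / dist x v - ε ≤ eang a x v := by linarith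
  calc _ = dist x v * ((dist x a - dist v a) / dist x v - ε) := by field_simp
    _ ≤ _ := by gcongr

/-- A `δ`-frame at `p`: `k` almost opposite, pairwise almost orthogonal pairs of points,
all within distance `δ` of `p`. Euclidean comparison angles are used. -/
structure Frame (δ : ℝ) {k : ℕ} (a : Fin k → Bool → X) (p : X) : Prop where
  ne : ∀ i σ, a i σ ≠ p
  lt : ∀ i σ, dist p (a i σ) < δ
  opp : ∀ i σ, eang (a i σ) p (a i !σ) < -1 + δ
  orth : ∀ i j σ τ, i ≠ j → eang (a i σ) p (a j τ) < δ

lemma Frame.mono {δ δ' : ℝ} {k : ℕ} {a : Fin k → Bool → X} {p : X} (h : Frame δ a p)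
    (hδ : δ ≤ δ') : Frame δ' a p :=
  ⟨h.ne, fun i σ => (h.lt i σ).trans_le hδ, fun i σ => (h.opp i σ).trans_le (by linarith),
    fun i j σ τ hij => (h.orth i j σ τ hij).trans_le hδ⟩

lemma continuousAt_eang {q p r : X} (hq : q ≠ p) (hr : r ≠ p) :
    ContinuousAt (fun x => eang q x r) p := by
  have h1 : dist p q ≠ 0 := (dist_pos.2 hq.symm).ne'
  have h2 : dist p r ≠ 0 := (dist_pos.2 hr.symm).ne'
  unfold eang ecos
  exact ContinuousAt.div (by fun_prop) (by fun_prop) (by simp [h1, h2])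

lemma Frame.eventually {δ : ℝ} {k : ℕ} {a : Fin k → Bool → X} {p : X} (h : Frame δ a p) :
    ∀ᶠ x in 𝓝 p, Frame δ a x := by
  have h1 : ∀ᶠ x in 𝓝 p, ∀ i σ, a i σ ≠ x := eventually_all.2 fun i => eventually_all.2 fun σ =>
    by filter_upwards [isOpen_ne.mem_nhds (h.ne i σ).symm] with x hx using Ne.symm hx
  have h2 : ∀ᶠ x in 𝓝 p, ∀ i σ, dist x (a i σ) < δ :=
    eventually_all.2 fun i => eventually_all.2 fun σ =>
    (continuous_id.dist continuous_const).continuousAt.eventually (gt_mem_nhds (h.lt i σ))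
  have h3 : ∀ᶠ x in 𝓝 p, ∀ i σ, eang (a i σ) x (a i !σ) < -1 + δ :=
    eventually_all.2 fun i => eventually_all.2 fun σ =>
    (continuousAt_eang (h.ne i σ) (h.ne i _)).eventually (gt_mem_nhds (h.opp i σ))
  have h4 : ∀ᶠ x in 𝓝 p, ∀ i j σ τ, i ≠ j → eang (a i σ) x (a j τ) < δ :=
    eventually_all.2 fun i => eventually_all.2 fun j => eventually_all.2 fun σ =>
    eventually_all.2 fun τ => eventually_all.2 fun hij =>
    (continuousAt_eang (h.ne i σ) (h.ne j τ)).eventually (gt_mem_nhds (h.orth i j σ τ hij))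
  filter_upwards [h1, h2, h3, h4] with x h1 h2 h3 h4 using ⟨h1, h2, h3, h4⟩

/-- First order estimates for a frame, valid on the ball of radius `ρ` around `p`. -/
structure Good (ε ρ : ℝ) {k : ℕ} (a : Fin k → Bool → X) (p : X) : Prop where
  far : ∀ i σ, 8 * ρ ≤ ε * dist p (a i σ)
  lt : ∀ i σ, dist p (a i σ) < ε
  opp : ∀ i σ w w', dist p w < ρ → dist p w' < ρ →
    dist w' (a i σ) - dist w (a i σ) + (dist w' (a i !σ) - dist w (a i !σ)) ≤ ε * dist w w'
  orth : ∀ i σ w z, dist p w < ρ → dist p z < ρ →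
    dist w z + dist z (a i σ) = dist w (a i σ) → ∀ j τ, i ≠ j →
    dist w (a j τ) - ε * dist w z ≤ dist z (a j τ)
  upper : ∀ i σ w z x, dist p w < ρ → dist p z < ρ → dist p x < ρ →
    dist w z + dist z (a i σ) = dist w (a i σ) →
    dist z x ^ 2 ≤ dist w x ^ 2 + dist w z ^ 2 -
      2 * dist w z * (dist x (a i !σ) - dist w (a i !σ)) + ε * dist w z * dist w x
  lower : ∀ i σ w z x, dist p w < ρ → dist p z < ρ → dist p x < ρ →
    dist w z + dist z (a i σ) = dist w (a i σ) →
    dist w x ^ 2 + dist w z ^ 2 -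
      2 * dist w z * (dist w (a i σ) - dist x (a i σ)) - ε * dist w z * dist w x ≤ dist z x ^ 2

lemma exists_good (hX : IsAlexandrov X κ) {ε : ℝ} (hε : 0 < ε) (hε1 : ε ≤ 1) : ∃ δ > 0,
    ∀ {k : ℕ} (a : Fin k → Bool → X) (p : X), Frame δ a p → ∀ᶠ ρ in 𝓝[>] 0, Good ε ρ a p := by
  have hsc := scale_pos κ
  obtain ⟨δ₀, hδ₀, L₀, hL₀, hcore⟩ := core hX (ε := ε / 8) (by positivity)
  obtain ⟨L₁, hL₁, -, hLe⟩ :=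
    hang_le_eang κ (ε := min (ε / 8) (δ₀ / 2)) (by positivity)
  set δ := min (min (δ₀ / 2) (ε / 8)) (min (min L₀ L₁) (scale κ / 2)) with hδ
  have d1 : δ ≤ δ₀ / 2 := (min_le_left _ _).trans (min_le_left _ _)
  have d2 : δ ≤ ε / 8 := (min_le_left _ _).trans (min_le_right _ _)
  have d3 : δ ≤ L₀ := (min_le_right _ _).trans ((min_le_left _ _).trans (min_le_left _ _))
  have d4 : δ ≤ L₁ := (min_le_right _ _).trans ((min_le_left _ _).trans (min_le_right _ _))
  have d5 : δ ≤ scale κ / 2 := (min_le_right _ _).trans (min_le_right _ _)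
  have e1 := min_le_left (ε / 8) (δ₀ / 2)
  have e2 := min_le_right (ε / 8) (δ₀ / 2)
  refine ⟨δ, by positivity, fun {k} a p hF => ?_⟩
  obtain ⟨ρ₀, hρ₀, hFr⟩ := Metric.eventually_nhds_iff.1 hF.eventually
  have id0 : Tendsto (fun τ : ℝ => τ) (𝓝[>] 0) (𝓝 0) := tendsto_id.mono_left nhdsWithin_le_nhds
  have hsmall : ∀ᶠ ρ in 𝓝[>] (0:ℝ), ∀ i σ, ρ < ε / 32 * dist p (a i σ) :=
    eventually_all.2 fun i => eventually_all.2 fun σ =>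
      id0.eventually (gt_mem_nhds (by have := dist_pos.2 (hF.ne i σ).symm; positivity))
  filter_upwards [hsmall, id0.eventually (gt_mem_nhds hρ₀), self_mem_nhdsWithin]
    with ρ hρs hρ1 hρ0
  rw [mem_Ioi] at hρ0
  have fr : ∀ w, dist p w < ρ → Frame δ a w := fun w hw => hFr (by rw [dist_comm]; linarith)
  have near : ∀ i σ w v, dist p w < ρ → dist p v < ρ → dist w v ≤ ε / 8 * dist w (a i σ) := by
    intro i σ w v hw hv
    have h1 := hρs i σ
    have h2 := dist_triangle_left w v p
    have h3 := dist_triangle p w (a i σ)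
    have h4 : ρ < 1 * dist p (a i σ) := h1.trans_le (by gcongr; linarith)
    nlinarith
  have near' : ∀ (_ : Fin k) (_ : Bool) w v, dist p w < ρ → dist p v < ρ → dist w v ≤ δ := by
    intro i σ w v hw hv
    refine (near i σ w v hw hv).trans ?_
    have := (fr w hw).lt i σ
    have h0 : 0 ≤ dist w (a i σ) := dist_nonneg
    nlinarith
  have seg : ∀ i σ w z, dist p w < ρ → dist p z < ρ → z ≠ w →
      dist w z + dist z (a i σ) = dist w (a i σ) → ∀ v, v ≠ w → dist w v ≤ δ →
      eang v w z ≤ eang v w (a i σ) + min (ε / 8) (δ₀ / 2) := by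
    intro i σ w z hw hz hzw hb v hv hvd
    have h1 := eang_le_hang (κ := κ) hv hzw
    have h5 := near' i σ w z hw hz
    have h6 := (fr w hw).lt i σ
    have h2 := hang_mono hX (a := v) hb hzw hv (by linarith) (by
      have h4 := near i σ w z hw hz
      have := dist_triangle_left z v w
      have h7 : dist w z ≤ 1/8 * dist w (a i σ) := h4.trans (by gcongr)
      linarith)
    have h3 := hLe v w (a i σ) hv ((fr w hw).ne i σ) (by linarith) (by linarith)
    linarith
  have hlow : ∀ i σ w z x, dist p w < ρ → dist p z < ρ → dist w x ≤ δ →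
      z ≠ w → x ≠ w → dist w x ≤ ε / 8 * dist w (a i σ) →
      dist w z + dist z (a i σ) = dist w (a i σ) →
      dist w x ^ 2 + dist w z ^ 2 -
        2 * dist w z * (dist w (a i σ) - dist x (a i σ)) - ε * dist w z * dist w x
          ≤ dist z x ^ 2 := by
    intro i σ w z x hw hz hx hzw hxw hxa hb
    have h1 := seg i σ w z hw hz hzw hb x hxw hx
    have h2 := eang_le_first ((fr w hw).ne i σ) hxw hxa
    rw [eang_comm] at h2
    have h3 := dist_sq_eq hxw hzw
    rw [dist_comm z x, h3]
    have h4 : dist w x * eang x w z ≤ dist w x * (eang x w (a i σ) + ε / 8) := by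
      gcongr; linarith
    have h5 : dist w x * eang x w z ≤ dist w (a i σ) - dist x (a i σ) + ε / 4 * dist w x := by
      linarith
    have h6 := mul_le_mul_of_nonneg_left h5 (show 0 ≤ 2 * dist w z by positivity)
    have h7 : 0 ≤ ε * dist w z * dist w x := by positivity
    nlinarith
  have wx : ∀ {w x : X}, dist w x ≠ 0 → x ≠ w := fun h hh => h (by rw [hh, dist_self])
  refine ⟨fun i σ => ?_, fun i σ => by linarith [hF.lt i σ], ?_, ?_, ?_, ?_⟩
  · have := hρs i σ
    linarith
  · intro i σ w w' hw hw'
    by_cases hne : w' = w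
    · subst hne; simp
    have f := fr w hw
    have h1 := hcore w (a i σ) (a i !σ) w' (f.ne i σ) (f.ne i _) hne ((f.lt i σ).le.trans d3)
      ((f.lt i _).le.trans d3) ((near' i σ w w' hw hw').trans d3)
      ((f.opp i σ).le.trans (by linarith))
    have h2 := eang_le_first (f.ne i σ) hne (near i σ w w' hw hw')
    have h3 := eang_le_first (f.ne i (!σ)) hne (near i _ w w' hw hw')
    have h4 := mul_le_mul_of_nonneg_left h1 (dist_nonneg (x := w) (y := w'))
    have h5 : 0 ≤ ε * dist w w' := by positivity
    linarith
  · intro i σ w z hw hz hb j τ hij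
    by_cases hne : z = w
    · subst hne; simp
    have f := fr w hw
    have h1 := seg i σ w z hw hz hne hb (a j τ) (f.ne j τ) (f.lt j τ).le
    have h2 := first_le_eang (f.ne j τ) hne (near j τ w z hw hz)
    have h3 := f.orth j i τ σ hij.symm
    have h4 : dist w z * eang (a j τ) w z ≤ dist w z * (ε / 4) := by gcongr; linarith
    have h5 : 0 ≤ ε * dist w z := by positivity
    linarith
  · intro i σ w z x hw hz hx hb
    by_cases hzw : z = w
    · subst hzw; simp
    by_cases hxw : x = w
    · subst hxw; simp [dist_comm]
    have f := fr w hw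
    have h1 := seg i σ w z hw hz hzw hb (a i !σ) (f.ne i _) (f.lt i _).le
    have h2 := f.opp i σ
    rw [eang_comm] at h2
    have h3 := hcore w (a i !σ) z x (f.ne i _) hzw hxw ((f.lt i _).le.trans d3)
      ((near' i σ w z hw hz).trans d3) ((near' i σ w x hw hx).trans d3) (by linarith)
    have h4 := eang_le_first (f.ne i (!σ)) hxw (near i _ w x hw hx)
    have h5 := dist_sq_eq hzw hxw
    rw [h5]
    have h6 := mul_le_mul_of_nonneg_left h3 (dist_nonneg (x := w) (y := x))
    have h7 : dist x (a i !σ) - dist w (a i !σ) - ε / 4 * dist w x ≤ dist w x * eang z w x := by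
      linarith
    have h8 := mul_le_mul_of_nonneg_left h7 (show 0 ≤ 2 * dist w z by positivity)
    have h9 : 0 ≤ ε * dist w z * dist w x := by positivity
    nlinarith
  · intro i σ w z x hw hz hx hb
    by_cases hzw : z = w
    · subst hzw; simp
    by_cases hxw : x = w
    · subst hxw; simp [dist_comm]
    exact hlow i σ w z x hw hz (near' i σ w x hw hx) hzw hxw (near i σ w x hw hx) hb

/-- Existence of a `δ`-frame with `k` pairs. -/
def Strained (k : ℕ) (δ : ℝ) (p : X) : Prop :=
  ∃ a : Fin k → Bool → X, Frame δ a p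

lemma Frame.cons {δ : ℝ} {k : ℕ} {a : Fin k → Bool → X} {x : X} (h : Frame δ a x)
    {b : Bool → X} (hne : ∀ σ, b σ ≠ x) (hlt : ∀ σ, dist x (b σ) < δ)
    (hopp : eang (b true) x (b false) < -1 + δ)
    (horth : ∀ j σ τ, eang (a j τ) x (b σ) < δ) :
    Frame δ (Fin.cons b a : Fin (k + 1) → Bool → X) x := by
  refine ⟨fun i => ?_, fun i => ?_, fun i => ?_, fun i j => ?_⟩
  · refine Fin.cases ?_ (fun i => ?_) i
    · simpa using hne
    · simpa using h.ne i
  · refine Fin.cases ?_ (fun i => ?_) i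
    · simpa using hlt
    · simpa using h.lt i
  · refine Fin.cases ?_ (fun i => ?_) i
    · intro σ
      cases σ
      · rw [eang_comm]; simpa using hopp
      · simpa using hopp
    · simpa using h.opp i
  · refine Fin.cases ?_ (fun i => ?_) i <;> refine Fin.cases ?_ (fun j => ?_) j
    · simp
    · intro σ τ _
      rw [eang_comm]
      simpa using horth j σ τ
    · intro σ τ _
      simpa using horth i τ σ
    · intro σ τ hij
      simpa using h.orth i j σ τ (fun hh => hij (by rw [hh]))

lemma frame_extend (hX : IsAlexandrov X κ) {n : ℕ} (hdim : dimH (univ : Set X) = n) {δ : ℝ}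
    (hδ : 0 < δ) : ∃ δ' > 0, ∃ c > 0, ∀ {k : ℕ} (a : Fin k → Bool → X) (p : X),
    Frame δ' a p → ∃ r₀ > 0, ∀ x, x ≠ p → dist p x < r₀ →
      (∀ i, |dist x (a i true) - dist p (a i true)| ≤ c * dist p x) → Strained (k + 1) δ x := by
  set ε := min (δ / 40) (1 / 2) with hε
  have hε0 : 0 < ε := by positivity
  have ε1 : ε ≤ δ / 40 := min_le_left _ _
  have ε2 : ε ≤ 1 / 2 := min_le_right _ _
  obtain ⟨δ₁, hδ₁, hgood⟩ := exists_good hX hε0 (ε2.trans (by norm_num))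
  obtain ⟨δ₂, hδ₂, L, hL, hcore⟩ := core hX hε0
  refine ⟨min (min δ₁ δ) (L / 2), by positivity, ε, hε0, fun {k} a p hF => ?_⟩
  have m1 : min (min δ₁ δ) (L / 2) ≤ δ₁ := (min_le_left _ _).trans (min_le_left _ _)
  have m2 : min (min δ₁ δ) (L / 2) ≤ δ := (min_le_left _ _).trans (min_le_right _ _)
  have m3 : min (min δ₁ δ) (L / 2) ≤ L / 2 := min_le_right _ _
  obtain ⟨ρ, hG, hρ⟩ := ((hgood a p (hF.mono m1)).and self_mem_nhdsWithin).exists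
  obtain ⟨r₁, hr₁, htip⟩ := exists_tip hX hdim p hε0
  obtain ⟨r₂, hr₂, hFr⟩ := Metric.eventually_nhds_iff.1 (hF.mono m2).eventually
  refine ⟨min (min r₁ r₂) (min (ρ / 4) (min (δ / 4) (L / 4))), by positivity,
    fun x hxp hx hxa => ?_⟩
  simp only [lt_min_iff] at hx
  obtain ⟨⟨x1, x2⟩, x3, x4, x5⟩ := hx
  obtain ⟨y₁, y, hy1, hy2, hy3, hy4⟩ := htip x hxp x1
  have hr : 0 < dist p x := dist_pos.2 hxp.symm
  set r := dist p x with hrdef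
  have hy5 : dist x y ≤ (1 + ε) * r := by
    have := dist_triangle x y₁ y
    linarith
  have hy6 : (1 - ε) * r ≤ dist x y := by
    have := dist_triangle p x y
    have h7 := dist_triangle y₁ x y
    rw [dist_comm y₁ x] at h7
    linarith
  have hy7 : r / 2 ≤ dist x y := le_trans (by nlinarith) hy6
  have hyx : y ≠ x := by
    rintro rfl
    rw [dist_self] at hy7
    linarith
  have inc : ∀ i σ, dist x (a i σ) - dist p (a i σ) ≤ 2 * ε * r := by
    intro i σ
    have h1 := abs_le.1 (hxa i)
    have h2 := hG.opp i true p x (by simpa using hρ) (by rw [← hrdef]; linarith)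
    have h3 : 0 ≤ ε * r := by positivity
    rw [← hrdef] at h2
    simp only [Bool.not_true] at h2
    cases σ <;> linarith
  have far : ∀ i σ z, dist p z ≤ r → 2 * r ≤ ε * dist z (a i σ) := by
    intro i σ z hz
    have h1 := hG.far i σ
    have h2 := dist_triangle p z (a i σ)
    have h3 : ε * dist p (a i σ) ≤ ε * (r + dist z (a i σ)) := by gcongr; linarith
    nlinarith
  have ney : ∀ i σ z, dist p z ≤ r → a i σ ≠ z := by
    rintro i σ z hz rfl
    have := far i σ _ hz
    rw [dist_self] at this
    linarith
  have incy : ∀ i σ, dist y (a i σ) ≤ dist p (a i σ) + 9 * ε * r := by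
    intro i σ
    have hpy1 : p ≠ y₁ := by rw [← dist_pos, hy1]; exact hr
    have hyy1 : y ≠ y₁ := by rw [← dist_pos, dist_comm, hy2]; exact hr
    have f1 := far i σ y₁ hy1.le
    have n1 := ney i σ y₁ hy1.le
    have opp : eang p y₁ y ≤ -1 + δ₂ := by
      have : eang p y₁ y = -1 := by
        unfold eang ecos
        rw [dist_comm y₁ p, hy1, hy2, hy3]
        field_simp
        norm_num
      linarith
    have h1 := hcore y₁ p y (a i σ) hpy1 hyy1 n1 (by rw [dist_comm, hy1]; linarith) (by linarith)
      (by
        have := dist_triangle y₁ p (a i σ)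
        rw [dist_comm y₁ p, hy1] at this
        have := hF.lt i σ
        linarith) opp
    have h2 := eang_le_first n1 hpy1 (ε := ε) (by rw [dist_comm y₁ p, hy1]; linarith)
    have h3 := eang_le_first n1 hyy1 (ε := ε) (by linarith)
    rw [dist_comm y₁ p, hy1, eang_comm] at h2
    rw [hy2, eang_comm] at h3
    have h4 := mul_le_mul_of_nonneg_left h1 hr.le
    have h5 := inc i σ
    have h6 := dist_triangle y₁ x (a i σ)
    rw [dist_comm y₁ x] at h6
    linarith
  have decy : ∀ i σ, dist x (a i σ) - dist y (a i σ) ≤ 13 * ε * r := by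
    intro i σ
    have h1 := incy i (!σ)
    have h2 := hG.opp i σ y p (by rw [hy3]; linarith) (by simpa using hρ)
    rw [dist_comm y p, hy3] at h2
    have h3 := inc i σ
    linarith
  refine ⟨_, (hFr (by rw [dist_comm]; exact x2)).cons (b := fun σ => cond σ p y)
    ?_ ?_ ?_ ?_⟩
  · rintro (_ | _)
    exacts [hyx, hxp.symm]
  · rintro (_ | _)
    · show dist x y < δ
      nlinarith
    · show dist x p < δ
      rw [dist_comm]
      linarith
  · show eang p x y < _
    have h1 : 0 < dist x y := by linarith
    unfold eang ecos
    rw [dist_comm x p, ← hrdef, hy3, div_lt_iff₀ (by positivity)]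
    nlinarith [mul_pos hr h1]
  · intro j σ τ
    have f1 := far j τ x le_rfl
    have n1 := ney j τ x le_rfl
    have h1 := inc j τ
    have h2 := decy j τ
    cases σ
    · show eang (a j τ) x y < δ
      have h3 := eang_le_first n1 hyx (ε := ε) (by nlinarith)
      have h4 : dist x y * eang (a j τ) x y ≤ dist x y * (27 * ε) := by nlinarith
      have := le_of_mul_le_mul_left h4 (by linarith)
      linarith
    · show eang (a j τ) x p < δ
      have h3 := eang_le_first n1 hxp.symm (ε := ε) (by rw [dist_comm]; linarith)
      rw [dist_comm x p, ← hrdef] at h3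
      have h4 : r * eang (a j τ) x p ≤ r * (3 * ε) := by linarith
      have := le_of_mul_le_mul_left h4 hr
      linarith

lemma dimH_le_of_local [SecondCountableTopology X] {S : Set X} {d : ℝ≥0∞}
    (h : ∀ x ∈ S, ∃ t ∈ 𝓝[S] x, dimH t ≤ d) : dimH S ≤ d := by
  by_contra! hlt
  obtain ⟨x, hx, hxt⟩ := exists_mem_nhdsWithin_lt_dimH_of_lt_dimH hlt
  obtain ⟨t, ht, htd⟩ := h x hx
  exact absurd (hxt t ht) (not_lt.2 htd)

lemma dimH_le_image_of_dist {Y : Type*} [MetricSpace Y] {S : Set X} {f : X → Y} {c : ℝ}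
    (hc : 0 < c) (h : ∀ x ∈ S, ∀ y ∈ S, c * dist x y ≤ dist (f x) (f y)) :
    dimH S ≤ dimH (f '' S) := by
  have hA : AntilipschitzWith (Real.toNNReal c⁻¹) (S.domRestrict f) :=
    AntilipschitzWith.of_le_mul_dist fun x y => by
      rw [Real.coe_toNNReal _ (by positivity), Subtype.dist_eq, inv_mul_eq_div, le_div_iff₀ hc]
      have := h x x.2 y y.2
      simp only [domRestrict_apply]
      linarith
  have h1 := hA.le_dimH_image univ
  rw [image_univ, range_domRestrict] at h1
  have h2 := (isometry_subtype_coe (s := S)).dimH_image univ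
  rw [image_univ, Subtype.range_coe] at h2
  rwa [h2]

lemma strained_zero (δ : ℝ) (p : X) : Strained 0 δ p :=
  ⟨fun i => i.elim0, fun i => i.elim0, fun i => i.elim0, fun i => i.elim0, fun i => i.elim0⟩

lemma Strained.mono {k : ℕ} {δ δ' : ℝ} {p : X} (h : Strained k δ p) (hδ : δ ≤ δ') :
    Strained k δ' p := by
  obtain ⟨a, ha⟩ := h
  exact ⟨a, ha.mono hδ⟩

lemma Strained.eventually {k : ℕ} {δ : ℝ} {p : X} (h : Strained k δ p) :
    ∀ᶠ x in 𝓝 p, Strained k δ x := by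
  obtain ⟨a, ha⟩ := h
  exact ha.eventually.mono fun x hx => ⟨a, hx⟩

lemma dimH_not_strained_succ [SecondCountableTopology X] (hX : IsAlexandrov X κ) {n : ℕ}
    (hdim : dimH (univ : Set X) = n) (k : ℕ)
    (ih : ∀ δ : ℝ, 0 < δ → dimH {p : X | ¬ Strained k δ p} ≤ k) {δ : ℝ} (hδ : 0 < δ) :
    dimH {p : X | ¬ Strained (k + 1) δ p} ≤ k := by
  obtain ⟨δ', hδ', c, hc, hext⟩ := frame_extend hX hdim hδ
  set B : Set X := {p | ¬ Strained (k + 1) δ p}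
  have hsub : B ⊆ {p : X | ¬ Strained k δ' p} ∪ (B ∩ {p : X | Strained k δ' p}) := fun p hp => by
    by_cases h : Strained k δ' p
    exacts [Or.inr ⟨hp, h⟩, Or.inl h]
  refine (dimH_mono hsub).trans ?_
  rw [dimH_union]
  refine max_le (ih _ hδ') (dimH_le_of_local fun p hp => ?_)
  obtain ⟨hpB, a, ha⟩ := hp
  refine ⟨_, inter_mem_nhdsWithin _ ha.eventually, ?_⟩
  set B' := (B ∩ {p : X | Strained k δ' p}) ∩ {x | Frame δ' a x}
  set u : X → Fin k → ℝ := fun x i => dist x (a i true)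
  set Q : ℕ → Set X := fun j => {q | q ∈ B' ∧ ∀ x ∈ B, x ≠ q → dist q x < 1 / (j + 1 : ℝ) →
    c * dist q x ≤ dist (u q) (u x)}
  have hcov : B' ⊆ ⋃ j, Q j := by
    intro q hq
    obtain ⟨r₀, hr₀, hh⟩ := hext a q hq.2
    obtain ⟨j, hj⟩ := exists_nat_one_div_lt hr₀
    refine mem_iUnion.2 ⟨j, hq, fun x hx hxq hd => ?_⟩
    by_contra! hlt
    refine hx (hh x hxq (hd.trans hj) fun i => ?_)
    have := dist_le_pi_dist (u q) (u x) i
    rw [dist_comm, Real.dist_eq] at this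
    linarith
  refine (dimH_mono hcov).trans ?_
  rw [dimH_iUnion]
  refine iSup_le fun j => dimH_le_of_local fun q hq => ?_
  refine ⟨_, inter_mem_nhdsWithin _
    (ball_mem_nhds q (ε := 1 / (j + 1 : ℝ) / 2) (by positivity)), ?_⟩
  refine (dimH_le_image_of_dist (f := u) hc ?_).trans
    ((dimH_mono (subset_univ _)).trans (dimH_univ_pi_fin k).le)
  rintro x ⟨hx, hxq⟩ y ⟨hy, hyq⟩
  by_cases hxy : y = x
  · subst hxy; simp
  refine hx.2 y hy.1.1.1 hxy ?_
  rw [mem_ball] at hxq hyq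
  have := dist_triangle_right x y q
  linarith

lemma dimH_not_strained [SecondCountableTopology X] (hX : IsAlexandrov X κ) {n : ℕ}
    (hdim : dimH (univ : Set X) = n) (k : ℕ) :
    ∀ {δ : ℝ}, 0 < δ → dimH {p : X | ¬ Strained k δ p} ≤ k - 1 := by
  induction k with
  | zero =>
    intro δ hδ
    simp [strained_zero]
  | succ k ih =>
    intro δ hδ
    have := dimH_not_strained_succ hX hdim k (fun δ hδ => (ih hδ).trans tsub_le_self) hδ
    simpa using this

/-- Ekeland-type principle on a closed subset of a proper space. -/
lemma exists_goal [ProperSpace X] {E : Set X} (hE : IsClosed E) {Θ : X → ℝ} (hΘ : Continuous Θ)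
    {x : X} (hx : x ∈ E) {ρ η : ℝ} (hρ : 0 < ρ)
    (hbd : ∀ y ∈ E, dist x y = ρ → Θ y < Θ x + η * ρ) (goal : X → Prop)
    (hmove : ∀ y ∈ E, dist x y < ρ → ¬ goal y → Θ x + η * dist x y ≤ Θ y →
      ∃ y₁ ∈ E, dist x y₁ ≤ ρ ∧ 0 ≤ η ∧ Θ y + η * dist y y₁ < Θ y₁) :
    ∃ y ∈ E, dist x y < ρ ∧ Θ x + η * dist x y ≤ Θ y ∧ goal y := by
  have hK : IsCompact (E ∩ closedBall x ρ) := (isCompact_closedBall x ρ).inter_left hE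
  obtain ⟨y, ⟨hyE, hyb⟩, hy⟩ := hK.exists_isMaxOn ⟨x, hx, mem_closedBall_self hρ.le⟩
    (f := fun y => Θ y - η * dist x y) (by fun_prop)
  have h0 : Θ x + η * dist x y ≤ Θ y := by
    have := hy ⟨hx, mem_closedBall_self hρ.le⟩
    simp only [mem_ofPred_eq, dist_self, mul_zero, sub_zero] at this
    linarith
  have h1 : dist x y < ρ := by
    rw [mem_closedBall, dist_comm] at hyb
    refine lt_of_le_of_ne hyb fun h => ?_
    have := hbd y hyE h
    rw [h] at h0
    linarith
  refine ⟨y, hyE, h1, h0, ?_⟩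
  by_contra hg
  obtain ⟨y₁, hy₁, hd, hη, hlt⟩ := hmove y hyE h1 hg h0
  have := hy ⟨hy₁, by rwa [mem_closedBall, dist_comm]⟩
  simp only [mem_ofPred_eq] at this
  have := mul_le_mul_of_nonneg_left (dist_triangle x y y₁) hη
  linarith

lemma exists_move [ProperSpace X] (hX : IsAlexandrov X κ) {E : Set X} (hE : IsExtremal κ E)
    {ε : ℝ} (hε : 0 < ε) (hε1 : ε ≤ 1) : ∃ δ > 0, ∀ {k : ℕ} (a : Fin k → Bool → X) (p : X),
    Frame δ a p → ∀ᶠ ρ in 𝓝[>] 0, Good ε ρ a p ∧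
      ∀ y ∈ E, ∀ s, 0 < s → dist p y + 4 * s < ρ → ∀ i σ, ∃ y₁ ∈ E, dist y y₁ ≤ 2 * s ∧
        |dist y₁ (a i σ) - dist y (a i σ) + s| ≤ 5 * ε * s ∧
        |dist y₁ (a i !σ) - dist y (a i !σ) - s| ≤ 5 * ε * s ∧
        (∀ j τ, i ≠ j → |dist y₁ (a j τ) - dist y (a j τ)| ≤ 5 * ε * s) ∧
        ∀ x, dist p x < ρ → dist y x ^ 2 - 2 * s * (dist y (a i σ) - dist x (a i σ)) -
          4 * ε * s * (dist y x + s) ≤ dist y₁ x ^ 2 := by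
  obtain ⟨δ₁, hδ₁, hgood⟩ := exists_good hX hε hε1
  obtain ⟨L, hL, hLs, hLe⟩ := hang_le_eang κ hε
  refine ⟨min δ₁ (L / 2), by positivity, fun {k} a p hF => ?_⟩
  have id0 : Tendsto (fun τ : ℝ => τ) (𝓝[>] 0) (𝓝 0) := tendsto_id.mono_left nhdsWithin_le_nhds
  filter_upwards [hgood a p (hF.mono (min_le_left _ _)), self_mem_nhdsWithin,
    id0.eventually (gt_mem_nhds (show 0 < L / 8 by positivity))] with ρ hG hρ0 hρL
  replace hρ0 : 0 < ρ := hρ0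
  refine ⟨hG, fun y hy s hs hys i σ => ?_⟩
  have hd0 : 0 ≤ dist p y := dist_nonneg
  have far : ∀ j τ w, dist p w < ρ → 7 * ρ ≤ ε * dist w (a j τ) := by
    intro j τ w hw
    have h1 := hG.far j τ
    have h2 := dist_triangle p w (a j τ)
    have h3 : ε * dist p (a j τ) ≤ ε * (ρ + dist w (a j τ)) := by gcongr; linarith
    nlinarith
  have hya : s ≤ dist y (a i σ) := by
    have := far i σ y (by linarith)
    have h0 : 0 ≤ dist y (a i σ) := dist_nonneg
    nlinarith
  obtain ⟨z, hz1, hz2⟩ := exists_between hX y (a i σ) hs.le hya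
  obtain ⟨y₁, hy₁, hmin⟩ := hE.1.exists_infDist_eq_dist ⟨y, hy⟩ z
  have hnear : ∀ w ∈ E, dist z y₁ ≤ dist z w := fun w hw =>
    hmin ▸ infDist_le_dist_of_mem hw
  have hzy1 : dist z y₁ ≤ s := by
    have := hnear y hy
    rwa [dist_comm z y, hz1] at this
  have hyy1 : dist y y₁ ≤ 2 * s := by
    have := dist_triangle y z y₁
    linarith
  have hpz : dist p z < ρ := by
    have := dist_triangle p y z
    linarith
  have hpy1 : dist p y₁ < ρ := by
    have := dist_triangle p y y₁
    linarith
  have ext : ∀ v, dist y₁ v ≤ L → dist z v ^ 2 ≤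
      dist z y₁ ^ 2 + dist y₁ v ^ 2 + 2 * ε * dist z y₁ * dist y₁ v := by
    intro v hv
    by_cases h1 : z = y₁
    · subst h1; simp
    by_cases h2 : v = y₁
    · subst h2; simp
    have hz' : dist y₁ z ≤ L := by rw [dist_comm]; linarith
    have h3 := ch_le_of_nearest hE hy₁ hnear (hz'.trans_lt hLs) (hv.trans_lt hLs)
    have h4 : 0 ≤ hang κ z y₁ v := by
      rw [hang_eq h1 h2]
      apply div_nonneg
      · rw [dist_comm y₁ z]; linarith
      · exact mul_nonneg (sh_nonneg dist_nonneg) (sh_nonneg dist_nonneg)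
    have h5 := hLe z y₁ v h1 h2 hz' hv
    have h6 := dist_sq_eq h1 h2
    rw [h6, dist_comm z y₁]
    have h7 : 0 ≤ dist y₁ z * dist y₁ v := by positivity
    nlinarith
  have low : ∀ j τ, dist z (a j τ) - 2 * ε * s ≤ dist y₁ (a j τ) := by
    intro j τ
    have h1 := ext (a j τ) (by
      have := dist_triangle y₁ p (a j τ)
      have h3 := (hF.lt j τ).trans_le (min_le_right _ _)
      rw [dist_comm y₁ p] at this
      linarith)
    have h2 := far j τ y₁ hpy1
    have h3 : dist z (a j τ) ≤ dist y₁ (a j τ) + 2 * ε * s := by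
      refine abs_le_of_sq_le_sq' ?_ (by positivity) |>.2
      have h4 : 0 ≤ dist z y₁ := dist_nonneg
      have h5 : 0 ≤ dist y₁ (a j τ) := dist_nonneg
      have h6 : dist z y₁ ^ 2 ≤ s * s := by nlinarith
      have h7 : dist z y₁ * (ε * dist y₁ (a j τ)) ≤ s * (ε * dist y₁ (a j τ)) := by gcongr
      have h8 : s * (7 * ρ) ≤ s * (ε * dist y₁ (a j τ)) := by gcongr
      have h9 : s * s ≤ s * (7 * ρ) := by gcongr; linarith
      nlinarith [sq_nonneg (ε * s)]
    linarith
  have hb : dist y z + dist z (a i σ) = dist y (a i σ) := by linarith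
  have hpy : dist p y < ρ := by linarith
  have A := low i σ
  have B : dist y (a i !σ) + s - 3 * ε * s ≤ dist y₁ (a i !σ) := by
    have h1 := low i (!σ)
    have h2 := hG.opp i σ z y hpz hpy
    rw [dist_comm z y, hz1] at h2
    linarith
  have C : ∀ j τ, i ≠ j → dist y (a j τ) - 3 * ε * s ≤ dist y₁ (a j τ) := by
    intro j τ hij
    have h1 := low j τ
    have h2 := hG.orth i σ y z hpy hpz hb j τ hij
    rw [hz1] at h2
    linarith
  have hεs : 0 ≤ ε * s := by positivity
  have hεy : ε * dist y y₁ ≤ ε * (2 * s) := by gcongr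
  refine ⟨y₁, hy₁, hyy1, ?_, ?_, ?_, ?_⟩
  · have h1 := hG.opp i σ y y₁ hpy hpy1
    rw [abs_le]
    constructor <;> linarith
  · have h1 := hG.opp i σ y y₁ hpy hpy1
    rw [abs_le]
    constructor <;> linarith
  · intro j τ hij
    have h1 := hG.opp j τ y y₁ hpy hpy1
    have h2 := C j τ hij
    have h3 := C j (!τ) hij
    rw [abs_le]
    constructor <;> linarith
  · intro x hx
    have h1 := hG.lower i σ y z x hpy hpz hx hb
    rw [hz1] at h1
    have h2 := ext x (by
      have := dist_triangle_left y₁ x p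
      linarith)
    have h3 : dist y₁ x ≤ dist y x + 2 * s := by
      have := dist_triangle_left y₁ x y
      linarith
    have h4 : dist z y₁ ^ 2 ≤ s ^ 2 := by gcongr
    have h5 : 2 * ε * dist z y₁ * dist y₁ x ≤ 2 * ε * s * (dist y x + 2 * s) := by gcongr
    have h6 : 0 ≤ ε * s * dist y x := by positivity
    nlinarith

lemma exists_open [ProperSpace X] (hX : IsAlexandrov X κ) {E : Set X} (hE : IsExtremal κ E)
    (k : ℕ) : ∃ δ > 0, ∀ (a : Fin k → Bool → X) (p : X), Frame δ a p → ∀ᶠ ρ in 𝓝[>] 0,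
      ∀ x ∈ E, ∀ (t : Fin k → ℝ) (r : ℝ), dist p x + r ≤ ρ →
        4 * ∑ i, |dist x (a i true) - t i| < r →
        ∃ y ∈ E, dist x y ≤ 4 * ∑ i, |dist x (a i true) - t i| ∧ ∀ i, dist y (a i true) = t i := by
  set ε : ℝ := 1 / (20 * (k + 1)) with hεdef
  have hε : 0 < ε := by positivity
  have hεk : 5 * ε * k ≤ 1 / 4 := by
    rw [hεdef]
    field_simp
    linarith
  have hε1 : ε ≤ 1 := by
    rw [hεdef, div_le_one (by positivity)]
    have : (0 : ℝ) ≤ k := by positivity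
    linarith
  obtain ⟨δ, hδ, hmv⟩ := exists_move hX hE hε hε1
  refine ⟨δ, hδ, fun a p hF => ?_⟩
  filter_upwards [hmv a p hF] with ρ hρ x hx t r hxr hr
  obtain ⟨-, hρ⟩ := hρ
  have hS0 : 0 ≤ ∑ i, |dist x (a i true) - t i| := Finset.sum_nonneg fun i _ => abs_nonneg _
  obtain ⟨y, hyE, -, hy2, hy3⟩ := exists_goal hE.1 (Θ := fun y => -∑ i, |dist y (a i true) - t i|)
    (by fun_prop) hx (ρ := r) (η := 1 / 4) (by linarith) (fun y _ _ => by
      have : 0 ≤ ∑ i, |dist y (a i true) - t i| := Finset.sum_nonneg fun i _ => abs_nonneg _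
      linarith) (fun y => ∀ i, dist y (a i true) = t i) (fun y hyE hyr hng hy => by
    push Not at hng
    obtain ⟨i, hi⟩ := hng
    have hΔ : 0 < |dist y (a i true) - t i| := abs_pos.2 (sub_ne_zero.2 hi)
    have hpy : dist p y < ρ := by
      have := dist_triangle p x y
      linarith
    set s := min |dist y (a i true) - t i| (min ((ρ - dist p y) / 8) ((r - dist x y) / 2))
    have hs : 0 < s := lt_min hΔ (lt_min (by linarith) (by linarith))
    have s1 : s ≤ |dist y (a i true) - t i| := min_le_left _ _
    have s2 : s ≤ (ρ - dist p y) / 8 := (min_le_right _ _).trans (min_le_left _ _)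
    have s3 : s ≤ (r - dist x y) / 2 := (min_le_right _ _).trans (min_le_right _ _)
    have key : ∃ y₁ ∈ E, dist y y₁ ≤ 2 * s ∧
        |dist y₁ (a i true) - t i| ≤ |dist y (a i true) - t i| + 5 * ε * s - s ∧
        ∀ j, i ≠ j → |dist y₁ (a j true) - dist y (a j true)| ≤ 5 * ε * s := by
      rcases le_or_gt (t i) (dist y (a i true)) with h | h
      · obtain ⟨y₁, h1, h2, h3, h4, h5, -⟩ := hρ y hyE s hs (by linarith) i true
        refine ⟨y₁, h1, h2, ?_, fun j hij => h5 j true hij⟩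
        rw [abs_of_nonneg (sub_nonneg.2 h)] at s1 ⊢
        rw [abs_le] at h3 ⊢
        constructor <;> linarith
      · obtain ⟨y₁, h1, h2, h3, h4, h5, -⟩ := hρ y hyE s hs (by linarith) i false
        refine ⟨y₁, h1, h2, ?_, fun j hij => h5 j true hij⟩
        rw [abs_of_neg (sub_neg.2 h)] at s1 ⊢
        rw [Bool.not_false] at h4
        rw [abs_le] at h4 ⊢
        constructor <;> linarith
    obtain ⟨y₁, hy₁, h1, h2, h3⟩ := key
    refine ⟨y₁, hy₁, ?_, by norm_num, ?_⟩
    · have := dist_triangle x y y₁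
      linarith
    · have : ∑ j, |dist y₁ (a j true) - t j| ≤
          ∑ j, (|dist y (a j true) - t j| + 5 * ε * s - if i = j then s else 0) := by
        refine Finset.sum_le_sum fun j _ => ?_
        by_cases hij : i = j
        · subst hij
          simpa using h2
        · have h4 := abs_sub_le (dist y₁ (a j true)) (dist y (a j true)) (t j)
          have h5 := h3 j hij
          simp only [hij, if_false]
          linarith
      rw [Finset.sum_sub_distrib, Finset.sum_add_distrib] at this
      simp only [Finset.sum_ite_eq, Finset.mem_univ, if_true, Finset.sum_const,
        Finset.card_univ, Fintype.card_fin, nsmul_eq_mul] at this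
      have h6 := mul_le_mul_of_nonneg_right hεk hs.le
      linarith)
  refine ⟨y, hyE, ?_, hy3⟩
  have : 0 ≤ ∑ i, |dist y (a i true) - t i| := Finset.sum_nonneg fun i _ => abs_nonneg _
  linarith

lemma exists_le_dimH [ProperSpace X] (hX : IsAlexandrov X κ) {E : Set X} (hE : IsExtremal κ E)
    (k : ℕ) : ∃ δ > 0, ∀ p, Strained k δ p → ∀ᶠ x in 𝓝 p, x ∈ E →
      ∀ r > 0, (k : ℝ≥0∞) ≤ dimH (E ∩ ball x r) := by
  obtain ⟨δ, hδ, h⟩ := exists_open hX hE k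
  refine ⟨δ, hδ, fun p ⟨a, ha⟩ => ?_⟩
  obtain ⟨ρ, hρ, hρ0⟩ := ((h a p ha).and self_mem_nhdsWithin).exists
  replace hρ0 : 0 < ρ := hρ0
  filter_upwards [ball_mem_nhds p hρ0] with x hxp hx r hr
  rw [mem_ball, dist_comm] at hxp
  set u : X → Fin k → ℝ := fun y i => dist y (a i true)
  have hu : LipschitzWith 1 u := LipschitzWith.of_dist_le_mul fun y z => by
    rw [NNReal.coe_one, one_mul, dist_pi_le_iff dist_nonneg]
    exact fun i => dist_dist_dist_le_left y z (a i true)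
  set r' := min r (ρ - dist p x)
  have hr' : 0 < r' := lt_min hr (by linarith)
  set b := r' / (4 * (k + 1))
  have hb : 0 < b := by positivity
  have hsub : ball (u x) b ⊆ u '' (E ∩ ball x r) := by
    intro t ht
    have hsum : 4 * ∑ i, |dist x (a i true) - t i| < r' := by
      have h1 : ∑ i, |dist x (a i true) - t i| ≤ ∑ i : Fin k, b :=
        Finset.sum_le_sum fun i _ => by
          have := dist_le_pi_dist t (u x) i
          rw [dist_comm, Real.dist_eq] at this
          exact this.trans (mem_ball.1 ht).le
      simp only [Finset.sum_const, Finset.card_univ, Fintype.card_fin, nsmul_eq_mul] at h1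
      have h2 : 4 * (k + 1) * b = r' := by
        simp only [b]
        field_simp
      linarith
    obtain ⟨y, hy, hxy, hyt⟩ := hρ x hx t r' (by linarith [min_le_right r (ρ - dist p x)]) hsum
    refine ⟨y, ⟨hy, ?_⟩, funext hyt⟩
    rw [mem_ball, dist_comm]
    linarith [min_le_left r (ρ - dist p x)]
  calc (k : ℝ≥0∞) = dimH (ball (u x) b) := (dimH_ball_pi_fin _ hb).symm
    _ ≤ dimH (u '' (E ∩ ball x r)) := dimH_mono hsub
    _ ≤ _ := hu.dimH_image_le _

lemma sum_sq_le {m : ℕ} {f f' : Fin m → ℝ} {i : Fin m} {ε s R : ℝ} (hε : 0 ≤ ε) (hε1 : ε ≤ 1)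
    (hs : 0 ≤ s) (hsR : s ≤ ε * R) (hR : ∀ j, |f j| ≤ R)
    (hi : |f' i| ≤ |f i| - s + 5 * ε * s) (hj : ∀ j, i ≠ j → |f' j - f j| ≤ 5 * ε * s) :
    ∑ j, f' j ^ 2 ≤ ∑ j, f j ^ 2 - 2 * s * |f i| + 36 * (m + 1) * (ε * s * R) := by
  have hR0 : 0 ≤ R := (abs_nonneg _).trans (hR i)
  have hεs : 0 ≤ ε * s := by positivity
  set e := ε * s * R with he
  have he0 : 0 ≤ e := by positivity
  have e1 : s * s ≤ e := by
    calc s * s ≤ s * (ε * R) := by gcongr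
      _ = e := by rw [he]; ring
  have e2 : (ε * s) * (ε * s) ≤ e := by
    calc (ε * s) * (ε * s) ≤ (1 * s) * (1 * s) := by gcongr
      _ ≤ e := by linarith
  have e3 : ∀ j, ε * s * |f j| ≤ e := fun j => by rw [he]; gcongr; exact hR j
  have hsum : ∑ j, f' j ^ 2 ≤
      ∑ j, (f j ^ 2 + 36 * e - if i = j then 2 * s * |f i| else 0) := by
    refine Finset.sum_le_sum fun j _ => ?_
    rw [← sq_abs, ← sq_abs (f j)]
    by_cases hij : i = j
    · subst hij
      simp only [if_true]
      have h5 : |f' i| ^ 2 ≤ (|f i| - s + 5 * ε * s) ^ 2 := by gcongr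
      have h6 := e3 i
      have h7 : 0 ≤ ε * (s * s) := by positivity
      nlinarith
    · simp only [hij, if_false]
      have h6 := e3 j
      have h7 : |f' j| ≤ |f j| + 5 * ε * s := by
        have := abs_sub_abs_le_abs_sub (f' j) (f j)
        linarith [hj j hij]
      have h8 : |f' j| ^ 2 ≤ (|f j| + 5 * ε * s) ^ 2 := by gcongr
      nlinarith
  rw [Finset.sum_sub_distrib, Finset.sum_add_distrib] at hsum
  simp only [Finset.sum_ite_eq, Finset.mem_univ, if_true, Finset.sum_const,
    Finset.card_univ, Fintype.card_fin, nsmul_eq_mul] at hsum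
  linarith

set_option maxHeartbeats 1000000 in
lemma dist_sq_le_of_frame [ProperSpace X] (hX : IsAlexandrov X κ) {n : ℕ}
    (hdim : dimH (univ : Set X) = n) {E : Set X} (hE : IsExtremal κ E) {m : ℕ}
    (hEdim : dimH E ≤ m) {ε : ℝ} (hε : 0 < ε) (hε1 : ε ≤ 1) :
    ∃ δ > 0, ∀ (a : Fin m → Bool → X) (p : X), Frame δ a p → ∃ ρ > 0, ∀ x ∈ E, dist p x < ρ →
      dist p x ^ 2 ≤ ∑ i, (dist p (a i true) - dist x (a i true)) ^ 2 + ε * dist p x ^ 2 := by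
  obtain ⟨δ₁, hδ₁, hbig⟩ := exists_le_dimH hX hE (m + 1)
  obtain ⟨δ₂, hδ₂, c, hc, hext⟩ := frame_extend hX hdim hδ₁
  wlog hc1 : c ≤ 1 generalizing c
  · exact this 1 one_pos (fun a p hF => by
      obtain ⟨r₀, hr₀, h⟩ := hext a p hF
      exact ⟨r₀, hr₀, fun x hx hxr hi => h x hx hxr fun i => (hi i).trans
        (by gcongr; linarith)⟩) le_rfl
  set g := c * ε ^ 2 / 2 with hg
  have hg0 : 0 < g := by positivity
  set K := 16 / g + 1 with hK
  have hK1 : 1 ≤ K := by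
    have : 0 < 16 / g := by positivity
    linarith
  set ε' := min 1 (g / (164 * (m + 1) * K)) with hε'
  have hε'0 : 0 < ε' := by positivity
  have hε'1 : ε' ≤ 1 := min_le_left _ _
  have hε'2 : 82 * (m + 1) * K * ε' ≤ g / 2 := by
    have h1 : ε' ≤ g / (164 * (m + 1) * K) := min_le_right _ _
    rw [le_div_iff₀ (by positivity)] at h1
    linarith
  obtain ⟨δ₃, hδ₃, hmv⟩ := exists_move hX hE hε'0 hε'1
  refine ⟨min δ₂ δ₃, by positivity, fun a p hF => ?_⟩
  obtain ⟨ρ, ⟨hG, hρ⟩, hρ0⟩ := ((hmv a p (hF.mono (min_le_right _ _))).and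
    self_mem_nhdsWithin).exists
  replace hρ0 : 0 < ρ := hρ0
  obtain ⟨r₀, hr₀, hr⟩ := hext a p (hF.mono (min_le_left _ _))
  have hno : ∀ y ∈ E, y ≠ p → dist p y < r₀ →
      ∃ i, c * dist p y < |dist p (a i true) - dist y (a i true)| := by
    intro y hy hyp hyr
    by_contra! hcon
    have h1 := (hbig y (hr y hyp hyr fun i => by rw [abs_sub_comm]; exact hcon i)).self_of_nhds hy 1
      one_pos
    have h2 := h1.trans ((dimH_mono inter_subset_left).trans hEdim)
    norm_cast at h2
    omega
  refine ⟨min r₀ ρ / (2 * K), by positivity, fun x hx hxr => ?_⟩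
  rw [lt_div_iff₀ (by positivity)] at hxr
  have hxr1 : dist p x * (2 * K) < r₀ := hxr.trans_le (min_le_left _ _)
  have hxr2 : dist p x * (2 * K) < ρ := hxr.trans_le (min_le_right _ _)
  by_contra! hcon
  have hxp : 0 < dist p x := by
    rcases (dist_nonneg (x := p) (y := x)).eq_or_lt with h | h
    · exfalso
      rw [← h] at hcon
      have : 0 ≤ ∑ i, (dist p (a i true) - dist x (a i true)) ^ 2 :=
        Finset.sum_nonneg fun i _ => sq_nonneg _
      nlinarith
    · exact h
  set r := dist p x with hrdef
  set Q : X → ℝ := fun y => ∑ i, (dist p (a i true) - dist y (a i true)) ^ 2 with hQ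
  have hQ0 : ∀ y, 0 ≤ Q y := fun y => Finset.sum_nonneg fun i _ => sq_nonneg _
  set Θ : X → ℝ := fun y => min (dist p y ^ 2) (r ^ 2) - (1 + ε / 2) * Q y with hΘ
  have hΘx : ε / 2 * r ^ 2 ≤ Θ x := by
    have h1 : Q x ≤ (1 - ε) * r ^ 2 := by linarith
    have h2 : (1 + ε / 2) * Q x ≤ (1 + ε / 2) * ((1 - ε) * r ^ 2) := by gcongr
    simp only [hΘ, ← hrdef, min_self]
    nlinarith [sq_nonneg (ε * r)]
  have hΘr : ∀ y, Θ y ≤ r ^ 2 := fun y => by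
    have h1 := min_le_right (dist p y ^ 2) (r ^ 2)
    have h2 : 0 ≤ (1 + ε / 2) * Q y := mul_nonneg (by linarith) (hQ0 y)
    simp only [hΘ]
    linarith
  have hball : ∀ y, dist x y < 16 / g * r → dist p y ≤ K * r := fun y hy => by
    have := dist_triangle p x y
    rw [hK]
    linarith
  have hlow : ∀ y, Θ x ≤ Θ y → ε / 2 * r ≤ dist p y := fun y hy => by
    have h1 := min_le_left (dist p y ^ 2) (r ^ 2)
    have h2 : 0 ≤ (1 + ε / 2) * Q y := mul_nonneg (by linarith) (hQ0 y)
    have h3 : ε / 2 * r ^ 2 ≤ dist p y ^ 2 := by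
      simp only [hΘ] at hy hΘx
      linarith
    refine abs_le_of_sq_le_sq' ?_ dist_nonneg |>.2
    refine le_trans ?_ h3
    have : (ε / 2) ^ 2 ≤ ε / 2 := by nlinarith
    rw [mul_pow]
    gcongr
  obtain ⟨y, hyE, hxy, hΘy, hgoal⟩ := exists_goal hE.1 (Θ := Θ) (by fun_prop) hx
    (ρ := 16 / g * r) (η := g * r / 8) (by positivity) (fun y _ _ => by
      have h1 := hΘr y
      have h2 : g * r / 8 * (16 / g * r) = 2 * r ^ 2 := by field_simp; norm_num
      nlinarith)
    (fun y => ∀ i, |dist p (a i true) - dist y (a i true)| ≤ c * dist p y)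
    (fun y hyE hyr hng hy => by
      push Not at hng
      obtain ⟨i, hi⟩ := hng
      have hpy := hball y hyr
      have hpy2 := hlow y (by
        have : 0 ≤ g * r / 8 * dist x y := by positivity
        linarith)
      set F := |dist p (a i true) - dist y (a i true)| with hFdef
      have hF1 : c * (ε / 2 * r) ≤ F := (by gcongr : c * (ε / 2 * r) ≤ c * dist p y).trans hi.le
      have hF0 : 0 < F := lt_of_lt_of_le (by positivity) hF1
      have hFle : ∀ j, |dist p (a j true) - dist y (a j true)| ≤ K * r := fun j =>
        (abs_dist_sub_le p y (a j true)).trans hpy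
      set s := min F (min (ε' * r) ((16 / g * r - dist x y) / 2)) with hs
      have hs0 : 0 < s := lt_min hF0 (lt_min (by positivity) (by linarith))
      have s1 : s ≤ F := min_le_left _ _
      have s2 : s ≤ ε' * r := (min_le_right _ _).trans (min_le_left _ _)
      have s3 : s ≤ (16 / g * r - dist x y) / 2 := (min_le_right _ _).trans (min_le_right _ _)
      have hsr : s ≤ r := s2.trans (by nlinarith)
      have hεs : 0 ≤ ε' * s := by positivity
      have hKr : r ≤ K * r := by nlinarith
      have hpyρ : dist p y < ρ := by linarith [mul_pos (one_pos.trans_le hK1) hxp]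
      have hyρ : ∃ s' ≤ s, 0 < s' ∧ dist p y + 4 * s' < ρ :=
        ⟨min s ((ρ - dist p y) / 8), min_le_left _ _, lt_min hs0 (by linarith), by
          linarith [min_le_right s ((ρ - dist p y) / 8)]⟩
      clear_value s
      obtain ⟨s', hs', hs'0, hs'ρ⟩ := hyρ
      replace s1 := hs'.trans s1
      replace s2 := hs'.trans s2
      replace s3 := hs'.trans s3
      replace hsr := hs'.trans hsr
      replace hεs : 0 ≤ ε' * s' := by positivity
      have key : ∃ y₁ ∈ E, dist y y₁ ≤ 2 * s' ∧
          |dist p (a i true) - dist y₁ (a i true)| ≤ F - s' + 5 * ε' * s' ∧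
          (∀ j, i ≠ j → |dist y₁ (a j true) - dist y (a j true)| ≤ 5 * ε' * s') ∧
          dist p y ^ 2 - 2 * s' * (F + ε' * dist p y) - 4 * ε' * s' * (dist p y + s') ≤
            dist p y₁ ^ 2 := by
        rcases le_or_gt 0 (dist p (a i true) - dist y (a i true)) with h | h
        · obtain ⟨y₁, h1, h2, h3, h4, h5, h6⟩ := hρ y hyE s' hs'0 hs'ρ i false
          refine ⟨y₁, h1, h2, ?_, fun j hij => h5 j true hij, ?_⟩
          · rw [hFdef, abs_of_nonneg h] at s1 ⊢
            rw [Bool.not_false] at h4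
            rw [abs_le] at h4 ⊢
            constructor <;> linarith
          · have h7 := h6 p (by simpa using hρ0)
            have h8 := hG.opp i true p y (by simpa using hρ0) hpyρ
            rw [dist_comm p y, dist_comm p y₁]
            rw [hFdef, abs_of_nonneg h]
            rw [Bool.not_true] at h8
            rw [dist_comm p y] at h8
            have h9 : 2 * s' * (dist y (a i false) - dist p (a i false)) ≤ 2 * s' *
              (dist p (a i true) - dist y (a i true) + ε' * dist y p) := by gcongr; linarith
            linarith
        · obtain ⟨y₁, h1, h2, h3, h4, h5, h6⟩ := hρ y hyE s' hs'0 hs'ρ i true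
          refine ⟨y₁, h1, h2, ?_, fun j hij => h5 j true hij, ?_⟩
          · rw [hFdef, abs_of_neg h] at s1 ⊢
            rw [abs_le] at h3 ⊢
            constructor <;> linarith
          · have h7 := h6 p (by simpa using hρ0)
            rw [dist_comm p y, dist_comm p y₁]
            rw [hFdef, abs_of_neg h]
            have h9 : 0 ≤ s' * (ε' * dist y p) := by positivity
            linarith
      obtain ⟨y₁, hy₁, h1, h2, h3, h4⟩ := key
      refine ⟨y₁, hy₁, ?_, by positivity, ?_⟩
      · have := dist_triangle x y y₁
        linarith
      set e := ε' * s' * (K * r) with he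
      have he0 : 0 ≤ e := by positivity
      have e2 : ε' * s' * s' ≤ e := by rw [he]; gcongr; linarith
      have e3 : ε' * s' * dist p y ≤ e := by rw [he]; gcongr
      have d1 : min (dist p y ^ 2) (r ^ 2) - 2 * s' * F - 10 * e ≤
          min (dist p y₁ ^ 2) (r ^ 2) := by
        have h5 : 0 ≤ 2 * s' * F := by positivity
        refine le_min ?_ ?_
        · have := min_le_left (dist p y ^ 2) (r ^ 2)
          linarith
        · have := min_le_right (dist p y ^ 2) (r ^ 2)
          linarith
      have d2 : Q y₁ ≤ Q y - 2 * s' * F + 36 * (m + 1) * e :=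
        sum_sq_le (f := fun j => dist p (a j true) - dist y (a j true))
          (f' := fun j => dist p (a j true) - dist y₁ (a j true)) hε'0.le hε'1 hs'0.le
          (s2.trans (by gcongr)) hFle h2 fun j hij => by
            rw [sub_sub_sub_cancel_left, abs_sub_comm]
            exact h3 j hij
      have d3 : (1 + ε / 2) * Q y₁ ≤ (1 + ε / 2) * (Q y - 2 * s' * F + 36 * (m + 1) * e) := by
        gcongr
      have d4 : ε / 2 * (36 * (m + 1) * e) ≤ 1 / 2 * (36 * (m + 1) * e) := by gcongr
      have d5 : ε * s' * (c * (ε / 2 * r)) ≤ ε * s' * F := by gcongr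
      have d6 : ε * s' * (c * (ε / 2 * r)) = g * (s' * r) := by rw [hg]; ring
      have d7 : 82 * (m + 1) * e ≤ g / 2 * (s' * r) := by
        calc 82 * (m + 1) * e = 82 * (m + 1) * K * ε' * (s' * r) := by rw [he]; ring
          _ ≤ _ := by gcongr
      have d8 : g * r / 8 * dist y y₁ ≤ g * r / 8 * (2 * s') := by gcongr
      have d9 : 0 < g * (s' * r) := by positivity
      have d10 : 0 ≤ m * e := by positivity
      simp only [hΘ]
      linarith)
  have hpy2 := hlow y (by
    have : 0 ≤ g * r / 8 * dist x y := by positivity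
    linarith)
  have hyp : 0 < dist p y := lt_of_lt_of_le (by positivity) hpy2
  obtain ⟨i, hi⟩ := hno y hyE (dist_pos.1 hyp).symm (by
    have := hball y hxy
    linarith [mul_pos (one_pos.trans_le hK1) hxp])
  exact absurd (hgoal i) (not_le.2 hi)

/-- Almost Bessel inequality for the distance coordinates of a frame. -/
lemma Good.bessel (hX : IsAlexandrov X κ) {ε ρ : ℝ} {m : ℕ} {a : Fin m → Bool → X} {p : X}
    (hG : Good ε ρ a p) (hε : 0 < ε) (hε1 : ε ≤ 1) {r : ℝ} (hr : 0 < r)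
    (hrρ : (2 * m + 4) * r ≤ ρ) {x y : X} (hx : dist p x ≤ r) (hy : dist p y ≤ r) :
    ∑ i, (dist y (a i true) - dist x (a i true)) ^ 2 ≤
      dist x y ^ 2 + 28 * (m + 2) ^ 2 * ε * r ^ 2 := by
  set d : Fin m → ℝ := fun i => dist y (a i true) - dist x (a i true) with hd
  set D := (2 * m + 4) * r with hD
  have hm0 : (0 : ℝ) ≤ m := by positivity
  have hxy : dist x y ≤ 2 * r := by
    have := dist_triangle_left x y p
    linarith
  have main : ∀ S : Finset (Fin m), ∃ w, dist x w ≤ 2 * r * S.card ∧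
      dist w y ^ 2 ≤ dist x y ^ 2 - ∑ i ∈ S, d i ^ 2 + S.card * (14 * ε * r * D) ∧
      ∀ i ∉ S, |dist w (a i true) - dist x (a i true)| ≤ S.card * (4 * ε * r) := by
    intro S
    induction S using Finset.induction_on with
    | empty => exact ⟨x, by simp⟩
    | insert i S hi ih =>
      obtain ⟨w, h1, h2, h3⟩ := ih
      have hcard : (S.card : ℝ) + 1 ≤ m := by
        have := Finset.card_lt_univ_of_notMem hi
        rw [Fintype.card_fin] at this
        exact_mod_cast this
      have hS0 : (0 : ℝ) ≤ S.card := by positivity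
      have hSr : r * S.card + r ≤ r * m := by nlinarith
      have hrm : 0 ≤ r * m := by positivity
      have hpw : dist p w < ρ := by
        have := dist_triangle p x w
        linarith
      have hpy : dist p y < ρ := by linarith
      have hwy : dist w y ≤ D := by
        have := dist_triangle_left w y x
        linarith
      set t := |d i| with ht
      have htr : t ≤ 2 * r := by
        refine le_trans ?_ hxy
        rw [ht, hd, dist_comm x y]
        exact abs_dist_sub_le y x (a i true)
      have ht0 : 0 ≤ t := abs_nonneg _
      have hu := abs_le.1 (h3 i hi)
      have hεD : 0 ≤ ε * dist w y := by positivity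
      obtain ⟨σ, hσ⟩ : ∃ σ, t - S.card * (4 * ε * r) - ε * dist w y ≤
          dist y (a i !σ) - dist w (a i !σ) := by
        rcases le_or_gt 0 (d i) with h | h
        · refine ⟨false, ?_⟩
          rw [ht, abs_of_nonneg h, hd, Bool.not_false]
          simp only
          linarith
        · refine ⟨true, ?_⟩
          have h4 := hG.opp i true y w hpy hpw
          rw [dist_comm y w] at h4
          rw [ht, abs_of_neg h, hd]
          simp only
          linarith
      have hta : t ≤ dist w (a i σ) := by
        have h4 := hG.far i σ
        have h5 := dist_triangle p w (a i σ)
        have h6 : ε * dist p (a i σ) ≤ 1 * dist p (a i σ) := by gcongr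
        linarith
      obtain ⟨z, hz1, hz2⟩ := exists_between hX w (a i σ) ht0 hta
      have hpz : dist p z < ρ := by
        have h4 := dist_triangle p x w
        have h5 := dist_triangle p w z
        linarith
      have hb : dist w z + dist z (a i σ) = dist w (a i σ) := by linarith
      refine ⟨z, ?_, ?_, fun j hj => ?_⟩
      · rw [Finset.card_insert_of_notMem hi]
        push_cast
        have := dist_triangle x w z
        linarith
      · rw [Finset.card_insert_of_notMem hi, Finset.sum_insert hi]
        push_cast
        have h4 := hG.upper i σ w z y hpw hpz hpy hb
        rw [hz1] at h4
        have h5 := mul_le_mul_of_nonneg_left hσ (show 0 ≤ 2 * t by positivity)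
        have h6 : t ^ 2 = d i ^ 2 := sq_abs _
        have h7 : ε * t * dist w y ≤ ε * (2 * r) * D := by gcongr
        have h8 : t * (S.card * (4 * ε * r)) ≤ 2 * r * (ε * (2 * D)) := by
          have : S.card * (4 * ε * r) ≤ ε * (2 * D) := by
            have : S.card * r ≤ m * r := mul_le_mul_of_nonneg_right (by linarith) hr.le
            rw [hD]
            nlinarith
          gcongr
        nlinarith
      · rw [Finset.mem_insert, not_or] at hj
        rw [Finset.card_insert_of_notMem hi]
        push_cast
        have h4 := hG.orth i σ w z hpw hpz hb j true (Ne.symm hj.1)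
        have h5 := hG.orth i σ w z hpw hpz hb j false (Ne.symm hj.1)
        have h6 := hG.opp j true w z hpw hpz
        rw [Bool.not_true] at h6
        have h7 := abs_le.1 (h3 j hj.2)
        rw [hz1] at h4 h5 h6
        have h8 : ε * t ≤ ε * (2 * r) := by gcongr
        rw [abs_le]
        constructor <;> linarith
  obtain ⟨w, -, h, -⟩ := main Finset.univ
  rw [Finset.card_univ, Fintype.card_fin] at h
  have h1 : m * (14 * ε * r * D) ≤ 28 * (m + 2) ^ 2 * ε * r ^ 2 := by
    have : m * (14 * (2 * m + 4)) ≤ 28 * ((m : ℝ) + 2) ^ 2 := by nlinarith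
    calc m * (14 * ε * r * D) = m * (14 * (2 * m + 4)) * (ε * r ^ 2) := by rw [hD]; ring
      _ ≤ 28 * ((m : ℝ) + 2) ^ 2 * (ε * r ^ 2) := by gcongr
      _ = _ := by ring
  nlinarith [sq_nonneg (dist w y)]

lemma half_le_of_sq {A B P e : ℝ} (hB0 : 0 ≤ B) (hA : A ^ 2 ≤ P + e)
    (hB' : P ≤ B ^ 2 + e) (he : 4 * e ≤ A ^ 2) : A / 2 ≤ B :=
  abs_le_of_sq_le_sq' (by nlinarith) hB0 |>.2

lemma opposite_algebra {A B Y P e δ : ℝ} (hA0 : 0 < A) (hB0 : 0 ≤ B) (hA : A ^ 2 ≤ P + e)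
    (hB : B ^ 2 ≤ P + e) (hB' : P ≤ B ^ 2 + e) (hY : 4 * P ≤ Y ^ 2 + e)
    (he : 4 * e ≤ A ^ 2) (hδ : 0 ≤ δ) (heδ : 5 * e ≤ δ * A ^ 2) :
    (A ^ 2 + B ^ 2 - Y ^ 2) / (2 * A * B) ≤ -1 + δ := by
  have h1 := half_le_of_sq hB0 hA hB' he
  have h2 : A * (A / 2) ≤ A * B := by gcongr
  have h3 : δ * (A * (A / 2)) ≤ δ * (A * B) := by gcongr
  have h4 : 0 < B := by linarith
  rw [div_le_iff₀ (by positivity)]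
  nlinarith [sq_nonneg (A - B)]

lemma upper_algebra {A B Y W Z P Q I e r δ θ : ℝ} (hA0 : 0 < A) (hB0 : 0 ≤ B) (hY0 : 0 < Y)
    (hAr : A ≤ r) (hYr : Y ≤ r)
    (hA : A ^ 2 ≤ P + e) (hA' : P ≤ A ^ 2 + e) (hB : B ^ 2 ≤ P + e) (hB' : P ≤ B ^ 2 + e)
    (hY : Y ^ 2 ≤ Q + e) (hY' : Q ≤ Y ^ 2 + e) (hZ : P + Q + 2 * I ≤ Z ^ 2 + e)
    (hI : |I| ≤ (P + Q) / 2) (he : 4 * e ≤ A ^ 2) (hθ : 4 * e ≤ θ * A ^ 2)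
    (hθ0 : 0 ≤ θ) (hδ : 0 ≤ δ)
    (hcore : -δ ≤ (A ^ 2 + Y ^ 2 - W ^ 2) / (2 * A * Y) + (B ^ 2 + Y ^ 2 - Z ^ 2) / (2 * B * Y)) :
    W ^ 2 ≤ P + Q - 2 * I + 5 * e + 2 * δ * r ^ 2 + θ * (2 * r ^ 2 + 5 * e) := by
  have h1 := half_le_of_sq hB0 hA hB' he
  have h4 : 0 < B := by linarith
  have hr0 : 0 ≤ r := by linarith
  have h5 : -δ * (2 * A * Y) ≤ A ^ 2 + Y ^ 2 - W ^ 2 + A / B * (B ^ 2 + Y ^ 2 - Z ^ 2) := by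
    have := mul_le_mul_of_nonneg_right hcore (show 0 ≤ 2 * A * Y by positivity)
    refine this.trans (le_of_eq ?_)
    field_simp
  have h6 : A / B * (B ^ 2 + Y ^ 2 - Z ^ 2) ≤ A / B * (-2 * I + 3 * e) := by
    gcongr; linarith
  have h7 : |A / B - 1| ≤ θ := by
    have e1 : A / B - 1 = (A ^ 2 - B ^ 2) / (B * (A + B)) := by field_simp; ring
    rw [e1, abs_div, abs_of_pos (show 0 < B * (A + B) by positivity), div_le_iff₀ (by positivity)]
    have e2 : |A ^ 2 - B ^ 2| ≤ 2 * e := by rw [abs_le]; constructor <;> linarith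
    have e3 : A / 2 * A ≤ B * (A + B) := mul_le_mul h1 (by linarith) hA0.le h4.le
    have e4 : θ * (A / 2 * A) ≤ θ * (B * (A + B)) := by gcongr
    nlinarith
  have h8 : (A / B - 1) * (-2 * I + 3 * e) ≤ θ * (2 * r ^ 2 + 5 * e) := by
    have e1 : |-2 * I + 3 * e| ≤ 2 * r ^ 2 + 5 * e := by
      have e2 : P + Q ≤ 2 * r ^ 2 + 2 * e := by nlinarith
      have e3 := abs_le.1 hI
      rw [abs_le]
      constructor <;> linarith
    calc _ ≤ |(A / B - 1) * (-2 * I + 3 * e)| := le_abs_self _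
      _ = |A / B - 1| * |-2 * I + 3 * e| := abs_mul _ _
      _ ≤ _ := by gcongr
  have h9 : δ * (A * Y) ≤ δ * r ^ 2 := by rw [sq]; gcongr
  nlinarith

/-- Distance coordinates centred at `p`. -/
noncomputable def coord {m : ℕ} (a : Fin m → Bool → X) (p x : X) : EuclideanSpace ℝ (Fin m) :=
  WithLp.toLp 2 fun i => dist p (a i true) - dist x (a i true)

lemma coord_self {m : ℕ} (a : Fin m → Bool → X) (p : X) : coord a p p = 0 := by
  ext i
  simp [coord]

lemma norm_coord_sq {m : ℕ} (a : Fin m → Bool → X) (p x : X) :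
    ‖coord a p x‖ ^ 2 = ∑ i, (dist p (a i true) - dist x (a i true)) ^ 2 := by
  simp [coord, EuclideanSpace.real_norm_sq_eq]

lemma norm_coord_sub_sq {m : ℕ} (a : Fin m → Bool → X) (p x y : X) :
    ‖coord a p x - coord a p y‖ ^ 2 = ∑ i, (dist y (a i true) - dist x (a i true)) ^ 2 := by
  simp [coord, EuclideanSpace.real_norm_sq_eq]

/-- At scale `r`, the map `f` is almost expanding from `p` on `E`, almost contracting everywhere,
and takes on `E` all values of size `2 * r`. -/
structure CoordGood (E : Set X) (l r R : ℝ) {m : ℕ} (f : X → EuclideanSpace ℝ (Fin m)) (p : X) :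
    Prop where
  upper : ∀ x ∈ E, dist p x ≤ R → dist p x ^ 2 ≤ ‖f x‖ ^ 2 + l * dist p x ^ 2
  upper' : ∀ x ∈ E, dist p x ≤ R → dist p x ^ 2 ≤ ‖f x‖ ^ 2 + l * r ^ 2
  lower : ∀ x y, dist p x ≤ R → dist p y ≤ R → ‖f x - f y‖ ^ 2 ≤ dist x y ^ 2 + l * r ^ 2
  surj : ∀ v, ‖v‖ ≤ 2 * r → ∃ x ∈ E, dist p x ≤ R ∧ f x = v

lemma exists_coordGood [ProperSpace X] (hX : IsAlexandrov X κ) {n : ℕ}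
    (hdim : dimH (univ : Set X) = n) {E : Set X} (hE : IsExtremal κ E) {m : ℕ}
    (hEdim : dimH E ≤ m) {p : X} (hp : p ∈ E) (hs : ∀ δ > 0, Strained m δ p) {l : ℝ} (hl : 0 < l)
    (hl1 : l ≤ 1) : ∃ a : Fin m → Bool → X, ∃ r₀ > 0, ∀ r, 0 < r → r < r₀ →
      CoordGood E l r ((8 * m + 1) * r) (coord a p) p := by
  have hm0 : (0 : ℝ) ≤ m := by positivity
  set C : ℝ := 28 * (m + 2) ^ 2 * (8 * m + 1) ^ 2 with hC
  have hC1 : (8 * (m : ℝ) + 1) ^ 2 ≤ C := by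
    have : (1 : ℝ) ≤ 28 * (m + 2) ^ 2 := by nlinarith
    rw [hC]
    exact le_mul_of_one_le_left (by positivity) this
  have hC2 : 1 ≤ C := le_trans (by nlinarith) hC1
  set η := l / C with hη
  have hη0 : 0 < η := by positivity
  have hCη : C * η = l := by rw [hη]; field_simp
  have hηl : η ≤ l := by nlinarith
  have hη1 : η ≤ 1 := hηl.trans hl1
  obtain ⟨δ₁, hδ₁, h1⟩ := exists_good hX hη0 hη1
  obtain ⟨δ₂, hδ₂, h2⟩ := dist_sq_le_of_frame hX hdim hE hEdim hη0 hη1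
  obtain ⟨δ₃, hδ₃, h3⟩ := exists_open hX hE m
  obtain ⟨a, ha⟩ := hs (min δ₁ (min δ₂ δ₃)) (by positivity)
  obtain ⟨ρ, ⟨hG, hop⟩, hρ⟩ := (((h1 a p (ha.mono (min_le_left _ _))).and
    (h3 a p (ha.mono ((min_le_right _ _).trans (min_le_right _ _))))).and
      self_mem_nhdsWithin).exists
  replace hρ : 0 < ρ := hρ
  obtain ⟨ρ', hρ', hup⟩ := h2 a p (ha.mono ((min_le_right _ _).trans (min_le_left _ _)))
  refine ⟨a, min ρ ρ' / ((2 * m + 4) * (8 * m + 1)), by positivity, fun r hr hr0 => ?_⟩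
  rw [lt_div_iff₀ (by positivity)] at hr0
  have r1 := hr0.trans_le (min_le_left _ _)
  have r2 := hr0.trans_le (min_le_right _ _)
  set R := (8 * m + 1) * r with hR
  have hR0 : 0 < R := by positivity
  have hRρ : (2 * m + 4) * R ≤ ρ := by rw [hR]; linarith
  have hmR : 0 ≤ m * R := by positivity
  have hRρ' : R < ρ' := by rw [hR] at *; linarith
  have hup' : ∀ x ∈ E, dist p x ≤ R → dist p x ^ 2 ≤ ‖coord a p x‖ ^ 2 + η * dist p x ^ 2 := by
    intro x hx hxR
    rw [norm_coord_sq]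
    exact hup x hx (hxR.trans_lt hRρ')
  refine ⟨fun x hx hxR => (hup' x hx hxR).trans (by gcongr), fun x hx hxR =>
    (hup' x hx hxR).trans ?_, fun x y hx hy => ?_, fun v hv => ?_⟩
  · have : η * dist p x ^ 2 ≤ η * R ^ 2 := by gcongr
    have h4 : η * R ^ 2 ≤ l * r ^ 2 := by
      calc η * R ^ 2 = (8 * (m : ℝ) + 1) ^ 2 * (η * r ^ 2) := by rw [hR]; ring
        _ ≤ C * (η * r ^ 2) := by gcongr
        _ = l * r ^ 2 := by rw [← mul_assoc, hCη]
    linarith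
  · rw [norm_coord_sub_sq]
    refine (hG.bessel hX hη0 hη1 hR0 hRρ hx hy).trans (le_of_eq ?_)
    rw [← hCη, hR, hC]
    ring
  · have hsum : 4 * ∑ i, |dist p (a i true) - (dist p (a i true) - v i)| ≤ 8 * m * r := by
      have : ∑ i, |dist p (a i true) - (dist p (a i true) - v i)| ≤ ∑ i : Fin m, 2 * r :=
        Finset.sum_le_sum fun i _ => by
          rw [sub_sub_cancel]
          exact (PiLp.norm_apply_le v i).trans hv
      simp only [Finset.sum_const, Finset.card_univ, Fintype.card_fin, nsmul_eq_mul] at this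
      linarith
    obtain ⟨x, hx, hxd, hxv⟩ := hop p hp (fun i => dist p (a i true) - v i) R
      (by rw [dist_self]; linarith) (by linarith)
    refine ⟨x, hx, by linarith, ?_⟩
    ext i
    simp [coord, hxv i]

set_option maxHeartbeats 1000000 in
lemma isRegularPt_of_strained [ProperSpace X] (hX : IsAlexandrov X κ) {n : ℕ}
    (hdim : dimH (univ : Set X) = n) {E : Set X} (hE : IsExtremal κ E) {m : ℕ}
    (hEdim : dimH E ≤ m) {p : X} (hp : p ∈ E) (hs : ∀ δ > 0, Strained m δ p) :
    IsRegularPt E m p := by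
  intro ε₀ hε₀
  set ε := min ε₀ 1
  have hε : 0 < ε := by positivity
  have hεε : ε ≤ ε₀ := min_le_left _ _
  have hε1 : ε ≤ 1 := min_le_right _ _
  obtain ⟨δ, hδ, L, hL, hcore⟩ := core hX (ε := ε ^ 2 / 8) (by positivity)
  set μ := ε / 8 with hμ
  set θ := ε ^ 2 / 28 with hθ
  set l := min (ε ^ 2 / 64) (min (θ * μ ^ 2 / 4) (δ * μ ^ 2 / 5)) with hldef
  have hl : 0 < l := by positivity
  have l1 : l ≤ ε ^ 2 / 64 := min_le_left _ _
  have l2 : l ≤ θ * μ ^ 2 / 4 := (min_le_right _ _).trans (min_le_left _ _)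
  have l3 : l ≤ δ * μ ^ 2 / 5 := (min_le_right _ _).trans (min_le_right _ _)
  clear_value l
  have hε2 : ε ^ 2 ≤ 1 := by nlinarith
  have hθ1 : θ ≤ 1 := by linarith
  obtain ⟨a, r₁, hr₁, hgood⟩ := exists_coordGood hX hdim hE hEdim hp hs hl (by linarith)
  set f := coord a p with hf
  have hfp : f p = 0 := coord_self a p
  refine ⟨min r₁ (L / (8 * m + 1)), by positivity, fun r hr hrr => ⟨f, hfp, ?_, ?_⟩⟩
  all_goals
    have hG := hgood r hr (hrr.trans_le (min_le_left _ _))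
    have hRL := hrr.trans_le (min_le_right _ _)
    rw [lt_div_iff₀ (by positivity), mul_comm] at hRL
    set R := (8 * m + 1) * r with hR
    have hrR : r ≤ R := by
      have : 0 ≤ (8 * m) * r := by positivity
      rw [hR]
      linarith
    set e := l * r ^ 2 with he
    have he0 : 0 < e := by positivity
    have hnorm : ∀ x, dist p x ≤ R → ‖f x‖ ^ 2 ≤ dist p x ^ 2 + e := fun x hx => by
      have := hG.lower x p hx (by rw [dist_self]; linarith)
      rwa [hfp, sub_zero, dist_comm] at this
  · have root : ∀ {u v : ℝ}, 0 ≤ u → 0 ≤ v → u ^ 2 ≤ v ^ 2 + e → u ≤ v + ε / 8 * r := by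
      intro u v hu hv h
      refine abs_le_of_sq_le_sq' ?_ (by positivity) |>.2
      have h1 : e ≤ (ε / 8 * r) ^ 2 := by
        calc e ≤ ε ^ 2 / 64 * r ^ 2 := by rw [he]; gcongr
          _ = _ := by ring
      have h2 : 0 ≤ v * (ε / 8 * r) := by positivity
      nlinarith
    rintro x ⟨hxE, hxr⟩ y ⟨hyE, hyr⟩
    rw [mem_closedBall, dist_comm] at hxr hyr
    have hlow := root (norm_nonneg _) dist_nonneg (hG.lower x y (by linarith) (by linarith))
    have hεr : 0 < ε * r := by positivity
    have hεr' : ε * r ≤ ε₀ * r := by gcongr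
    have hxx := hG.upper' x hxE (by linarith)
    have hyy := hG.upper' y hyE (by linarith)
    suffices h : dist x y ≤ ‖f x - f y‖ + ε * r by
      rw [dist_eq_norm, abs_le]
      constructor <;> linarith
    have small : ∀ u v, dist p u < μ * r → dist p v ≤ R → dist p u ≤ R →
        dist p v ^ 2 ≤ ‖f v‖ ^ 2 + e → dist u v ≤ ‖f u - f v‖ + ε * r := by
      intro u v hu hv hu' hvv
      have h1 := root dist_nonneg (norm_nonneg _) hvv
      have h2 := root (norm_nonneg _) dist_nonneg (hnorm u hu')
      have h3 := dist_triangle_left u v p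
      have h4 := norm_sub_norm_le (f v) (f u)
      rw [norm_sub_rev] at h4
      rw [hμ] at hu
      linarith
    rcases lt_or_ge (dist p x) (μ * r) with hx0 | hx0
    · exact small x y hx0 (by linarith) (by linarith) hyy
    rcases lt_or_ge (dist p y) (μ * r) with hy0 | hy0
    · rw [dist_comm, norm_sub_rev]
      exact small y x hy0 (by linarith) (by linarith) hxx
    have hx1 : 0 < dist p x := lt_of_lt_of_le (by positivity) hx0
    have hy1 : 0 < dist p y := lt_of_lt_of_le (by positivity) hy0
    have hfx := hnorm x (by linarith)
    have hfy := hnorm y (by linarith)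
    obtain ⟨z, hzE, hzR, hz⟩ := hG.surj (-f x) (by
      rw [norm_neg]
      have := root (norm_nonneg _) dist_nonneg hfx
      nlinarith)
    have hzz := hG.upper' z hzE hzR
    have hfz := hnorm z hzR
    rw [hz, norm_neg] at hzz hfz
    have hA2 : (μ * r) ^ 2 ≤ dist p x ^ 2 := by gcongr
    have he1 : 4 * e ≤ θ * dist p x ^ 2 := by
      calc 4 * e ≤ 4 * (θ * μ ^ 2 / 4 * r ^ 2) := by rw [he]; gcongr
        _ = θ * (μ * r) ^ 2 := by ring
        _ ≤ _ := by gcongr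
    have he2 : 5 * e ≤ δ * dist p x ^ 2 := by
      calc 5 * e ≤ 5 * (δ * μ ^ 2 / 5 * r ^ 2) := by rw [he]; gcongr
        _ = δ * (μ * r) ^ 2 := by ring
        _ ≤ _ := by gcongr
    have he3 : 4 * e ≤ dist p x ^ 2 := he1.trans (by nlinarith [sq_nonneg (dist p x)])
    have hz1 : 0 < dist p z := lt_of_lt_of_le (by linarith)
      (half_le_of_sq dist_nonneg hxx hfz he3)
    have hopp : eang x p z ≤ -1 + δ := by
      change (dist p x ^ 2 + dist p z ^ 2 - dist x z ^ 2) / (2 * dist p x * dist p z) ≤ -1 + δ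
      refine opposite_algebra hx1 dist_nonneg hxx hzz hfz ?_ he3 hδ.le he2
      have := hG.lower x z (by linarith) hzR
      rw [hz, sub_neg_eq_add, ← two_smul ℝ, norm_smul, mul_pow] at this
      norm_num at this
      exact this
    have hc := hcore p x z y (dist_pos.1 hx1).symm (dist_pos.1 hz1).symm (dist_pos.1 hy1).symm
      (by linarith) (by linarith) (by linarith) hopp
    have hI := abs_real_inner_le_norm (f x) (f y)
    have hfin := upper_algebra (W := dist x y) (I := inner ℝ (f x) (f y))
      hx1 dist_nonneg hy1 hxr hyr
      hxx hfx hzz hfz hyy hfy (by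
        have := hG.lower z y hzR (by linarith)
        rw [hz, norm_sub_sq_real, norm_neg, inner_neg_left] at this
        linarith) (hI.trans (by nlinarith [sq_nonneg (‖f x‖ - ‖f y‖)])) he3 he1 (by positivity)
        (by positivity) hc
    have hns := norm_sub_sq_real (f x) (f y)
    refine abs_le_of_sq_le_sq' ?_ (by positivity) |>.2
    have h5 : e ≤ ε ^ 2 / 64 * r ^ 2 := by rw [he]; gcongr
    have h6 : θ * (2 * r ^ 2 + 5 * e) ≤ θ * (7 * r ^ 2) := by
      gcongr
      nlinarith [sq_nonneg r]
    have h7 : 0 ≤ ‖f x - f y‖ * (ε * r) := by positivity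
    have h8 : θ * (7 * r ^ 2) = ε ^ 2 / 4 * r ^ 2 := by rw [hθ]; ring
    have h9 : 0 ≤ ε ^ 2 * r ^ 2 := by positivity
    nlinarith
  · intro v hv
    rw [mem_closedBall, dist_zero_right] at hv
    have hl1 : l ≤ ε / 64 := by nlinarith
    have hn : ‖(1 - l) • v‖ = (1 - l) * ‖v‖ := by
      rw [norm_smul, Real.norm_of_nonneg (by linarith)]
    have hle : (1 - l) * ‖v‖ ≤ 1 * r := by gcongr; linarith
    obtain ⟨x, hxE, hxR, hx⟩ := hG.surj ((1 - l) • v) (by rw [hn]; linarith)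
    refine ⟨x, ⟨hxE, ?_⟩, ?_⟩
    · rw [mem_closedBall, dist_comm]
      refine abs_le_of_sq_le_sq' ?_ hr.le |>.2
      have h1 := hG.upper x hxE hxR
      rw [hx, hn, mul_pow] at h1
      have h2 : ‖v‖ ^ 2 ≤ r ^ 2 := by gcongr
      have h3 : (1 - l) ^ 2 * ‖v‖ ^ 2 ≤ (1 - l) * r ^ 2 := by
        have : (1 - l) ^ 2 ≤ 1 - l := by nlinarith
        gcongr
        linarith
      have h4 : (1 - l) * dist p x ^ 2 ≤ (1 - l) * r ^ 2 := by linarith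
      exact le_of_mul_le_mul_left h4 (by linarith)
    · rw [hx, dist_eq_norm, sub_smul, one_smul, sub_sub_cancel_left, norm_neg, norm_smul,
        Real.norm_of_nonneg hl.le]
      have : l ≤ ε₀ := by linarith
      gcongr

lemma dimH_diff_isRegularPt [ProperSpace X] (hX : IsAlexandrov X κ) {n : ℕ}
    (hdim : dimH (univ : Set X) = n) {E : Set X} (hE : IsExtremal κ E) {m : ℕ}
    (hEdim : dimH E ≤ m) : dimH (E \ {p | IsRegularPt E m p}) ≤ (m : ℝ≥0∞) - 1 := by
  have hsub : E \ {p | IsRegularPt E m p} ⊆ ⋃ j : ℕ, {p | ¬ Strained m (1 / (j + 1 : ℝ)) p} := by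
    rintro p ⟨hpE, hp⟩
    by_contra hcon
    simp only [mem_iUnion, mem_ofPred_eq, not_exists, not_not] at hcon
    refine hp (isRegularPt_of_strained hX hdim hE hEdim hpE fun δ hδ => ?_)
    obtain ⟨j, hj⟩ := exists_nat_one_div_lt hδ
    exact (hcon j).mono hj.le
  refine (dimH_mono hsub).trans ?_
  rw [dimH_iUnion]
  exact iSup_le fun j => dimH_not_strained hX hdim m (by positivity)

lemma isRegularPt_zero [ProperSpace X] (hX : IsAlexandrov X κ) {n : ℕ}
    (hdim : dimH (univ : Set X) = n) {E : Set X} (hE : IsExtremal κ E)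
    (hEdim : dimH E ≤ (0 : ℕ)) {p : X} (hp : p ∈ E) : IsRegularPt E 0 p :=
  isRegularPt_of_strained hX hdim hE hEdim hp fun δ _ => strained_zero δ p

lemma sh_ch_identity (s a b : ℝ) :
    sh κ s * ch κ b + sh κ (a - s) * ch κ (a - b) = sh κ a * ch κ (a - s - b) := by
  simp only [ch_sub, sh_sub]
  linear_combination (-sh κ s * ch κ b) * ch_sq (κ := κ) a

/-- The point `z` lies at distance `s` from `x` on a shortest path to `q`, and `y` is a point
of `E` nearest to `z`. -/
structure IsStep (E : Set X) (q : X) (s : ℝ) (x z y : X) : Prop where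
  dist_left : dist x z = s
  dist_right : dist z q = dist x q - s
  mem : y ∈ E
  nearest : ∀ v ∈ E, dist z y ≤ dist z v

lemma exists_isStep [ProperSpace X] (hX : IsAlexandrov X κ) {E : Set X} (hE : IsClosed E)
    (q : X) {s : ℝ} (hs : 0 ≤ s) {x : X} (hx : x ∈ E) (hxs : s ≤ dist x q) :
    ∃ z y, IsStep E q s x z y := by
  obtain ⟨z, h1, h2⟩ := exists_between hX x q hs hxs
  obtain ⟨y, hy, hzy⟩ := hE.exists_infDist_eq_dist ⟨x, hx⟩ z
  exact ⟨z, y, h1, h2, hy, fun v hv => hzy ▸ infDist_le_dist_of_mem hv⟩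

namespace IsStep

variable {E : Set X} {q : X} {s : ℝ} {x z y : X}

lemma dist_nearest_le (h : IsStep E q s x z y) (hx : x ∈ E) : dist z y ≤ s := by
  rw [← h.dist_left, dist_comm x z]
  exact h.nearest x hx

lemma dist_le (h : IsStep E q s x z y) (hx : x ∈ E) : dist x y ≤ 2 * s := by
  linarith [dist_triangle x z y, h.dist_left, h.dist_nearest_le hx]

lemma dist_target_le (h : IsStep E q s x z y) (hx : x ∈ E) : dist y q ≤ dist x q := by
  linarith [dist_triangle_left y q z, h.dist_right, h.dist_nearest_le hx]

lemma nonneg (h : IsStep E q s x z y) : 0 ≤ s := h.dist_left ▸ dist_nonneg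

lemma ch_le (h : IsStep E q s x z y) (hE : IsExtremal κ E) (hx : x ∈ E) (hs : s < scale κ) {v : X}
    (hv : dist y v < scale κ) : ch κ (dist z v) ≤ ch κ s * ch κ (dist y v) := by
  have h1 := h.dist_nearest_le hx
  refine (ch_le_of_nearest hE h.mem h.nearest (by rw [dist_comm]; linarith) hv).trans ?_
  exact mul_le_mul_of_nonneg_right (ch_le_ch dist_nonneg h1) (ch_pos _).le

lemma gain (h : IsStep E q s x z y) (hX : IsAlexandrov X κ) (hE : IsExtremal κ E) (hx : x ∈ E)
    {w : X} (hs : s < scale κ) (hq : dist x q < scale κ) (hz : dist z w < scale κ)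
    (hw : dist y w < scale κ) :
    sh κ (dist x q) * ch κ s * ch κ (dist x w) +
      sh κ s * (ch κ (dist q w) - ch κ (dist x q) * ch κ (dist x w)) ≤
      sh κ (dist x q) * ch κ s * ch κ (dist y w) := by
  have h0 := h.nonneg
  have hh := hinge hX (x := x) (y := q) (z := z) (a := w)
    (by rw [h.dist_left, h.dist_right]; ring) (by rw [dist_comm, h.dist_left]; exact hs)
    (by rw [h.dist_right]; linarith) hz
  rw [h.dist_left, h.dist_right, sh_sub] at hh
  have := mul_le_mul_of_nonneg_right (h.ch_le hE hx hs hw)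
    (sh_nonneg (κ := κ) (dist_nonneg (x := x) (y := q)))
  linarith

lemma pair (h : IsStep E q s x z y) (hX : IsAlexandrov X κ) (hE : IsExtremal κ E) (hx : x ∈ E)
    {x' z' y' : X} (h' : IsStep E q s x' z' y') (hx' : x' ∈ E) (hs : s < scale κ)
    (hq : dist x q < scale κ) (hq' : dist x' q < scale κ) (hz : dist z x' < scale κ)
    (hzz : dist z' z < scale κ) (hyz : dist y z' < scale κ) (hyy : dist y y' < scale κ) :
    sh κ (dist x q - s) * sh κ (dist x' q - s) * (ch κ (dist x x') - 1) ≤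
      sh κ (dist x q) * sh κ (dist x' q) * (ch κ s ^ 2 * ch κ (dist y y') - 1) := by
  have h0 := h.nonneg
  have hh := hinge hX (x := x) (y := q) (z := z) (a := x')
    (by rw [h.dist_left, h.dist_right]; ring) (by rw [dist_comm, h.dist_left]; exact hs)
    (by rw [h.dist_right]; linarith) hz
  have hh' := hinge hX (x := x') (y := q) (z := z') (a := z)
    (by rw [h'.dist_left, h'.dist_right]; ring) (by rw [dist_comm, h'.dist_left]; exact hs)
    (by rw [h'.dist_right]; linarith) hzz
  rw [h.dist_left, h.dist_right, dist_comm q x'] at hh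
  rw [h'.dist_left, h'.dist_right, dist_comm q z, h.dist_right, dist_comm x' z,
    dist_comm z' z] at hh'
  have e1 := h.ch_le hE hx hs hyz
  have e2 := h'.ch_le hE hx' hs (v := y) (by rwa [dist_comm])
  rw [dist_comm z' y, dist_comm y' y] at e2
  have i1 := sh_ch_identity (κ := κ) s (dist x q) (dist x' q)
  have i2 := sh_ch_identity (κ := κ) s (dist x' q) (dist x q - s)
  have n0 : s ≤ dist x q := by linarith [dist_nonneg (x := z) (y := q), h.dist_right]
  have n0' : s ≤ dist x' q := by linarith [dist_nonneg (x := z') (y := q), h'.dist_right]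
  generalize hα : dist x q = a at *
  generalize hα' : dist x' q = a' at *
  have ev : ∀ t : ℝ, ch κ (-t) = ch κ t := fun t => by simp [ch]
  rw [show a' - (a - s) = -(a - s - a') by ring, ev, show a' - s - (a - s) = -(a - a') by ring,
    ev] at i2
  have s1 : 0 ≤ sh κ (a - s) := sh_nonneg (by linarith)
  have s2 : 0 ≤ sh κ (a' - s) := sh_nonneg (by linarith)
  have s3 : sh κ (a - s) ≤ sh κ a := sh_le_sh (by linarith)
  have s4 : sh κ (a' - s) ≤ sh κ a' := sh_le_sh (by linarith)
  have s5 : 0 ≤ sh κ a := s1.trans s3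
  have s6 : 0 ≤ sh κ a' := s2.trans s4
  have m0 : sh κ (a - s) * sh κ (a' - s) ≤ sh κ a * sh κ a' := by gcongr
  have m1 := mul_le_mul_of_nonneg_left hh s2
  have m2 := mul_le_mul_of_nonneg_left hh' s5
  have m3 : ch κ (dist z z') ≤ ch κ s ^ 2 * ch κ (dist y y') := by
    have := mul_le_mul_of_nonneg_left e2 (ch_pos (κ := κ) s).le
    linarith
  have m4 := mul_le_mul_of_nonneg_left m3 (mul_nonneg s5 s6)
  have m5 := mul_nonneg (sub_nonneg.2 m0) (sub_nonneg.2 (one_le_ch (κ := κ) (a - a')))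
  have i1' := congrArg (fun t => sh κ (a' - s) * t) i1
  have i2' := congrArg (fun t => sh κ a * t) i2
  linarith

end IsStep

lemma exists_sh_eq {u : ℝ} (hu : 0 ≤ u) : ∃ s, 0 ≤ s ∧ sh κ s = u ∧ cmpK κ * s ≤ u := by
  have hk := cmpK_pos κ
  have h : cmpK κ * (arsinh u / cmpK κ) = arsinh u := by field_simp
  refine ⟨arsinh u / cmpK κ, div_nonneg (arsinh_nonneg_iff.2 hu) hk.le, ?_, ?_⟩
  · rw [sh, h, sinh_arsinh]
  · rw [h]
    calc arsinh u ≤ sinh (arsinh u) := self_le_sinh_iff.2 (arsinh_nonneg_iff.2 hu)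
      _ = u := sinh_arsinh u

lemma one_step_algebra {B u D D' : ℝ} (hu0 : 0 ≤ u) (hu1 : u ≤ 1) (hB : 0 ≤ B) (hD : 0 ≤ D)
    (h : (1 - B * u) ^ 2 * D ≤ (u ^ 2 + 1) * (1 + D') - 1) :
    (1 - (2 * B + 1) * u) * D - u ^ 2 ≤ D' := by
  have h1 : (1 - 2 * B * u) * D ≤ (1 - B * u) ^ 2 * D := by
    gcongr
    nlinarith [sq_nonneg (B * u)]
  have h2 : u ^ 2 ≤ u := by nlinarith
  have h3 : 0 ≤ (u - u ^ 2) * D := mul_nonneg (by linarith) hD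
  have h4 : 0 ≤ u ^ 2 * (2 * B * u + u) * D := by positivity
  have h5 : 0 ≤ u ^ 2 * u ^ 2 := by positivity
  have h6 : (u ^ 2 + 1) * ((1 - (2 * B + 1) * u) * D - u ^ 2) ≤ (u ^ 2 + 1) * D' := by
    nlinarith
  exact le_of_mul_le_mul_left h6 (by positivity)

/-- A map moving each point of `S` inside `E` not away from `q`, away from `w` by a definite
amount, and almost not contracting distances. -/
structure IsFlow (κ : ℝ) (E S : Set X) (q w : X) (d g b e : ℝ) (f : X → X) : Prop where
  mem : ∀ x ∈ S, f x ∈ E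
  dist_le : ∀ x ∈ S, dist (f x) q ≤ dist x q
  move : ∀ x ∈ S, dist x (f x) ≤ d
  gain : ∀ x ∈ S, ch κ (dist x w) + g ≤ ch κ (dist (f x) w)
  pair : ∀ x ∈ S, ∀ x' ∈ S, (1 - b) * (ch κ (dist x x') - 1) - e ≤ ch κ (dist (f x) (f x')) - 1

lemma exists_step_flow [ProperSpace X] (hX : IsAlexandrov X κ) {E : Set X} (hE : IsExtremal κ E)
    {p q w : X} (hpq : p ≠ q) (hq : dist p q ≤ scale κ / 4) (hw : dist p w ≤ scale κ / 4)
    (hqw : ch κ (dist p q) * ch κ (dist p w) < ch κ (dist q w)) :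
    ∃ ρ > 0, ∃ K > 0, ∃ β > 0, ∃ B > 0, ∃ u₀ > 0, ∀ u, 0 ≤ u → u ≤ u₀ →
      ∃ f : X → X, IsFlow κ E (E ∩ closedBall p ρ) q w (K * u) (β * u) (B * u) (u ^ 2) f := by
  have hk := cmpK_pos κ
  have hsc := scale_pos κ
  have hpq0 := dist_pos.2 hpq
  set γ := (ch κ (dist q w) - ch κ (dist p q) * ch κ (dist p w)) / 2 with hγ
  have hγ0 : 0 < γ := by linarith
  have hcont : Continuous fun x : X => ch κ (dist x q) * ch κ (dist x w) :=
    (continuous_ch.comp (continuous_id.dist continuous_const)).mul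
      (continuous_ch.comp (continuous_id.dist continuous_const))
  obtain ⟨δ, hδ, hball⟩ := Metric.eventually_nhds_iff_ball.1
    (hcont.tendsto p |>.eventually (gt_mem_nhds (show _ < ch κ (dist q w) - γ by linarith)))
  set ρ := min (δ / 2) (min (scale κ / 16) (dist p q / 2))
  have hρ : 0 < ρ := by positivity
  have hρ1 : ρ ≤ δ / 2 := min_le_left _ _
  have hρ2 : ρ ≤ scale κ / 16 := (min_le_right _ _).trans (min_le_left _ _)
  have hρ3 : ρ ≤ dist p q / 2 := (min_le_right _ _).trans (min_le_right _ _)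
  have hA : 0 < sh κ (scale κ / 2) := sh_pos (by positivity)
  have ha0 : 0 < sh κ (dist p q / 2) := sh_pos (by positivity)
  set B := ch κ (scale κ / 2) / sh κ (dist p q / 2) with hB
  have hB0 : 0 < B := div_pos (ch_pos _) ha0
  refine ⟨ρ, hρ, 2 / cmpK κ, by positivity, γ / (2 * sh κ (scale κ / 2)), by positivity,
    2 * B + 1, by positivity, min 1 (min (cmpK κ * ρ) (1 / B)), by positivity,
    fun u hu0 hu => ?_⟩
  have hu1 : u ≤ 1 := hu.trans (min_le_left _ _)
  have hu2 : u ≤ cmpK κ * ρ := hu.trans ((min_le_right _ _).trans (min_le_left _ _))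
  have hu3 : u ≤ 1 / B := hu.trans ((min_le_right _ _).trans (min_le_right _ _))
  rw [le_div_iff₀ hB0] at hu3
  obtain ⟨s, hs0, hs, hks⟩ := exists_sh_eq (κ := κ) hu0
  have hsρ : s ≤ ρ := le_of_mul_le_mul_left (hks.trans hu2) hk
  have hchs : ch κ s ≤ 2 := by nlinarith [ch_sq (κ := κ) s, one_le_ch (κ := κ) s]
  have key : ∀ x ∈ E ∩ closedBall p ρ, dist p q / 2 ≤ dist x q ∧ dist x q ≤ scale κ / 2 ∧
      dist x w ≤ scale κ / 2 ∧ ch κ (dist x q) * ch κ (dist x w) + γ ≤ ch κ (dist q w) := by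
    rintro x ⟨-, hx⟩
    rw [mem_closedBall] at hx
    have h1 := hball x (by rw [mem_ball]; linarith)
    refine ⟨?_, ?_, ?_, by linarith⟩
    · linarith [dist_triangle_left p q x]
    · linarith [dist_triangle x p q]
    · linarith [dist_triangle x p w]
  have hex : ∀ x, ∃ z y, x ∈ E ∩ closedBall p ρ → IsStep E q s x z y := by
    intro x
    by_cases hx : x ∈ E ∩ closedBall p ρ
    · obtain ⟨z, y, h⟩ := exists_isStep hX hE.1 q hs0 hx.1 (by linarith [(key x hx).1])
      exact ⟨z, y, fun _ => h⟩
    · exact ⟨x, x, fun h => absurd h hx⟩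
  choose Z f hf using hex
  have hsh : ∀ x ∈ E ∩ closedBall p ρ, (1 - B * u) * sh κ (dist x q) ≤ sh κ (dist x q - s) ∧
      0 < sh κ (dist x q) ∧ sh κ (dist x q) ≤ sh κ (scale κ / 2) := by
    intro x hx
    obtain ⟨k1, k2, -, -⟩ := key x hx
    have h1 : ch κ (dist x q) ≤ B * sh κ (dist x q) := by
      calc ch κ (dist x q) ≤ ch κ (scale κ / 2) := ch_le_ch dist_nonneg k2
        _ = B * sh κ (dist p q / 2) := by rw [hB]; field_simp
        _ ≤ _ := by gcongr; exact sh_le_sh k1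
    have h2 : 0 < sh κ (dist x q) := ha0.trans_le (sh_le_sh k1)
    refine ⟨?_, h2, sh_le_sh k2⟩
    rw [sh_sub, hs]
    have h3 := mul_le_mul_of_nonneg_right h1 hu0
    have h4 := mul_le_mul_of_nonneg_left (one_le_ch (κ := κ) s) h2.le
    linarith
  refine ⟨f, fun x hx => (hf x hx).mem, fun x hx => (hf x hx).dist_target_le hx.1,
    fun x hx => ?_, fun x hx => ?_, fun x hx x' hx' => ?_⟩
  · refine ((hf x hx).dist_le hx.1).trans ?_
    rw [div_mul_eq_mul_div, le_div_iff₀ hk]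
    linarith
  · obtain ⟨k1, k2, k3, k4⟩ := key x hx
    obtain ⟨-, h2, h3⟩ := hsh x hx
    have st := hf x hx
    have d1 := st.dist_le hx.1
    have hg := st.gain hX hE hx.1 (w := w) (by linarith) (by linarith)
      (by linarith [dist_triangle_left (Z x) w x, st.dist_left])
      (by linarith [dist_triangle_left (f x) w x])
    rw [hs] at hg
    have h5 : γ * u ≤ u * (ch κ (dist q w) - ch κ (dist x q) * ch κ (dist x w)) := by
      rw [mul_comm]
      gcongr
      linarith
    have h6 : sh κ (dist x q) * ch κ s ≤ 2 * sh κ (scale κ / 2) := by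
      rw [mul_comm]
      exact mul_le_mul hchs h3 h2.le zero_le_two
    have h7 : 0 < sh κ (dist x q) * ch κ s := mul_pos h2 (ch_pos _)
    have h8 : sh κ (dist x q) * ch κ s * (γ / (2 * sh κ (scale κ / 2)) * u) ≤ γ * u := by
      calc _ ≤ 2 * sh κ (scale κ / 2) * (γ / (2 * sh κ (scale κ / 2)) * u) := by gcongr
        _ = _ := by field_simp
    refine le_of_mul_le_mul_left ?_ h7
    linarith
  · obtain ⟨k1, k2, -, -⟩ := key x hx
    obtain ⟨k1', k2', -, -⟩ := key x' hx'
    obtain ⟨h1, h2, -⟩ := hsh x hx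
    obtain ⟨h1', h2', -⟩ := hsh x' hx'
    have st := hf x hx
    have st' := hf x' hx'
    have d1 := st.dist_le hx.1
    have d1' := st'.dist_le hx'.1
    have dxx : dist x x' ≤ 2 * ρ := by
      linarith [dist_triangle_right x x' p, mem_closedBall.1 hx.2, mem_closedBall.1 hx'.2]
    have dz : dist (Z x) x' ≤ 3 * ρ := by linarith [dist_triangle_left (Z x) x' x, st.dist_left]
    have dzz : dist (Z x') (Z x) ≤ 4 * ρ := by
      linarith [dist_triangle_left (Z x') (Z x) x', st'.dist_left, dist_comm x' (Z x)]
    have dyz : dist (f x) (Z x') ≤ 5 * ρ := by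
      linarith [dist_triangle (f x) (Z x) (Z x'), st.dist_nearest_le hx.1, dist_comm (f x) (Z x),
        dist_comm (Z x) (Z x')]
    have dyy : dist (f x) (f x') ≤ 6 * ρ := by
      linarith [dist_triangle (f x) (Z x') (f x'), st'.dist_nearest_le hx'.1]
    have hp := st.pair hX hE hx.1 st' hx'.1 (by linarith) (by linarith) (by linarith)
      (by linarith) (by linarith) (by linarith) (by linarith)
    rw [ch_sq, hs] at hp
    have hD : 0 ≤ ch κ (dist x x') - 1 := sub_nonneg.2 (one_le_ch _)
    refine one_step_algebra hu0 hu1 hB0.le hD ?_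
    have hBu : 0 ≤ 1 - B * u := by linarith
    rw [add_sub_cancel]
    have hnn : 0 ≤ sh κ (dist x q - s) := (mul_nonneg hBu h2.le).trans h1
    refine le_of_mul_le_mul_left ?_ (mul_pos h2 h2')
    refine le_trans ?_ hp
    calc _ = (1 - B * u) * sh κ (dist x q) * ((1 - B * u) * sh κ (dist x' q)) *
          (ch κ (dist x x') - 1) := by ring
      _ ≤ _ := by gcongr

lemma IsFlow.iterate {E : Set X} {p q w : X} {ρ d g b e : ℝ} {f : X → X}
    (hf : IsFlow κ E (E ∩ closedBall p ρ) q w d g b e f) (hb : b ≤ 1) (hb0 : 0 ≤ b) (he : 0 ≤ e)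
    (hd : 0 ≤ d) (N : ℕ) (hN : N * d ≤ ρ / 2) :
    IsFlow κ E (E ∩ closedBall p (ρ / 2)) q w (N * d) (N * g) (N * b) (N * e) f^[N] := by
  induction N with
  | zero =>
    constructor <;> simp +contextual
  | succ N ih =>
    push_cast at hN ⊢
    have hf' := ih (by linarith)
    have hin : ∀ x ∈ E ∩ closedBall p (ρ / 2), f^[N] x ∈ E ∩ closedBall p ρ := fun x hx => by
      refine ⟨hf'.mem x hx, ?_⟩
      have h1 := hf'.move x hx
      have h2 := mem_closedBall.1 hx.2
      rw [mem_closedBall]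
      linarith [dist_triangle_left (f^[N] x) p x]
    constructor
    · intro x hx
      rw [Function.iterate_succ_apply']
      exact hf.mem _ (hin x hx)
    · intro x hx
      rw [Function.iterate_succ_apply']
      exact (hf.dist_le _ (hin x hx)).trans (hf'.dist_le x hx)
    · intro x hx
      rw [Function.iterate_succ_apply']
      linarith [dist_triangle x (f^[N] x) (f (f^[N] x)), hf.move _ (hin x hx), hf'.move x hx]
    · intro x hx
      rw [Function.iterate_succ_apply']
      linarith [hf.gain _ (hin x hx), hf'.gain x hx]
    · intro x hx x' hx'
      rw [Function.iterate_succ_apply', Function.iterate_succ_apply']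
      have h1 := hf.pair _ (hin x hx) _ (hin x' hx')
      have h2 := mul_le_mul_of_nonneg_left (hf'.pair x hx x' hx') (sub_nonneg.2 hb)
      have h3 : 0 ≤ N * b * b * (ch κ (dist x x') - 1) :=
        mul_nonneg (by positivity) (sub_nonneg.2 (one_le_ch _))
      have h4 : 0 ≤ b * (N * e) := by positivity
      linarith

/-- For a point `w` in whose direction the distance to `q` does not decrease to first order, there
is a limiting flow. -/
lemma exists_flow [ProperSpace X] (hX : IsAlexandrov X κ) {E : Set X} (hE : IsExtremal κ E)
    {p q w : X} (hpq : p ≠ q) (hq : dist p q ≤ scale κ / 4) (hw : dist p w ≤ scale κ / 4)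
    (hqw : ch κ (dist p q) * ch κ (dist p w) < ch κ (dist q w)) {σ : ℝ} (hσ : 0 < σ) :
    ∃ ρ > 0, ∃ g > 0, ∃ f : X → X, IsFlow κ E (E ∩ closedBall p ρ) q w σ g (1 / 2) 0 f := by
  obtain ⟨ρ, hρ, K, hK, β, hβ, B, hB, u₀, hu₀, hstep⟩ := exists_step_flow hX hE hpq hq hw hqw
  set τ := min u₀ (min (1 / (2 * B)) (min (ρ / (2 * K)) (σ / K))) with hτ
  have hτ0 : 0 < τ := by positivity
  have t1 : τ ≤ u₀ := min_le_left _ _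
  have t2 : τ ≤ 1 / (2 * B) := (min_le_right _ _).trans (min_le_left _ _)
  have t3 : τ ≤ ρ / (2 * K) := (min_le_right _ _).trans ((min_le_right _ _).trans (min_le_left _ _))
  have t4 : τ ≤ σ / K := (min_le_right _ _).trans ((min_le_right _ _).trans (min_le_right _ _))
  clear_value τ
  rw [le_div_iff₀ (by positivity)] at t2 t3 t4
  have happ : ∀ N : ℕ, ∃ f : X → X, IsFlow κ E (E ∩ closedBall p (ρ / 2)) q w (K * τ) (β * τ)
      (B * τ) (τ ^ 2 * (1 / ((N : ℝ) + 1))) f := by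
    intro N
    have hN : (1 : ℝ) ≤ (N : ℝ) + 1 := by linarith [N.cast_nonneg (α := ℝ)]
    have hle : τ / (N + 1) ≤ τ := div_le_self hτ0.le hN
    have hpos : 0 < τ / (N + 1) := by positivity
    obtain ⟨f, hf⟩ := hstep (τ / (N + 1)) (by positivity) (hle.trans t1)
    have hBle : B * (τ / (N + 1)) ≤ B * τ := by gcongr
    have e0 : ∀ c : ℝ, ((N + 1 : ℕ) : ℝ) * (c * (τ / (N + 1))) = c * τ := fun c => by
      push_cast
      field_simp
    have := hf.iterate (by linarith) (by positivity) (by positivity) (by positivity) (N + 1)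
      (by rw [e0]; linarith)
    rw [e0, e0, e0] at this
    refine ⟨f^[N + 1], ?_⟩
    convert this using 1
    push_cast
    field_simp
  choose F hF using happ
  let U : Ultrafilter ℕ := Filter.hyperfilter ℕ
  have hU : (U : Filter ℕ) ≤ atTop := Nat.hyperfilter_le_atTop
  have hlim : ∀ x, ∃ y, x ∈ E ∩ closedBall p (ρ / 2) → Tendsto (fun N => F N x) U (𝓝 y) := by
    intro x
    by_cases hx : x ∈ E ∩ closedBall p (ρ / 2)
    · obtain ⟨y, -, hy⟩ := (isCompact_closedBall x (K * τ)).ultrafilter_le_nhds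
        (U.map fun N => F N x) (le_principal_iff.2 (Filter.mem_map.2 (univ_mem' fun N => by
          rw [mem_preimage, mem_closedBall, dist_comm]
          exact (hF N).move x hx)))
      exact ⟨y, fun _ => hy⟩
    · exact ⟨x, fun h => absurd h hx⟩
  choose f hf using hlim
  refine ⟨ρ / 2, by positivity, β * τ, by positivity, f, ?_, ?_, ?_, ?_, ?_⟩
  · exact fun x hx => hE.1.mem_of_tendsto (hf x hx) (Eventually.of_forall fun N => (hF N).mem x hx)
  · exact fun x hx => le_of_tendsto ((hf x hx).dist tendsto_const_nhds)
      (Eventually.of_forall fun N => (hF N).dist_le x hx)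
  · exact fun x hx => le_of_tendsto (tendsto_const_nhds.dist (hf x hx))
      (Eventually.of_forall fun N => ((hF N).move x hx).trans (by linarith))
  · exact fun x hx => ge_of_tendsto
      ((continuous_ch.tendsto _).comp ((hf x hx).dist tendsto_const_nhds))
      (Eventually.of_forall fun N => (hF N).gain x hx)
  · intro x hx x' hx'
    have h1 : Tendsto (fun N : ℕ => τ ^ 2 * (1 / ((N : ℝ) + 1))) U (𝓝 0) := by
      simpa using (tendsto_one_div_add_atTop_nhds_zero_nat.const_mul (τ ^ 2)).mono_left hU
    refine le_of_tendsto_of_tendsto (tendsto_const_nhds.sub h1)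
      (((continuous_ch.tendsto _).comp ((hf x hx).dist (hf x' hx'))).sub_const 1)
      (Eventually.of_forall fun N => ?_)
    have h2 := (hF N).pair x hx x' hx'
    have h3 : (1 / 2) * (ch κ (dist x x') - 1) ≤ (1 - B * τ) * (ch κ (dist x x') - 1) := by
      refine mul_le_mul_of_nonneg_right (by linarith) (sub_nonneg.2 (one_le_ch _))
    simp only [Function.comp]
    linarith

lemma exists_ch_mul_lt (κ : ℝ) {c : ℝ} (hc : 0 < c) : ∃ L > 0, ∀ t, 0 < t → t ≤ L →
    ch κ (2 / c * t) * ch κ t < ch κ ((2 / c + c) * t) := by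
  have hk := cmpK_pos κ
  obtain ⟨L, hL, h⟩ := exists_cosh_bound κ (ε := 2) zero_lt_two
  refine ⟨min (c / 2 * L) (1 / cmpK κ), by positivity, fun t ht htL => ?_⟩
  have h1 : 2 / c * t ≤ L := by
    rw [div_mul_eq_mul_div, div_le_iff₀ hc]
    linarith [htL.trans (min_le_left _ _)]
  have h2 : cmpK κ * t ≤ 1 := by
    rw [mul_comm, ← le_div_iff₀ hk]
    exact htL.trans (min_le_right _ _)
  have h3 : ch κ (2 / c * t) < 2 := by
    nlinarith [h _ (by positivity) h1, one_le_ch (κ := κ) (2 / c * t)]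
  have h4 : ch κ t - 1 ≤ (cmpK κ * t) ^ 2 := by
    have e1 : ch κ t ≤ exp ((cmpK κ * t) ^ 2 / 2) := cosh_le_exp_half_sq _
    have hy : (cmpK κ * t) ^ 2 ≤ 1 := pow_le_one₀ (by positivity) h2
    set y := (cmpK κ * t) ^ 2
    have hy0 : 0 ≤ y := by positivity
    have e2 : exp (y / 2) * (1 - y / 2) ≤ 1 := by
      calc exp (y / 2) * (1 - y / 2) ≤ exp (y / 2) * exp (-(y / 2)) := by
            gcongr
            exact one_sub_le_exp_neg _
        _ = 1 := by rw [← exp_add, add_neg_cancel, exp_zero]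
    nlinarith [exp_pos (y / 2)]
  have h5 : 2 * (cmpK κ * t) ^ 2 ≤ sh κ (2 / c * t) * sh κ (c * t) := by
    calc 2 * (cmpK κ * t) ^ 2 = (cmpK κ * (2 / c * t)) * (cmpK κ * (c * t)) := by field_simp
      _ ≤ _ := mul_le_mul (self_le_sinh_iff.2 (by positivity)) (self_le_sinh_iff.2 (by positivity))
        (by positivity) (sh_nonneg (by positivity))
  rw [add_mul, ch_add]
  have h6 : ch κ (2 / c * t) * 1 ≤ ch κ (2 / c * t) * ch κ (c * t) :=
    mul_le_mul_of_nonneg_left (one_le_ch _) (ch_pos _).le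
  have h7 : 0 < (cmpK κ * t) ^ 2 := by positivity
  have h8 := mul_le_mul_of_nonneg_left h4 (ch_pos (κ := κ) (2 / c * t)).le
  have h9 := mul_lt_mul_of_pos_right h3 h7
  linarith

lemma le_of_ch_le {a b : ℝ} (hb : 0 ≤ b) (h : ch κ a ≤ ch κ b) : a ≤ b := by
  by_contra! hlt
  exact absurd h (not_le.2 (ch_lt_ch hb hlt))

lemma half_le_of_ch {a b : ℝ} (hb : 0 ≤ b) (h : 1 / 2 * (ch κ a - 1) ≤ ch κ b - 1) :
    1 / 2 * a ≤ b := by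
  refine le_of_ch_le (κ := κ) hb ?_
  have h1 := ch_add (κ := κ) (1 / 2 * a) (1 / 2 * a)
  rw [show 1 / 2 * a + 1 / 2 * a = a by ring] at h1
  nlinarith [ch_sq (κ := κ) (1 / 2 * a), one_le_ch (κ := κ) (1 / 2 * a)]

lemma IsFlow.dimH_le {E S T : Set X} {q w : X} {d g : ℝ} {f : X → X}
    (hf : IsFlow κ E S q w d g (1 / 2) 0 f) (hST : ∀ x ∈ S, f x ∈ T) : dimH S ≤ dimH T := by
  refine (dimH_le_image_of_dist one_half_pos fun x hx y hy => ?_).trans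
    (dimH_mono (image_subset_iff.2 hST))
  refine half_le_of_ch (κ := κ) dist_nonneg ?_
  have := hf.pair x hx y hy
  linarith

lemma IsFlow.mono {E S S' : Set X} {q w : X} {d g b e : ℝ} {f : X → X}
    (hf : IsFlow κ E S q w d g b e f) (h : S' ⊆ S) : IsFlow κ E S' q w d g b e f :=
  ⟨fun x hx => hf.mem x (h hx), fun x hx => hf.dist_le x (h hx), fun x hx => hf.move x (h hx),
    fun x hx => hf.gain x (h hx), fun x hx y hy => hf.pair x (h hx) y (h hy)⟩

/-- The points of `E` all of whose neighbourhoods in `E` have dimension above `d`. -/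
def dimCore (E : Set X) (d : ℝ≥0∞) : Set X := {x | x ∈ E ∧ ∀ r > 0, ¬ dimH (E ∩ ball x r) ≤ d}

lemma dimH_diff_dimCore [SecondCountableTopology X] (E : Set X) (d : ℝ≥0∞) :
    dimH (E \ dimCore E d) ≤ d := by
  refine dimH_le_of_local fun x hx => ?_
  obtain ⟨r, hr, h⟩ : ∃ r > 0, dimH (E ∩ ball x r) ≤ d := by
    by_contra! hcon
    exact hx.2 ⟨hx.1, fun r hr => not_le.2 (hcon r hr)⟩
  exact ⟨E ∩ ball x r, inter_mem (mem_of_superset self_mem_nhdsWithin sdiff_subset)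
    (mem_nhdsWithin_of_mem_nhds (ball_mem_nhds x hr)), h⟩

lemma isClosed_dimCore {E : Set X} (hE : IsClosed E) (d : ℝ≥0∞) : IsClosed (dimCore E d) := by
  refine isClosed_of_closure_subset fun x hx => ?_
  refine ⟨hE.closure_subset_iff.2 (fun y hy => hy.1) hx, fun r hr h => ?_⟩
  obtain ⟨y, hy, hxy⟩ := Metric.mem_closure_iff.1 hx (r / 2) (by positivity)
  refine hy.2 (r / 2) (by positivity) ((dimH_mono ?_).trans h)
  exact inter_subset_inter_right _ (ball_subset_ball' (by rw [dist_comm]; linarith))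

/-- On the prolongation of a shortest path, a point is determined by its distances. -/
lemma eq_of_dist_le (hX : IsAlexandrov X κ) {x y z a : X} {t : ℝ} (hxz : dist x z = t)
    (hzy : dist z y = t) (hxy : dist x y = 2 * t) (ht : 0 < t) (hts : t < scale κ)
    (hza : dist z a ≤ t) (hxa : 2 * t ≤ dist x a) : a = y := by
  have h := hinge hX (x := x) (y := y) (z := z) (a := a) (by linarith)
    (by rwa [dist_comm, hxz]) (by rwa [hzy]) (by linarith)
  rw [hxz, hzy, hxy, two_mul, sh_add] at h
  have hs := sh_pos (κ := κ) ht
  have h1 : ch κ (dist z a) ≤ ch κ t := ch_le_ch dist_nonneg hza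
  have h2 : ch κ t * ch κ t + sh κ t * sh κ t ≤ ch κ (dist x a) := by
    rw [← ch_add]
    exact ch_le_ch (by linarith) (by linarith)
  have h3 : 0 ≤ sh κ t * ch κ t := mul_nonneg hs.le (ch_pos _).le
  have h4 : sh κ t * ch κ (dist y a) ≤ sh κ t * ch κ 0 := by
    have := mul_le_mul_of_nonneg_left h2 hs.le
    have := mul_le_mul_of_nonneg_right h1 h3
    have := congrArg (fun v => sh κ t * v) (ch_sq (κ := κ) t)
    rw [ch_zero]
    linarith
  exact (dist_le_zero.1 (le_of_ch_le le_rfl (le_of_mul_le_mul_left h4 hs))).symm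

lemma isExtremal_dimCore [ProperSpace X] (hX : IsAlexandrov X κ) {E : Set X}
    (hE : IsExtremal κ E) (d : ℝ≥0∞) : IsExtremal κ (dimCore E d) := by
  refine ⟨isClosed_dimCore hE.1 d, fun q hq p hp hmin => ?_⟩
  have hqp : q ≠ p := fun h => hq (h ▸ hp)
  have hpq0 := dist_pos.2 hqp.symm
  have hsc := scale_pos κ
  by_contra hcrit
  have hcon := mt (isCriticalPt_of_forall hX hqp) hcrit
  push Not at hcon
  obtain ⟨c, hc, hy⟩ := hcon
  obtain ⟨ρ₀, hρ₀, hloc⟩ : ∃ ρ₀ > 0, ∀ y ∈ dimCore E d, dist p y < ρ₀ → dist q p ≤ dist q y := by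
    obtain ⟨ρ₀, hρ₀, h⟩ := Metric.eventually_nhds_iff.1 (eventually_nhdsWithin_iff.1 hmin)
    exact ⟨ρ₀, hρ₀, fun y hy hpy => h (by rwa [dist_comm]) hy⟩
  obtain ⟨L, hL, hch⟩ := exists_ch_mul_lt κ hc
  obtain ⟨w, hw0, hwη, hqw⟩ := hy (min L (min (scale κ / 4)
    (min (c / 2 * (scale κ / 4)) (c / 2 * (dist p q / 2))))) (by positivity)
  set l := dist p w
  rw [lt_min_iff, lt_min_iff, lt_min_iff] at hwη
  obtain ⟨w1, w2, w3, w4⟩ := hwη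
  set t := 2 / c * l with ht
  have hl : l = c / 2 * t := by rw [ht]; field_simp
  have hc2 : 0 < c / 2 := by positivity
  have ht0 : 0 < t := by positivity
  have t1 : t < scale κ / 4 := lt_of_mul_lt_mul_left (hl ▸ w3) hc2.le
  have t2 : t < dist p q / 2 := lt_of_mul_lt_mul_left (hl ▸ w4) hc2.le
  obtain ⟨q₂, h21, h22⟩ := exists_between hX p q (t := 2 * t) (by positivity) (by linarith)
  obtain ⟨q₁, h11, h12⟩ := exists_between hX p q₂ (t := t) (by positivity) (by linarith)
  have hq₁q : dist q₁ q ≤ dist p q - t := by linarith [dist_triangle q₁ q₂ q]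
  have hstrict : ch κ (dist p q₁) * ch κ (dist p w) < ch κ (dist q₁ w) := by
    rw [h11]
    refine (hch l hw0 w1.le).trans_le (ch_le_ch (by positivity) ?_)
    rw [add_mul, ← ht]
    linarith [dist_triangle_left q w q₁, dist_comm p q]
  obtain ⟨ρ, hρ, g, hg, f, hf⟩ := exists_flow hX hE (dist_pos.1 (h11 ▸ ht0)) (by linarith)
    w2.le hstrict (half_pos hρ₀)
  obtain ⟨ρ₁, hρ₁, hcont⟩ := Metric.eventually_nhds_iff_ball.1
    ((continuous_ch (κ := κ).comp (continuous_id.dist (continuous_const (y := w)))).tendsto p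
      |>.eventually (lt_mem_nhds (show ch κ (dist p w) - g / 2 < ch κ (dist p w) by linarith)))
  have hreach : ∀ r, 0 < r → r ≤ ρ → ∃ x ∈ E ∩ ball p r, f x ∈ dimCore E d := by
    intro r hr hrρ
    by_contra! hno
    have hfr := hf.mono (inter_subset_inter_right E (ball_subset_closedBall.trans
      (closedBall_subset_closedBall hrρ)) : E ∩ ball p r ⊆ _)
    exact hp.2 r hr ((hfr.dimH_le (T := E \ dimCore E d) fun x hx =>
      ⟨hfr.mem x hx, hno x hx⟩).trans (dimH_diff_dimCore E d))
  set K := dimCore E d ∩ closedBall p (3 / 4 * ρ₀) ∩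
    {y | ch κ (dist p w) + g / 2 ≤ ch κ (dist y w)} with hK
  have hKc : IsCompact K := by
    rw [hK, inter_assoc]
    refine (((isCompact_closedBall p _).inter_right ?_).inter_left (isClosed_dimCore hE.1 d))
    exact isClosed_le continuous_const
      (continuous_ch.comp (continuous_id.dist continuous_const))
  have hfK : ∀ r, 0 < r → ∃ y ∈ K, dist y q₁ ≤ dist p q₁ + r := by
    intro r hr
    set r' := min r (min ρ (min (ρ₀ / 4) ρ₁))
    have m1 : r' ≤ r := min_le_left _ _
    have m2 : r' ≤ ρ := (min_le_right _ _).trans (min_le_left _ _)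
    have m3 : r' ≤ ρ₀ / 4 := (min_le_right _ _).trans ((min_le_right _ _).trans (min_le_left _ _))
    have m4 : r' ≤ ρ₁ := (min_le_right _ _).trans ((min_le_right _ _).trans (min_le_right _ _))
    obtain ⟨x, ⟨hxE, hxr⟩, hfx⟩ := hreach r' (by positivity) m2
    have hxS : x ∈ E ∩ closedBall p ρ := ⟨hxE, ball_subset_closedBall (ball_subset_ball m2 hxr)⟩
    have hx1 := mem_ball.1 hxr
    refine ⟨f x, ⟨⟨hfx, ?_⟩, ?_⟩, ?_⟩
    · rw [mem_closedBall]
      linarith [dist_triangle_left (f x) p x, hf.move x hxS]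
    · have h1 := hf.gain x hxS
      have h2 := hcont x (ball_subset_ball m4 hxr)
      simp only [Function.comp, id] at h2
      rw [mem_ofPred_eq]
      linarith
    · linarith [hf.dist_le x hxS, dist_triangle x p q₁]
  obtain ⟨y₀, hy₀, -⟩ := hfK 1 one_pos
  obtain ⟨y, hyK, hymin⟩ := hKc.exists_isMinOn ⟨y₀, hy₀⟩
    (continuous_id.dist (continuous_const (y := q₁))).continuousOn
  have hyq : dist y q₁ ≤ t := by
    rw [← h11]
    refine le_of_forall_pos_le_add fun r hr => ?_
    obtain ⟨v, hv, hvr⟩ := hfK r hr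
    exact (hymin hv).trans hvr
  have hyq' := hloc y hyK.1.1 (by
    have := mem_closedBall.1 hyK.1.2
    rw [dist_comm]
    linarith)
  have hyp : y = p := by
    refine eq_of_dist_le hX (x := q₂) (z := q₁) (t := t) (by rw [dist_comm]; linarith)
      (by rw [dist_comm]; linarith) (by rw [dist_comm]; linarith) ht0 (by linarith)
      (by rwa [dist_comm]) ?_
    linarith [dist_triangle_left q y q₂, dist_comm p q]
  have hfin : ch κ (dist p w) + g / 2 ≤ ch κ (dist y w) := hyK.2
  rw [hyp] at hfin
  linarith

lemma subset_closure_isRegularPt (hX : IsAlexandrov X κ) {n : ℕ}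
    (hdim : dimH (univ : Set X) = n) {E : Set X} {m : ℕ} (hE : IsPrimitiveExtremal κ E)
    (hEdim : dimH E = m) : E ⊆ closure {p | p ∈ E ∧ IsRegularPt E m p} := by
  have := properSpace hX hdim
  rcases Nat.eq_zero_or_pos m with rfl | hm
  · exact fun p hp => subset_closure ⟨hp, isRegularPt_zero hX hdim hE.1 hEdim.le hp⟩
  have hlt : (m : ℝ≥0∞) - 1 < m :=
    ENNReal.sub_lt_self (ENNReal.natCast_ne_top m) (by exact_mod_cast hm.ne') one_ne_zero
  obtain ⟨δ, hδ, hbig⟩ := exists_le_dimH hX hE.1 m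
  obtain ⟨p, hpE, hp⟩ : ∃ p ∈ E, Strained m δ p := by
    by_contra! hcon
    have := (dimH_mono (show E ⊆ {p | ¬ Strained m δ p} from hcon)).trans
      (dimH_not_strained hX hdim m hδ)
    exact absurd this (not_le.2 (hEdim ▸ hlt))
  obtain ⟨r, hr, hball⟩ := Metric.eventually_nhds_iff_ball.1 (hbig p hp)
  have hsub : ball p r ∩ E ⊆ dimCore E (m - 1) := fun x hx =>
    ⟨hx.2, fun s hs h => absurd ((hball x hx.1 hx.2 s hs).trans h) (not_le.2 hlt)⟩
  have hcore : dimCore E (m - 1) = E := by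
    by_contra hne
    exact hE.2 _ (isExtremal_dimCore hX hE.1 _) (fun x hx => hx.1) hne p
      (hsub ⟨mem_ball_self hr, hpE⟩) ⟨r, hr, hsub⟩
  intro x hx
  rw [← hcore] at hx
  refine Metric.mem_closure_iff.2 fun ε hε => ?_
  by_contra! hno
  refine hx.2 ε hε ((dimH_mono ?_).trans (dimH_diff_isRegularPt hX hdim hE.1 hEdim.le))
  rintro y ⟨hyE, hy⟩
  refine ⟨hyE, fun hreg => ?_⟩
  have := hno y ⟨hyE, hreg⟩
  rw [mem_ball, dist_comm] at hy
  linarith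

end Alexandrov

/-- regular points of an `m`-dimensional primitive extremal subset are
dense, and the non-regular set has Hausdorff dimension at most `m - 1`. -/
theorem stmt7 {X : Type*} [MetricSpace X] (κ : ℝ) (hX : IsAlexandrov X κ)
    (n : ℕ) (hdim : dimH (Set.univ : Set X) = n)
    (E : Set X) (m : ℕ) (hE : IsPrimitiveExtremal κ E) (hEdim : dimH E = m) :
    E ⊆ closure {p | p ∈ E ∧ IsRegularPt E m p} ∧
    dimH (E \ {p | IsRegularPt E m p}) ≤ (m : ℝ≥0∞) - 1 := by
  have := Alexandrov.properSpace hX hdim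
  exact ⟨Alexandrov.subset_closure_isRegularPt hX hdim hE hEdim,
    Alexandrov.dimH_diff_isRegularPt hX hdim hE.1 hEdim.le⟩
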